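/- Assume f satisfies the basic assumptions and hypothesis (H), with p the unique space-time periodic positive solution. Then there exist constants c*₋ > 0 and c*₊ > 0 with the following property: for every g₀ < h₀, every u₀ ∈ H(g₀,h₀) with u₀(x) ≤ p(0,x) on [g₀,h₀], and every classical solution (u,g,h) of the free boundary problem (1.1) with this initial data (u extended by 0 outside [g(t),h(t)]) such that h(t) → +∞ and g(t) → −∞ as t → ∞ and |u(t,x) − p(t,x)| → 0 as t → ∞ locally uniformly in x ∈ ℝ, one has: (a) for all c₁, c₂ with −c*₋ < −c₂ < c₁ < c*₊, sup over −c₂t ≤ x ≤ c₁t of |u(t,x) − p(t,x)| tends to 0 as t → ∞; (b) g(t)/t → −c*₋ and h(t)/t → c*₊ as t → ∞. -/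

import Mathlib

open Filter Topology Set

noncomputable section

/-- `u` solves `u_t = d u_xx + f(t,x,u)` classically at every point `(t,x)` of the set `s`:
the spatial function is twice differentiable there and the time derivative exists and
equals `d u_xx + f(t,x,u)`. -/
def SolvesPDE (d : ℝ) (f : ℝ → ℝ → ℝ → ℝ) (u : ℝ → ℝ → ℝ) (s : Set (ℝ × ℝ)) : Prop :=
  ∀ q ∈ s,
    DifferentiableAt ℝ (u q.1) q.2 ∧
    DifferentiableAt ℝ (deriv (u q.1)) q.2 ∧
    HasDerivAt (fun t => u t q.2)
      (d * deriv (deriv (u q.1)) q.2 + f q.1 q.2 (u q.1 q.2)) q.1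

/-- Basic assumptions on the reaction term `f(t,x,u)` (for `u ≥ 0`): continuity,
Hölder continuity of class `C^{α/2,α}` in `(t,x)` locally uniformly in `u`,
`C¹` in `u` uniformly in `(t,x)`, `f(t,x,0) = 0`, nonpositivity for large `u`,
and space-time periodicity. -/
structure BasicAssumptions (ω L : ℝ) (f : ℝ → ℝ → ℝ → ℝ) : Prop where
  cont : ContinuousOn (fun q : ℝ × ℝ × ℝ => f q.1 q.2.1 q.2.2) {q : ℝ × ℝ × ℝ | 0 ≤ q.2.2}
  holder : ∃ α ∈ Set.Ioo (0:ℝ) 1, ∀ R > 0, ∃ C > 0, ∀ t s x y u : ℝ,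
    0 ≤ u → u ≤ R → |f t x u - f s y u| ≤ C * (|t - s| ^ (α / 2) + |x - y| ^ α)
  c1 : ∃ fu : ℝ → ℝ → ℝ → ℝ,
    (∀ t x u : ℝ, 0 ≤ u → HasDerivWithinAt (fun w => f t x w) (fu t x u) (Set.Ici 0) u) ∧
    ∀ ε > 0, ∃ δ > 0, ∀ t x u v : ℝ, 0 ≤ u → 0 ≤ v → |u - v| ≤ δ →
      |fu t x u - fu t x v| ≤ ε
  zero : ∀ t x : ℝ, f t x 0 = 0
  neg_large : ∃ M > 0, ∀ t x u : ℝ, M ≤ u → f t x u ≤ 0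
  per_t : ∀ t x u : ℝ, 0 ≤ u → f (t + ω) x u = f t x u
  per_x : ∀ t x u : ℝ, 0 ≤ u → f t (x + L) u = f t x u

/-- A bounded classical solution of the Cauchy problem
`v_t = d v_xx + f(t,x,v)` on `(0,∞) × ℝ` with initial datum `v₀`. -/
structure IsCauchySolution (d : ℝ) (f : ℝ → ℝ → ℝ → ℝ) (v₀ : ℝ → ℝ) (v : ℝ → ℝ → ℝ) : Prop where
  init : ∀ x, v 0 x = v₀ x
  cont : ContinuousOn (fun q : ℝ × ℝ => v q.1 q.2) {q : ℝ × ℝ | 0 ≤ q.1}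
  pde : SolvesPDE d f v {q : ℝ × ℝ | 0 < q.1}
  bdd : ∃ C, ∀ t ≥ (0:ℝ), ∀ x, |v t x| ≤ C

/-- Hypothesis (H): `p` is the unique positive space-time periodic solution of
`p_t = d p_xx + f(t,x,p)`, and every bounded solution of the Cauchy problem with
initial datum bounded below by a positive constant converges to `p` uniformly. -/
structure HypH (d ω L : ℝ) (f : ℝ → ℝ → ℝ → ℝ) (p : ℝ → ℝ → ℝ) : Prop where
  pos : ∀ t x, 0 < p t x
  per_t : ∀ t x, p (t + ω) x = p t x
  per_x : ∀ t x, p t (x + L) = p t x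
  sol : SolvesPDE d f p Set.univ
  uniq : ∀ q : ℝ → ℝ → ℝ, (∀ t x, 0 < q t x) → (∀ t x, q (t + ω) x = q t x) →
    (∀ t x, q t (x + L) = q t x) → SolvesPDE d f q Set.univ → q = p
  conv : ∀ v₀ : ℝ → ℝ, Continuous v₀ → (∃ C, ∀ x, |v₀ x| ≤ C) →
    (∃ ε > 0, ∀ x, ε ≤ v₀ x) →
    ∀ v : ℝ → ℝ → ℝ, IsCauchySolution d f v₀ v →
    ∀ ε > 0, ∃ S, ∀ s ≥ S, ∀ t ≥ (0:ℝ), ∀ x : ℝ, |v (t + s) x - p (t + s) x| ≤ ε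

/-- The class `H(g₀,h₀)` of admissible initial data on `[g₀,h₀]`. -/
def memH (g₀ h₀ : ℝ) (φ : ℝ → ℝ) : Prop :=
  ContinuousOn φ (Set.Icc g₀ h₀) ∧ φ g₀ = 0 ∧ φ h₀ = 0 ∧ ∀ x ∈ Set.Ioo g₀ h₀, 0 < φ x

/-- A classical solution `(u, g, h)` of the free boundary problem (1.1) with
Stefan constant `μ` and initial data `u₀ ∈ H(g₀,h₀)`, with `u` extended by `0`
outside `[g(t), h(t)]`. -/
structure IsFBPSolution (d μ : ℝ) (f : ℝ → ℝ → ℝ → ℝ) (g₀ h₀ : ℝ) (u₀ : ℝ → ℝ)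
    (u : ℝ → ℝ → ℝ) (g h : ℝ → ℝ) : Prop where
  g_init : g 0 = g₀
  h_init : h 0 = h₀
  g_smooth : ContDiffOn ℝ 1 g (Set.Ici 0)
  h_smooth : ContDiffOn ℝ 1 h (Set.Ici 0)
  u_cont : ContinuousOn (fun q : ℝ × ℝ => u q.1 q.2)
    {q : ℝ × ℝ | 0 ≤ q.1 ∧ g q.1 ≤ q.2 ∧ q.2 ≤ h q.1}
  pde : SolvesPDE d f u {q : ℝ × ℝ | 0 < q.1 ∧ g q.1 < q.2 ∧ q.2 < h q.1}
  bc_left : ∀ t > (0:ℝ), u t (g t) = 0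
  bc_right : ∀ t > (0:ℝ), u t (h t) = 0
  stefan_left : ∀ t > (0:ℝ),
    HasDerivAt g (-μ * derivWithin (u t) (Set.Ici (g t)) (g t)) t
  stefan_right : ∀ t > (0:ℝ),
    HasDerivAt h (-μ * derivWithin (u t) (Set.Iic (h t)) (h t)) t
  init : ∀ x ∈ Set.Icc g₀ h₀, u 0 x = u₀ x
  ext : ∀ t ≥ (0:ℝ), ∀ x : ℝ, (x < g t ∨ h t < x) → u t x = 0

/-- The conclusion of Theorem 1.1 with leftward speed `cminus` and rightward speed `cplus`:
every solution of the free boundary problem that spreads (fronts go to `±∞` and `u → p`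
locally uniformly) spreads with these speeds. -/
def Theorem11Conclusion (d μ : ℝ) (f : ℝ → ℝ → ℝ → ℝ) (p : ℝ → ℝ → ℝ)
    (cminus cplus : ℝ) : Prop :=
  ∀ (g₀ h₀ : ℝ), g₀ < h₀ → ∀ u₀ : ℝ → ℝ, memH g₀ h₀ u₀ →
    (∀ x ∈ Set.Icc g₀ h₀, u₀ x ≤ p 0 x) →
    ∀ (u : ℝ → ℝ → ℝ) (g h : ℝ → ℝ), IsFBPSolution d μ f g₀ h₀ u₀ u g h →
    Tendsto h atTop atTop → Tendsto g atTop atBot →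
    (∀ A > (0:ℝ), ∀ ε > 0, ∃ T, ∀ t ≥ T, ∀ x ∈ Set.Icc (-A) A, |u t x - p t x| ≤ ε) →
    (∀ c₁ c₂ : ℝ, -cminus < -c₂ → -c₂ < c₁ → c₁ < cplus →
        ∀ ε > 0, ∃ T, ∀ t ≥ T, ∀ x ∈ Set.Icc (-c₂ * t) (c₁ * t), |u t x - p t x| ≤ ε) ∧
    Tendsto (fun t => g t / t) atTop (𝓝 (-cminus)) ∧
    Tendsto (fun t => h t / t) atTop (𝓝 cplus)


/-- `φ` is twice differentiable at `x` with second derivative `a`. -/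
def C2At (φ : ℝ → ℝ) (x a : ℝ) : Prop :=
  (∀ᶠ y in 𝓝 x, DifferentiableAt ℝ φ y) ∧ HasDerivAt (deriv φ) a x

theorem C2At.sub {φ ψ : ℝ → ℝ} {x a b : ℝ} (h1 : C2At φ x a) (h2 : C2At ψ x b) :
    C2At (fun y => φ y - ψ y) x (a - b) := by
  refine ⟨?_, ?_⟩
  · filter_upwards [h1.1, h2.1] with y hy1 hy2 using hy1.sub hy2
  · refine (h1.2.sub h2.2).congr_of_eventuallyEq ?_
    filter_upwards [h1.1, h2.1] with y hy1 hy2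
    exact deriv_fun_sub hy1 hy2

theorem C2At.of_hasDerivAt {φ φ' : ℝ → ℝ} {x a : ℝ} (h1 : ∀ y, HasDerivAt φ (φ' y) y)
    (h2 : HasDerivAt φ' a x) : C2At φ x a := by
  refine ⟨Eventually.of_forall fun y => (h1 y).differentiableAt, ?_⟩
  have : deriv φ = φ' := funext fun y => (h1 y).deriv
  rwa [this]

theorem C2At.nonneg_of_min {φ : ℝ → ℝ} {x a : ℝ} (h : C2At φ x a) (hm : IsLocalMin φ x) :
    0 ≤ a := by
  by_contra hneg
  push Not at hneg
  have hd0 : deriv φ x = 0 := hm.deriv_eq_zero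
  have hdd : deriv (deriv φ) x = a := h.2.deriv
  have hmax : IsLocalMax φ x :=
    isLocalMax_of_deriv_deriv_neg (by rw [hdd]; exact hneg) hd0 h.1.self_of_nhds.continuousAt
  have hconst : φ =ᶠ[𝓝 x] fun _ => φ x := by
    filter_upwards [hm, hmax] with y h1 h2 using le_antisymm h2 h1
  have : deriv φ =ᶠ[𝓝 x] deriv (fun _ => φ x) := hconst.deriv
  have h3 := this.deriv_eq
  simp at h3
  linarith

theorem C2At.const_mul {φ : ℝ → ℝ} {x a : ℝ} (c : ℝ) (h1 : C2At φ x a) :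
    C2At (fun y => c * φ y) x (c * a) := by
  refine ⟨?_, ?_⟩
  · filter_upwards [h1.1] with y hy1 using hy1.const_mul c
  · refine (h1.2.const_mul c).congr_of_eventuallyEq ?_
    filter_upwards [h1.1] with y hy1
    exact deriv_const_mul c hy1

theorem C2At.neg {φ : ℝ → ℝ} {x a : ℝ} (h1 : C2At φ x a) :
    C2At (fun y => - φ y) x (- a) := by
  simpa using h1.const_mul (-1)

theorem C2At.nonpos_of_max {φ : ℝ → ℝ} {x a : ℝ} (h : C2At φ x a) (hm : IsLocalMax φ x) :
    a ≤ 0 := by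
  have := h.neg.nonneg_of_min hm.neg
  linarith

theorem left_deriv_nonpos {F : ℝ → ℝ} {F' t : ℝ} (h : HasDerivAt F F' t)
    (hm : ∀ᶠ s in 𝓝[<] t, F t ≤ F s) : F' ≤ 0 := by
  have h1 := (hasDerivAt_iff_tendsto_slope.1 h).mono_left (nhdsLT_le_nhdsNE t)
  refine le_of_tendsto h1 ?_
  filter_upwards [hm, self_mem_nhdsWithin] with s hs hst
  rw [slope_def_field]
  exact div_nonpos_of_nonneg_of_nonpos (by linarith) (by linarith [show s < t from hst])

theorem left_deriv_nonneg {F : ℝ → ℝ} {F' t : ℝ} (h : HasDerivAt F F' t)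
    (hm : ∀ᶠ s in 𝓝[<] t, F s ≤ F t) : 0 ≤ F' := by
  have := left_deriv_nonpos (F := fun s => - F s) h.fun_neg (by
    filter_upwards [hm] with s hs; linarith)
  linarith

theorem SolvesPDE.c2At {d : ℝ} {f : ℝ → ℝ → ℝ → ℝ} {u : ℝ → ℝ → ℝ} {s : Set (ℝ × ℝ)}
    (h : SolvesPDE d f u s) {t x : ℝ} (hn : ∀ᶠ y in 𝓝 x, (t, y) ∈ s) :
    ∃ a b, C2At (u t) x a ∧ HasDerivAt (fun τ => u τ x) b t ∧ b = d * a + f t x (u t x) := by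
  refine ⟨deriv (deriv (u t)) x, _, ⟨?_, ?_⟩, (h (t, x) hn.self_of_nhds).2.2, rfl⟩
  · filter_upwards [hn] with y hy using (h _ hy).1
  · exact (h (t, x) hn.self_of_nhds).2.1.hasDerivAt

/-- Maximum principle on a compact set. -/
theorem max_principle {D : Set (ℝ × ℝ)} (hD : IsCompact D) {w : ℝ → ℝ → ℝ}
    (hw : ContinuousOn (fun q : ℝ × ℝ => w q.1 q.2) D) {d K : ℝ} (hd : 0 < d)
    (h : ∀ t x, (t, x) ∈ D → w t x < 0 →
      ∃ r > 0, (∀ t' x', t - r < t' → t' ≤ t → |x' - x| < r → (t', x') ∈ D) ∧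
      ∃ b a, HasDerivAt (fun τ => w τ x) b t ∧ C2At (w t) x a ∧ d * a + K * w t x ≤ b) :
    ∀ t x, (t, x) ∈ D → 0 ≤ w t x := by
  intro t₀ x₀ hq
  by_contra hneg
  push Not at hneg
  have hc : ContinuousOn (fun q : ℝ × ℝ => Real.exp (-(K + 1) * q.1) * w q.1 q.2) D :=
    ContinuousOn.mul (by fun_prop) hw
  obtain ⟨⟨t, x⟩, hmem, hmin⟩ := hD.exists_isMinOn ⟨_, hq⟩ hc
  have hmin' : ∀ t' x', (t', x') ∈ D →
      Real.exp (-(K + 1) * t) * w t x ≤ Real.exp (-(K + 1) * t') * w t' x' :=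
    fun t' x' h' => hmin h'
  have hneg2 : w t x < 0 := by
    have h1 := hmin' _ _ hq
    have h2 : Real.exp (-(K + 1) * t₀) * w t₀ x₀ < 0 :=
      mul_neg_of_pos_of_neg (Real.exp_pos _) hneg
    by_contra h3
    push Not at h3
    have := mul_nonneg (Real.exp_pos (-(K + 1) * t)).le h3
    linarith
  obtain ⟨r, hr, hnb, b, a, hb, ha, hineq⟩ := h t x hmem hneg2
  have ha0 : 0 ≤ a := by
    apply ha.nonneg_of_min
    filter_upwards [Metric.ball_mem_nhds x hr] with y hy
    have h1 := hmin' t y (hnb t y (by linarith) le_rfl (by simpa [Real.dist_eq] using hy))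
    exact le_of_mul_le_mul_left h1 (Real.exp_pos _)
  have hE : HasDerivAt (fun τ => Real.exp (-(K + 1) * τ) * w τ x)
      (Real.exp (-(K + 1) * t) * (-(K + 1)) * w t x + Real.exp (-(K + 1) * t) * b) t := by
    have h1 : HasDerivAt (fun τ : ℝ => -(K + 1) * τ) (-(K + 1)) t := by
      simpa using (hasDerivAt_id t).const_mul (-(K + 1))
    exact h1.exp.mul hb
  have hle := left_deriv_nonpos hE (by
    filter_upwards [Ioo_mem_nhdsLT (show t - r < t by linarith)] with s hs
    exact hmin' s x (hnb s x hs.1 hs.2.le (by simpa using hr)))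
  have h4 : Real.exp (-(K + 1) * t) * (b - (K + 1) * w t x) ≤ 0 := by
    calc _ = _ := by ring
      _ ≤ 0 := hle
  have h5 : b - (K + 1) * w t x ≤ 0 := by
    by_contra h6
    push Not at h6
    have := mul_pos (Real.exp_pos (-(K + 1) * t)) h6
    linarith
  have := mul_nonneg hd.le ha0
  nlinarith

/-- If `A > 0` wherever `ψ = 0` on a compact set, then `A + Λ ψ > 0` for large `Λ`. -/
theorem exists_large_mult {X : Type*} [TopologicalSpace X] {s : Set X} (hs : IsCompact s)
    {A ψ : X → ℝ} (hA : ContinuousOn A s) (hψ : ContinuousOn ψ s)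
    (h0 : ∀ x ∈ s, 0 ≤ ψ x) (h1 : ∀ x ∈ s, ψ x = 0 → 0 < A x) :
    ∃ Λ > 0, ∀ x ∈ s, ∀ Λ' ≥ Λ, 0 < A x + Λ' * ψ x := by
  have key : ∃ n : ℕ, ∀ x ∈ s, 0 < A x + n * ψ x := by
    by_contra hcon
    push Not at hcon
    choose y hys hy using hcon
    obtain ⟨z, hz, hcl⟩ := hs.exists_mapClusterPt (f := atTop) (u := y)
      (by simpa using ⟨0, fun b _ => hys b⟩)
    have hcψ : ∀ m : ℕ, A z + m * ψ z ≤ 0 := by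
      intro m
      have hcont : ContinuousOn (fun x => A x + m * ψ x) s := hA.add (continuousOn_const.mul hψ)
      by_contra hpos
      push Not at hpos
      obtain ⟨O, hO, hO2⟩ := mem_nhdsWithin_iff_exists_mem_nhds_inter.1
        (hcont z hz (Ioi_mem_nhds hpos))
      have hf := (mapClusterPt_iff_frequently.1 hcl O hO).and_eventually (eventually_ge_atTop m)
      obtain ⟨n, hn, hmn⟩ := hf.exists
      have h2 : 0 < A (y n) + m * ψ (y n) := hO2 ⟨hn, hys n⟩
      have h3 := hy n
      have h4 : (m : ℝ) * ψ (y n) ≤ n * ψ (y n) :=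
        mul_le_mul_of_nonneg_right (by exact_mod_cast hmn) (h0 _ (hys n))
      linarith
    rcases (h0 z hz).eq_or_lt with he | hlt
    · have := h1 z hz he.symm
      have h2 := hcψ 0
      simp at h2
      linarith
    · obtain ⟨m, hm⟩ := exists_nat_gt (-A z / ψ z)
      rw [div_lt_iff₀ hlt] at hm
      have := hcψ m
      linarith
  obtain ⟨n, hn⟩ := key
  refine ⟨n + 1, by positivity, fun x hx Λ' hΛ => ?_⟩
  have := mul_le_mul_of_nonneg_right (show (n : ℝ) ≤ Λ' by linarith) (h0 x hx)
  have := hn x hx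
  linarith


/-- Region between two curves. -/
def Reg (s τ : ℝ) (α β : ℝ → ℝ) : Set (ℝ × ℝ) :=
  {q | q.1 ∈ Icc s τ ∧ q.2 ∈ Icc (α q.1) (β q.1)}

theorem Reg.isCompact {s τ : ℝ} {α β : ℝ → ℝ} (hα : ContinuousOn α (Icc s τ))
    (hβ : ContinuousOn β (Icc s τ)) : IsCompact (Reg s τ α β) := by
  have hmap : Reg s τ α β =
      (Icc s τ ×ˢ (univ : Set ℝ)) ∩ {q | α q.1 ≤ q.2 ∧ q.2 ≤ β q.1} := by
    ext q; simp [Reg, mem_prod, and_assoc]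
  obtain ⟨A, hA⟩ := (isCompact_Icc.image_of_continuousOn hα).bddBelow
  obtain ⟨B, hB⟩ := (isCompact_Icc.image_of_continuousOn hβ).bddAbove
  have hcl : IsClosed (Reg s τ α β) := by
    rw [hmap]
    have hα' : ContinuousOn (fun q : ℝ × ℝ => α q.1) (Icc s τ ×ˢ (univ : Set ℝ)) :=
      hα.comp continuousOn_fst fun q hq => hq.1
    have hβ' : ContinuousOn (fun q : ℝ × ℝ => β q.1) (Icc s τ ×ˢ (univ : Set ℝ)) :=
      hβ.comp continuousOn_fst fun q hq => hq.1
    have hc : IsClosed (Icc s τ ×ˢ (univ : Set ℝ)) := isClosed_Icc.prod isClosed_univ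
    have h1 := hc.isClosed_le hα' continuousOn_snd
    have h2 := hc.isClosed_le (continuousOn_snd (s := Icc s τ ×ˢ (univ : Set ℝ))) hβ'
    convert h1.inter h2 using 1
    ext q; simp only [mem_inter_iff, mem_ofPred_eq]; tauto
  refine ((isCompact_Icc (a := s) (b := τ)).prod
    (isCompact_Icc (a := A) (b := B))).of_isClosed_subset hcl ?_
  rintro ⟨t, x⟩ ⟨h1, h2⟩
  exact ⟨h1, (hA ⟨t, h1, rfl⟩).trans h2.1, h2.2.trans (hB ⟨t, h1, rfl⟩)⟩

theorem Reg.backward {s τ : ℝ} {α β : ℝ → ℝ} (hα : ContinuousOn α (Icc s τ))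
    (hβ : ContinuousOn β (Icc s τ)) {t x : ℝ} (h1 : s < t) (h2 : t ≤ τ) (h3 : α t < x)
    (h4 : x < β t) :
    ∃ r > 0, s < t - r ∧ ∀ t' x', t - r < t' → t' ≤ t → |x' - x| < r → α t' < x' ∧ x' < β t' := by
  have hmem : t ∈ Icc s τ := ⟨h1.le, h2⟩
  set e := min ((x - α t) / 2) ((β t - x) / 2) with he
  have hepos : 0 < e := lt_min (by linarith) (by linarith)
  have e1 : e ≤ (x - α t) / 2 := min_le_left _ _
  have e2 : e ≤ (β t - x) / 2 := min_le_right _ _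
  obtain ⟨r1, hr1, H1⟩ := Metric.continuousOn_iff.1 hα t hmem e hepos
  obtain ⟨r2, hr2, H2⟩ := Metric.continuousOn_iff.1 hβ t hmem e hepos
  set r := min (min r1 r2) (min e ((t - s) / 2)) with hr
  have hrpos : 0 < r := lt_min (lt_min hr1 hr2) (lt_min hepos (by linarith))
  have q1 : r ≤ r1 := (min_le_left _ _).trans (min_le_left _ _)
  have q2 : r ≤ r2 := (min_le_left _ _).trans (min_le_right _ _)
  have q3 : r ≤ e := (min_le_right _ _).trans (min_le_left _ _)
  have q4 : r ≤ (t - s) / 2 := (min_le_right _ _).trans (min_le_right _ _)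
  refine ⟨r, hrpos, by linarith, fun t' x' a1 a2 a3 => ?_⟩
  have hm : t' ∈ Icc s τ := ⟨by linarith, by linarith⟩
  have hd : |t' - t| < r := by rw [abs_lt]; constructor <;> linarith
  have k1 := H1 t' hm (by rw [Real.dist_eq]; linarith)
  have k2 := H2 t' hm (by rw [Real.dist_eq]; linarith)
  rw [Real.dist_eq, abs_lt] at k1 k2
  rw [abs_lt] at a3
  constructor <;> linarith

theorem mp_curves {s τ : ℝ} {α β : ℝ → ℝ} (hα : ContinuousOn α (Icc s τ))
    (hβ : ContinuousOn β (Icc s τ)) {w : ℝ → ℝ → ℝ}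
    (hw : ContinuousOn (fun q : ℝ × ℝ => w q.1 q.2) (Reg s τ α β)) {d K : ℝ} (hd : 0 < d)
    (h0 : ∀ x ∈ Icc (α s) (β s), 0 ≤ w s x)
    (hl : ∀ t ∈ Icc s τ, α t ≤ β t → 0 ≤ w t (α t))
    (hr : ∀ t ∈ Icc s τ, α t ≤ β t → 0 ≤ w t (β t))
    (hi : ∀ t x, s < t → t ≤ τ → α t < x → x < β t → w t x < 0 →
      ∃ b a, HasDerivAt (fun τ => w τ x) b t ∧ C2At (w t) x a ∧ d * a + K * w t x ≤ b) :
    ∀ t ∈ Icc s τ, ∀ x ∈ Icc (α t) (β t), 0 ≤ w t x := by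
  intro t ht x hx
  refine max_principle (Reg.isCompact hα hβ) hw (K := K) hd ?_ t x ⟨ht, hx⟩
  rintro t x ⟨ht, hx⟩ hneg
  have a1 : s < t := by
    rcases ht.1.eq_or_lt with h | h
    · dsimp at h; subst h; exact absurd (h0 x hx) (not_le.2 hneg)
    · exact h
  have hle := hx.1.trans hx.2
  have a2 : α t < x := by
    rcases hx.1.eq_or_lt with h | h
    · dsimp at h; rw [← h] at hneg; exact absurd (hl t ht hle) (not_le.2 hneg)
    · exact h
  have a3 : x < β t := by
    rcases hx.2.eq_or_lt with h | h
    · dsimp at h; rw [h] at hneg; exact absurd (hr t ht hle) (not_le.2 hneg)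
    · exact h
  obtain ⟨r, hr, hsr, hb⟩ := Reg.backward hα hβ a1 ht.2 a2 a3
  refine ⟨r, hr, fun t' x' b1 b2 b3 => ?_, hi t x a1 ht.2 a2 a3 hneg⟩
  have := hb t' x' b1 b2 b3
  exact ⟨⟨by dsimp; linarith, b2.trans ht.2⟩, this.1.le, this.2.le⟩

theorem HasDerivAt.comp_real {f g : ℝ → ℝ} {f' g' x : ℝ} (hf : HasDerivAt f f' (g x))
    (hg : HasDerivAt g g' x) : HasDerivAt (fun y => f (g y)) (f' * g') x := hf.comp x hg

theorem hopf_poly (d B r : ℝ) (hd : 0 < d) (hB : 0 < B) (hr : 0 < r) :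
    ∃ (ψ ψ1 ψ2 : ℝ → ℝ), (∀ y, HasDerivAt ψ (ψ1 y) y) ∧ (∀ y, HasDerivAt ψ1 (ψ2 y) y) ∧
      (∀ y ∈ Icc 0 (2 * r), 0 ≤ ψ y) ∧ ψ 0 = 0 ∧ ψ (2 * r) = 0 ∧ Continuous ψ2 ∧
      (∀ y ∈ Icc 0 (2 * r), ψ y = 0 → 0 < d * ψ2 y - B * |ψ1 y|) ∧
      (∃ η > 0, ∀ y ∈ Icc 0 (2 * r), η * ψ y ≤ y) ∧ ∀ y ∈ Icc 0 r, r ^ 2 * y ≤ ψ y := by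
  set m := 1 / r + B / d with hm
  have hmpos : 0 < m := by positivity
  have hmr : m * r = 1 + B * r / d := by rw [hm]; field_simp
  set ψ : ℝ → ℝ := fun y => (y + m * y ^ 2) * (2 * r - y) ^ 2 with hψ
  set ψ1 : ℝ → ℝ := fun y => (1 + 2 * m * y) * (2 * r - y) ^ 2 - 2 * (y + m * y ^ 2) * (2 * r - y)
    with hψ1
  set ψ2 : ℝ → ℝ := fun y => 2 * m * (2 * r - y) ^ 2 - 4 * (1 + 2 * m * y) * (2 * r - y)
    + 2 * (y + m * y ^ 2) with hψ2
  have D1 : ∀ y, HasDerivAt ψ (ψ1 y) y := by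
    intro y
    have h1 : HasDerivAt (fun y => y + m * y ^ 2) (1 + m * (2 * y)) y := by
      exact ((hasDerivAt_id' y).fun_add
        (((hasDerivAt_id' y).fun_pow 2).const_mul m)).congr_deriv (by simp)
    have h2 : HasDerivAt (fun y => (2 * r - y) ^ 2) (2 * (2 * r - y) * (-1)) y := by
      exact (((hasDerivAt_id' y).const_sub (2 * r)).fun_pow 2).congr_deriv (by simp)
    exact (h1.fun_mul h2).congr_deriv (by simp only [hψ1]; ring)
  have D2 : ∀ y, HasDerivAt ψ1 (ψ2 y) y := by
    intro y
    have h1 : HasDerivAt (fun y => y + m * y ^ 2) (1 + m * (2 * y)) y := by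
      exact ((hasDerivAt_id' y).fun_add
        (((hasDerivAt_id' y).fun_pow 2).const_mul m)).congr_deriv (by simp)
    have h2 : HasDerivAt (fun y => (2 * r - y) ^ 2) (2 * (2 * r - y) * (-1)) y := by
      exact (((hasDerivAt_id' y).const_sub (2 * r)).fun_pow 2).congr_deriv (by simp)
    have h3 : HasDerivAt (fun y => 1 + 2 * m * y) (2 * m) y := by
      simpa using ((hasDerivAt_id y).const_mul (2 * m)).const_add 1
    have h4 : HasDerivAt (fun y => 2 * r - y) (-1) y := (hasDerivAt_id y).const_sub (2 * r)
    exact ((h3.fun_mul h2).fun_sub ((h1.const_mul 2).fun_mul h4)).congr_deriv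
      (by simp only [hψ2]; ring)
  have cψ : Continuous ψ := by simp only [hψ]; fun_prop
  have hψ0 : ∀ y ∈ Icc 0 (2 * r), 0 ≤ ψ y := fun y hy => by
    have := hy.1
    simp only [hψ]; positivity
  have hq : 0 < (1 + 2 * m * r) * (4 * r ^ 2) := by positivity
  set η := 1 / ((1 + 2 * m * r) * (4 * r ^ 2)) with hη
  have hηpos : 0 < η := by positivity
  have hηψ : ∀ y ∈ Icc 0 (2 * r), η * ψ y ≤ y := by
    intro y hy
    obtain ⟨y0, y1⟩ := hy
    rw [hη, one_div, inv_mul_le_iff₀ hq]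
    have e1 : ψ y = y * ((1 + m * y) * (2 * r - y) ^ 2) := by simp only [hψ]; ring
    rw [e1, show (1 + 2 * m * r) * (4 * r ^ 2) * y = y * ((1 + 2 * m * r) * (4 * r ^ 2)) by ring]
    refine mul_le_mul_of_nonneg_left ?_ y0
    refine mul_le_mul ?_ ?_ (sq_nonneg _) (by positivity)
    · nlinarith
    · nlinarith
  refine ⟨ψ, ψ1, ψ2, D1, D2, hψ0, by simp [hψ], by simp [hψ], by simp only [hψ2]; fun_prop, ?_,
    ⟨η, hηpos, hηψ⟩, ?_⟩
  · intro y hy h0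
    have hz : y = 0 ∨ y = 2 * r := by
      simp only [hψ, mul_eq_zero, pow_eq_zero_iff, ne_eq, OfNat.ofNat_ne_zero,
        not_false_eq_true] at h0
      rcases h0 with h0 | h0
      · left
        have := hy.1
        have := mul_nonneg hmpos.le (sq_nonneg y)
        linarith
      · right; linarith
    rcases hz with rfl | rfl
    · simp only [hψ2, hψ1]
      have e1 : |(1 + 2 * m * 0) * (2 * r - 0) ^ 2 - 2 * (0 + m * 0 ^ 2) * (2 * r - 0)|
          = 4 * r ^ 2 := by rw [abs_of_nonneg] <;> ring_nf; positivity
      rw [e1]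
      have e2 : d * (m * r) = d + B * r := by rw [hmr]; field_simp
      have e3 : d * (2 * m * (2 * r - 0) ^ 2 - 4 * (1 + 2 * m * 0) * (2 * r - 0)
        + 2 * (0 + m * 0 ^ 2)) = 8 * r * (d * (m * r)) - 8 * r * d := by ring
      rw [e3, e2]
      have : 0 < B * r ^ 2 := by positivity
      nlinarith
    · simp only [hψ2, hψ1]
      have : 0 < d * (2 * (2 * r + m * (2 * r) ^ 2)) := by positivity
      simp
      linarith
  · rintro y ⟨y0, y1⟩
    have e1 : ψ y = y * ((1 + m * y) * (2 * r - y) ^ 2) := by simp only [hψ]; ring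
    rw [e1, mul_comm]
    refine mul_le_mul_of_nonneg_left ?_ y0
    have : r ^ 2 ≤ (2 * r - y) ^ 2 := by nlinarith
    have : 0 ≤ m * y := by positivity
    nlinarith [sq_nonneg (2 * r - y)]

/-- Hopf lemma along a moving boundary, with a uniform constant. -/
theorem hopf (d K B r Tm : ℝ) (hd : 0 < d) (hB : 0 < B) (hr : 0 < r) (hT : 0 ≤ Tm) :
    ∃ κ > 0, ∀ (s τ c : ℝ) (h h' : ℝ → ℝ) (w : ℝ → ℝ → ℝ), s ≤ τ → τ ≤ s + Tm → 0 ≤ c →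
      (∀ t ∈ Icc s τ, HasDerivAt h (h' t) t) → (∀ t ∈ Icc s τ, |h' t| ≤ B) →
      ContinuousOn (fun q : ℝ × ℝ => w q.1 q.2) (Reg s τ (fun t => h t - 2 * r) h) →
      (∀ t ∈ Icc s τ, 0 ≤ w t (h t)) → (∀ t ∈ Icc s τ, 0 ≤ w t (h t - 2 * r)) →
      (∀ t x, s < t → t ≤ τ → h t - 2 * r < x → x < h t →
        ∃ b a, HasDerivAt (fun τ => w τ x) b t ∧ C2At (w t) x a ∧ d * a - K * w t x ≤ b) →
      (∀ y ∈ Icc 0 (2 * r), c * y ≤ w s (h s - y)) →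
      ∀ t ∈ Icc s τ, ∀ y ∈ Icc 0 r, c * κ * y ≤ w t (h t - y) := by
  obtain ⟨ψ, ψ1, ψ2, D1, D2, hψ0, hψa, hψb, cψ2, hpos, ⟨η, hηpos, hηψ⟩, hψr⟩ :=
    hopf_poly d B r hd hB hr
  have cψ : Continuous ψ := continuous_iff_continuousAt.2 fun y => (D1 y).continuousAt
  have cψ1 : Continuous ψ1 := continuous_iff_continuousAt.2 fun y => (D2 y).continuousAt
  obtain ⟨Λ, hΛ, hΛ2⟩ := exists_large_mult (s := Icc 0 (2 * r)) isCompact_Icc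
    (A := fun y => d * ψ2 y - B * |ψ1 y|) (ψ := ψ)
    (by apply Continuous.continuousOn; fun_prop) cψ.continuousOn hψ0 hpos
  set Λ' := Λ + |K| with hΛ'
  refine ⟨η * Real.exp (-(Λ' * Tm)) * r ^ 2, by positivity, ?_⟩
  intro s τ c h h' w hsτ hτT hc hh hB' hw hw1 hw2 hpde hbot
  have hcont : ContinuousOn h (Icc s τ) := fun t ht => (hh t ht).continuousAt.continuousWithinAt
  set z : ℝ → ℝ → ℝ := fun t x => c * η * (Real.exp (-(Λ' * (t - s))) * ψ (h t - x)) with hz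
  have key := mp_curves (s := s) (τ := τ) (α := fun t => h t - 2 * r) (β := h)
    (hcont.sub continuousOn_const) hcont (w := fun t x => w t x - z t x) (d := d) (K := -K)
    (hw.sub (by
      simp only [hz]
      have hh' : ContinuousOn (fun q : ℝ × ℝ => h q.1) (Reg s τ (fun t => h t - 2 * r) h) :=
        hcont.comp continuousOn_fst fun q hq => hq.1
      refine continuousOn_const.mul (ContinuousOn.mul (by fun_prop) ?_)
      exact cψ.comp_continuousOn (hh'.sub continuousOn_snd))) hd
    (by
      intro x hx
      have hy : h s - x ∈ Icc 0 (2 * r) := ⟨by linarith [hx.2], by linarith [hx.1]⟩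
      have h1 := hbot _ hy
      have h2 := mul_le_mul_of_nonneg_left (hηψ _ hy) hc
      simp only [hz, sub_self, mul_zero, neg_zero, Real.exp_zero, one_mul]
      rw [sub_sub_cancel] at h1
      linarith)
    (by
      intro t ht _
      have e := hψb
      simp only [hz, sub_sub_cancel, e]
      simpa using hw2 t ht)
    (by
      intro t ht _
      have e := hψa
      simp only [hz, sub_self, e]
      simpa using hw1 t ht)
    (by
      intro t x h1 h2 h3 h4 _
      obtain ⟨b, a, hb, ha, hba⟩ := hpde t x h1 h2 h3 h4
      have htm : t ∈ Icc s τ := ⟨h1.le, h2⟩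
      have hy : h t - x ∈ Icc 0 (2 * r) := ⟨by linarith, by linarith⟩
      have zt : HasDerivAt (fun τ => z τ x) (c * η * (Real.exp (-(Λ' * (t - s))) * (-Λ')
          * ψ (h t - x) + Real.exp (-(Λ' * (t - s))) * (ψ1 (h t - x) * h' t))) t := by
        have i1 : HasDerivAt (fun t => -(Λ' * (t - s))) (-Λ') t := by
          exact (((hasDerivAt_id' t).sub_const s).const_mul Λ').fun_neg.congr_deriv (by simp)
        have i2 : HasDerivAt (fun t => ψ (h t - x)) (ψ1 (h t - x) * h' t) t :=
          HasDerivAt.comp_real (g := fun t => h t - x) (D1 (h t - x)) ((hh t htm).sub_const x)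
        exact (i1.exp.fun_mul i2).const_mul (c * η)
      have zx : C2At (z t) x (c * η * (Real.exp (-(Λ' * (t - s))) * ψ2 (h t - x))) := by
        refine C2At.of_hasDerivAt
          (φ' := fun y => c * η * (Real.exp (-(Λ' * (t - s))) * (ψ1 (h t - y) * (-1)))) ?_ ?_
        · intro y
          exact (((D1 (h t - y)).comp_real ((hasDerivAt_id' y).const_sub (h t))).const_mul
            (Real.exp (-(Λ' * (t - s))))).const_mul (c * η)
        · exact (((((D2 (h t - x)).comp_real ((hasDerivAt_id' x).const_sub (h t))).mul_const
            (-1)).const_mul (Real.exp (-(Λ' * (t - s))))).const_mul (c * η)).congr_deriv (by ring)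
      refine ⟨_, _, hb.sub zt, ha.sub zx, ?_⟩
      simp only [hz]
      set y := h t - x
      set E := Real.exp (-(Λ' * (t - s)))
      have hE : 0 < E := Real.exp_pos _
      have k1 := hΛ2 y hy (Λ' - K) (by rw [hΛ']; linarith [le_abs_self K])
      have k2 : ψ1 y * h' t ≤ B * |ψ1 y| := by
        calc ψ1 y * h' t ≤ |ψ1 y * h' t| := le_abs_self _
          _ = |ψ1 y| * |h' t| := abs_mul _ _
          _ ≤ |ψ1 y| * B := mul_le_mul_of_nonneg_left (hB' t htm) (abs_nonneg _)
          _ = _ := mul_comm _ _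
      have k3 : 0 ≤ c * η * E * (d * ψ2 y + (Λ' - K) * ψ y - ψ1 y * h' t) :=
        mul_nonneg (by positivity) (by linarith)
      nlinarith)
  intro t ht y hy
  have h1 := key t ht (h t - y) ⟨by linarith [hy.1, hy.2], by linarith [hy.1]⟩
  simp only [hz, sub_sub_cancel] at h1
  obtain ⟨y0, y1⟩ := hy
  have h2 : Real.exp (-(Λ' * Tm)) ≤ Real.exp (-(Λ' * (t - s))) := by
    apply Real.exp_le_exp.2
    have : 0 ≤ Λ' := by positivity
    have : t - s ≤ Tm := by linarith [ht.2]
    nlinarith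
  have h3 : r ^ 2 * y ≤ ψ y := by exact hψr y ⟨y0, y1⟩
  have h4 : Real.exp (-(Λ' * Tm)) * (r ^ 2 * y) ≤ Real.exp (-(Λ' * (t - s))) * ψ y :=
    mul_le_mul h2 h3 (by positivity) (Real.exp_pos _).le
  have h5 := mul_le_mul_of_nonneg_left h4 (mul_nonneg hc hηpos.le)
  nlinarith


/-- Data extracted from the hypotheses. -/
structure Env (d μ ω L K R : ℝ) (f : ℝ → ℝ → ℝ → ℝ) (p : ℝ → ℝ → ℝ) : Prop where
  hd : 0 < d
  hμ : 0 < μ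
  hω : 0 < ω
  hL : 0 < L
  hK : 0 < K
  hR : 0 < R
  f0 : ∀ t x, f t x 0 = 0
  lip : ∀ t x a b, 0 ≤ a → a ≤ R → 0 ≤ b → b ≤ R → |f t x a - f t x b| ≤ K * |a - b|
  per_t : ∀ t x a, 0 ≤ a → f (t + ω) x a = f t x a
  per_x : ∀ t x a, 0 ≤ a → f t (x + L) a = f t x a
  p_cont : Continuous fun q : ℝ × ℝ => p q.1 q.2
  p_pos : ∀ t x, 0 < p t x
  p_le : ∀ t x, p t x ≤ R
  p_per_t : ∀ t x, p (t + ω) x = p t x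
  p_per_x : ∀ t x, p t (x + L) = p t x
  p_sol : SolvesPDE d f p univ
  plat : ∀ δ, 0 < δ → δ ≤ R → ∀ ε > 0, ∃ v : ℝ → ℝ → ℝ,
    ContinuousOn (fun q : ℝ × ℝ => v q.1 q.2) {q : ℝ × ℝ | 0 ≤ q.1} ∧
    (∀ t ≥ 0, ∀ x, 0 ≤ v t x ∧ v t x ≤ R) ∧ SolvesPDE d f v {q : ℝ × ℝ | 0 < q.1} ∧
    (∀ x, v 0 x = δ) ∧ ∃ k : ℕ, ∀ x, p 0 x - ε ≤ v (k * ω) x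

/-- Well-behaved spreading solutions of the free boundary problem. -/
structure Good (d μ : ℝ) (f : ℝ → ℝ → ℝ → ℝ) (p : ℝ → ℝ → ℝ) (u : ℝ → ℝ → ℝ)
    (g h : ℝ → ℝ) : Prop where
  cont : ContinuousOn (fun q : ℝ × ℝ => u q.1 q.2) {q : ℝ × ℝ | 0 ≤ q.1}
  dh : ∀ t ≥ 0, ∃ a > 0, HasDerivAt h (μ * a) t ∧
    HasDerivWithinAt (u t) (-a) (Iic (h t)) (h t)
  dg : ∀ t ≥ 0, ∃ a > 0, HasDerivAt g (-(μ * a)) t ∧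
    HasDerivWithinAt (u t) a (Ici (g t)) (g t)
  ch : ContinuousOn (deriv h) (Ici 0)
  cg : ContinuousOn (deriv g) (Ici 0)
  gh : ∀ t ≥ 0, g t < h t
  pos : ∀ t ≥ 0, ∀ x, g t < x → x < h t → 0 < u t x
  zero : ∀ t ≥ 0, ∀ x, x ≤ g t ∨ h t ≤ x → u t x = 0
  pde : SolvesPDE d f u {q : ℝ × ℝ | 0 < q.1 ∧ g q.1 < q.2 ∧ q.2 < h q.1}
  ltp : ∀ t ≥ 0, ∀ x, u t x < p t x
  h_top : Tendsto h atTop atTop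
  g_bot : Tendsto g atTop atBot
  conv : ∀ A > (0:ℝ), ∀ ε > 0, ∃ T, ∀ t ≥ T, ∀ x ∈ Icc (-A) A, |u t x - p t x| ≤ ε

/-- Reflection in space. -/
def reflF (f : ℝ → ℝ → ℝ → ℝ) : ℝ → ℝ → ℝ → ℝ := fun t x a => f t (-x) a
/-- Reflection in space. -/
def reflU (u : ℝ → ℝ → ℝ) : ℝ → ℝ → ℝ := fun t x => u t (-x)

theorem SolvesPDE.refl {d : ℝ} {f : ℝ → ℝ → ℝ → ℝ} {u : ℝ → ℝ → ℝ} {s : Set (ℝ × ℝ)}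
    (h : SolvesPDE d f u s) :
    SolvesPDE d (reflF f) (reflU u) {q | (q.1, -q.2) ∈ s} := by
  rintro ⟨t, x⟩ hq
  obtain ⟨h1, h2, h3⟩ := h _ hq
  have e1 : deriv (fun y => u t (-y)) = fun y => - deriv (u t) (-y) := by
    funext y; exact deriv_comp_neg _ _
  have e2 : deriv (deriv (fun y => u t (-y))) x = deriv (deriv (u t)) (-x) := by
    rw [e1, deriv.fun_neg, deriv_comp_neg]; simp
  refine ⟨?_, ?_, ?_⟩
  · exact h1.comp x (differentiableAt_id.neg)
  · show DifferentiableAt ℝ (deriv (fun y => u t (-y))) x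
    rw [e1]
    exact (h2.comp x differentiableAt_id.neg).neg
  · show HasDerivAt (fun τ => u τ (-x)) (d * deriv (deriv (fun y => u t (-y))) x + _) t
    rw [e2]; exact h3

theorem SolvesPDE.mono {d : ℝ} {f : ℝ → ℝ → ℝ → ℝ} {u : ℝ → ℝ → ℝ} {s s' : Set (ℝ × ℝ)}
    (h : SolvesPDE d f u s) (hs : s' ⊆ s) : SolvesPDE d f u s' := fun q hq => h q (hs hq)

theorem SolvesPDE.shift {d : ℝ} {f : ℝ → ℝ → ℝ → ℝ} {u : ℝ → ℝ → ℝ} {s : Set (ℝ × ℝ)}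
    (h : SolvesPDE d f u s) (a b : ℝ) :
    SolvesPDE d (fun t x => f (t + a) (x + b)) (fun t x => u (t + a) (x + b))
      {q | (q.1 + a, q.2 + b) ∈ s} := by
  rintro ⟨t, x⟩ hq
  obtain ⟨h1, h2, h3⟩ := h _ hq
  have e1 : deriv (fun y => u (t + a) (y + b)) = fun y => deriv (u (t + a)) (y + b) := by
    funext y; exact deriv_comp_add_const _ _ _
  refine ⟨?_, ?_, ?_⟩
  · exact h1.comp x (differentiableAt_id.add_const b)
  · show DifferentiableAt ℝ (deriv (fun y => u (t + a) (y + b))) x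
    rw [e1]
    exact h2.comp x (differentiableAt_id.add_const b)
  · show HasDerivAt (fun τ => u (τ + a) (x + b))
      (d * deriv (deriv (fun y => u (t + a) (y + b))) x + _) t
    rw [e1, deriv_comp_add_const]
    exact h3.comp_add_const t a

theorem SolvesPDE.congr_f {d : ℝ} {f f' : ℝ → ℝ → ℝ → ℝ} {u : ℝ → ℝ → ℝ} {s : Set (ℝ × ℝ)}
    (h : SolvesPDE d f u s) (hs : ∀ q ∈ s, f q.1 q.2 (u q.1 q.2) = f' q.1 q.2 (u q.1 q.2)) :
    SolvesPDE d f' u s := by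
  intro q hq
  have := h q hq
  rwa [hs q hq] at this

theorem Env.refl {d μ ω L K R : ℝ} {f : ℝ → ℝ → ℝ → ℝ} {p : ℝ → ℝ → ℝ}
    (E : Env d μ ω L K R f p) : Env d μ ω L K R (reflF f) (reflU p) where
  hd := E.hd
  hμ := E.hμ
  hω := E.hω
  hL := E.hL
  hK := E.hK
  hR := E.hR
  f0 t x := E.f0 t (-x)
  lip t x := E.lip t (-x)
  per_t t x := E.per_t t (-x)
  per_x t x a ha := by
    have := E.per_x t (-x - L) a ha
    simp only [reflF]
    rw [neg_add, ← sub_eq_add_neg, ← this]; simp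
  p_cont := E.p_cont.comp (by fun_prop : Continuous fun q : ℝ × ℝ => (q.1, -q.2))
  p_pos t x := E.p_pos _ _
  p_le t x := E.p_le _ _
  p_per_t t x := E.p_per_t _ _
  p_per_x t x := by
    have := E.p_per_x t (-x - L)
    simp only [reflU]
    rw [neg_add, ← sub_eq_add_neg, ← this]; simp
  p_sol := E.p_sol.refl.mono (by simp)
  plat δ h1 h2 ε hε := by
    obtain ⟨v, c1, c2, c3, c4, k, hk⟩ := E.plat δ h1 h2 ε hε
    refine ⟨reflU v, ?_, fun t ht x => c2 t ht _, c3.refl, fun x => c4 _, k, fun x => hk _⟩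
    exact c1.comp (by fun_prop : ContinuousOn (fun q : ℝ × ℝ => (q.1, -q.2)) _) fun q hq => hq

theorem Good.refl {d μ : ℝ} {f : ℝ → ℝ → ℝ → ℝ} {p u : ℝ → ℝ → ℝ} {g h : ℝ → ℝ}
    (G : Good d μ f p u g h) :
    Good d μ (reflF f) (reflU p) (reflU u) (fun t => - h t) (fun t => - g t) where
  cont := G.cont.comp (by fun_prop : ContinuousOn (fun q : ℝ × ℝ => (q.1, -q.2)) _) fun q hq => hq
  dh t ht := by
    obtain ⟨a, ha, h1, h2⟩ := G.dg t ht
    refine ⟨a, ha, h1.fun_neg.congr_deriv (by ring), ?_⟩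
    have h3 : HasDerivWithinAt (fun y : ℝ => -y) (-1) (Iic (- g t)) (- g t) :=
      (hasDerivAt_neg' (- g t)).hasDerivWithinAt
    have h2' : HasDerivWithinAt (u t) a (Ici (g t)) (- - g t) := by rwa [neg_neg]
    have := h2'.comp (- g t) h3 (fun y hy => by
      simp only [mem_Iic, mem_Ici] at hy ⊢; linarith)
    exact this.congr_deriv (by ring)
  dg t ht := by
    obtain ⟨a, ha, h1, h2⟩ := G.dh t ht
    refine ⟨a, ha, h1.fun_neg, ?_⟩
    have h3 : HasDerivWithinAt (fun y : ℝ => -y) (-1) (Ici (- h t)) (- h t) :=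
      (hasDerivAt_neg' (- h t)).hasDerivWithinAt
    have h2' : HasDerivWithinAt (u t) (-a) (Iic (h t)) (- - h t) := by rwa [neg_neg]
    have := h2'.comp (- h t) h3 (fun y hy => by
      simp only [mem_Iic, mem_Ici] at hy ⊢; linarith)
    exact this.congr_deriv (by ring)
  ch := by simpa using G.cg.fun_neg
  cg := by simpa using G.ch.fun_neg
  gh t ht := by have := G.gh t ht; linarith
  pos t ht x h1 h2 := G.pos t ht _ (by linarith) (by linarith)
  zero t ht x hx := G.zero t ht _ (by
    rcases hx with h | h
    · right; linarith
    · left; linarith)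
  pde := G.pde.refl.mono fun q hq => ⟨hq.1, by
    have h1 := hq.2.1
    have h2 := hq.2.2
    constructor <;> simp only <;> linarith⟩
  ltp t ht x := G.ltp t ht _
  h_top := tendsto_neg_atBot_atTop.comp G.g_bot
  g_bot := tendsto_neg_atTop_atBot.comp G.h_top
  conv A hA ε hε := by
    obtain ⟨T, hT⟩ := G.conv A hA ε hε
    refine ⟨T, fun t ht x hx => hT t ht _ ⟨by linarith [hx.2], by linarith [hx.1]⟩⟩

theorem Env.per_t_nat {d μ ω L K R : ℝ} {f : ℝ → ℝ → ℝ → ℝ} {p : ℝ → ℝ → ℝ}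
    (E : Env d μ ω L K R f p) (n : ℕ) (t x a : ℝ) (ha : 0 ≤ a) :
    f (t + n * ω) x a = f t x a :=
  Function.Periodic.nat_mul (f := fun t => f t x a) (c := ω) (fun t => E.per_t t x a ha) n t

theorem Env.per_x_int {d μ ω L K R : ℝ} {f : ℝ → ℝ → ℝ → ℝ} {p : ℝ → ℝ → ℝ}
    (E : Env d μ ω L K R f p) (n : ℤ) (t x a : ℝ) (ha : 0 ≤ a) :
    f t (x + n * L) a = f t x a :=
  Function.Periodic.int_mul (f := fun x => f t x a) (c := L) (fun x => E.per_x t x a ha) n x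

theorem Env.p_per_t_nat {d μ ω L K R : ℝ} {f : ℝ → ℝ → ℝ → ℝ} {p : ℝ → ℝ → ℝ}
    (E : Env d μ ω L K R f p) (n : ℕ) (t x : ℝ) : p (t + n * ω) x = p t x :=
  Function.Periodic.nat_mul (f := fun t => p t x) (c := ω) (fun t => E.p_per_t t x) n t

theorem Env.p_per_x_int {d μ ω L K R : ℝ} {f : ℝ → ℝ → ℝ → ℝ} {p : ℝ → ℝ → ℝ}
    (E : Env d μ ω L K R f p) (n : ℤ) (t x : ℝ) : p t (x + n * L) = p t x :=
  Function.Periodic.int_mul (f := fun x => p t x) (c := L) (fun x => E.p_per_x t x) n x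

theorem Good.nonneg {d μ : ℝ} {f : ℝ → ℝ → ℝ → ℝ} {p u : ℝ → ℝ → ℝ} {g h : ℝ → ℝ}
    (G : Good d μ f p u g h) {t : ℝ} (ht : 0 ≤ t) (x : ℝ) : 0 ≤ u t x := by
  by_cases hx : x ≤ g t ∨ h t ≤ x
  · exact (G.zero t ht x hx).ge
  · push Not at hx
    exact (G.pos t ht x hx.1 hx.2).le

theorem Good.le_R {d μ ω L K R : ℝ} {f : ℝ → ℝ → ℝ → ℝ} {p u : ℝ → ℝ → ℝ} {g h : ℝ → ℝ}
    (E : Env d μ ω L K R f p)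
    (G : Good d μ f p u g h) {t : ℝ} (ht : 0 ≤ t) (x : ℝ) : u t x ≤ R :=
  (G.ltp t ht x).le.trans (E.p_le t x)

theorem Good.shift {d μ ω L K R : ℝ} {f : ℝ → ℝ → ℝ → ℝ} {p u : ℝ → ℝ → ℝ} {g h : ℝ → ℝ}
    (E : Env d μ ω L K R f p) (G : Good d μ f p u g h) (n : ℕ) (m : ℤ) :
    Good d μ f p (fun t x => u (t + n * ω) (x + m * L)) (fun t => g (t + n * ω) - m * L)
      (fun t => h (t + n * ω) - m * L) := by
  have hn : (0:ℝ) ≤ n * ω := mul_nonneg (Nat.cast_nonneg n) E.hω.le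
  have ht0 : ∀ t ≥ (0:ℝ), 0 ≤ t + n * ω := fun t ht => add_nonneg ht hn
  have htt : Tendsto (fun t : ℝ => t + n * ω) atTop atTop := tendsto_atTop_add_const_right _ _ tendsto_id
  exact {
    cont := G.cont.comp (by fun_prop : ContinuousOn
      (fun q : ℝ × ℝ => (q.1 + n * ω, q.2 + m * L)) _) fun q hq => ht0 _ hq
    dh := fun t ht => by
      obtain ⟨a, ha, h1, h2⟩ := G.dh _ (ht0 t ht)
      refine ⟨a, ha, (h1.comp_add_const t (n * ω)).sub_const _, ?_⟩
      have h3 : HasDerivWithinAt (fun y : ℝ => y + m * L) 1 (Iic (h (t + n * ω) - m * L))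
        (h (t + n * ω) - m * L) := ((hasDerivAt_id' _).add_const _).hasDerivWithinAt
      have h2' : HasDerivWithinAt (u (t + n * ω)) (-a) (Iic (h (t + n * ω)))
        (h (t + n * ω) - m * L + m * L) := by rwa [sub_add_cancel]
      have := h2'.comp (h := fun y : ℝ => y + m * L) _ h3 (fun y hy => by
        simp only [mem_Iic] at hy ⊢; linarith)
      exact this.congr_deriv (by ring)
    dg := fun t ht => by
      obtain ⟨a, ha, h1, h2⟩ := G.dg _ (ht0 t ht)
      refine ⟨a, ha, (h1.comp_add_const t (n * ω)).sub_const _, ?_⟩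
      have h3 : HasDerivWithinAt (fun y : ℝ => y + m * L) 1 (Ici (g (t + n * ω) - m * L))
        (g (t + n * ω) - m * L) := ((hasDerivAt_id' _).add_const _).hasDerivWithinAt
      have h2' : HasDerivWithinAt (u (t + n * ω)) a (Ici (g (t + n * ω)))
        (g (t + n * ω) - m * L + m * L) := by rwa [sub_add_cancel]
      have := h2'.comp (h := fun y : ℝ => y + m * L) _ h3 (fun y hy => by
        simp only [mem_Ici] at hy ⊢; linarith)
      exact this.congr_deriv (by ring)
    ch := by
      have e : deriv (fun t => h (t + n * ω) - m * L) = fun t => deriv h (t + n * ω) := by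
        funext t; rw [deriv_sub_const, deriv_comp_add_const]
      rw [e]
      exact G.ch.comp (by fun_prop) fun t ht => ht0 t ht
    cg := by
      have e : deriv (fun t => g (t + n * ω) - m * L) = fun t => deriv g (t + n * ω) := by
        funext t; rw [deriv_sub_const, deriv_comp_add_const]
      rw [e]
      exact G.cg.comp (by fun_prop) fun t ht => ht0 t ht
    gh := fun t ht => by have := G.gh _ (ht0 t ht); linarith
    pos := fun t ht x h1 h2 => G.pos _ (ht0 t ht) _ (by linarith) (by linarith)
    zero := fun t ht x hx => G.zero _ (ht0 t ht) _ (by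
      rcases hx with h | h
      · left; linarith
      · right; linarith)
    pde := by
      refine ((G.pde.shift (n * ω) (m * L)).mono fun q hq => ?_).congr_f fun q hq => ?_
      · have h0 := hq.1
        have h1 := hq.2.1
        have h2 := hq.2.2
        exact ⟨by dsimp only; linarith, by dsimp only; linarith, by dsimp only; linarith⟩
      · have := G.nonneg (ht0 q.1 hq.1.le) (q.2 + m * L)
        rw [E.per_x_int _ _ _ _ this, E.per_t_nat _ _ _ _ this]
    ltp := fun t ht x => by
      have := G.ltp _ (ht0 t ht) (x + m * L)
      rwa [E.p_per_x_int, E.p_per_t_nat] at this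
    h_top := tendsto_atTop_add_const_right _ _ (G.h_top.comp htt)
    g_bot := tendsto_atBot_add_const_right _ _ (G.g_bot.comp htt)
    conv := fun A hA ε hε => by
      obtain ⟨T, hT⟩ := G.conv (A + |m * L|) (by positivity) ε hε
      refine ⟨T, fun t ht x hx => ?_⟩
      have := hT (t + n * ω) (by linarith) (x + m * L)
        ⟨by linarith [hx.1, neg_abs_le (m * L)], by linarith [hx.2, le_abs_self (m * L)]⟩
      rwa [E.p_per_x_int, E.p_per_t_nat] at this }

theorem Good.h_cont {d μ : ℝ} {f : ℝ → ℝ → ℝ → ℝ} {p u : ℝ → ℝ → ℝ} {g h : ℝ → ℝ}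
    (G : Good d μ f p u g h) : ContinuousOn h (Ici 0) := fun t ht => by
  obtain ⟨a, -, h1, -⟩ := G.dh t ht
  exact h1.continuousAt.continuousWithinAt

theorem Good.g_cont {d μ : ℝ} {f : ℝ → ℝ → ℝ → ℝ} {p u : ℝ → ℝ → ℝ} {g h : ℝ → ℝ}
    (G : Good d μ f p u g h) : ContinuousOn g (Ici 0) := fun t ht => by
  obtain ⟨a, -, h1, -⟩ := G.dg t ht
  exact h1.continuousAt.continuousWithinAt

theorem Good.c2At {d μ : ℝ} {f : ℝ → ℝ → ℝ → ℝ} {p u : ℝ → ℝ → ℝ} {g h : ℝ → ℝ}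
    (G : Good d μ f p u g h) {t x : ℝ} (ht : 0 < t) (h1 : g t < x) (h2 : x < h t) :
    ∃ a b, C2At (u t) x a ∧ HasDerivAt (fun τ => u τ x) b t ∧ b = d * a + f t x (u t x) :=
  G.pde.c2At (by
    filter_upwards [Ioo_mem_nhds h1 h2] with y hy using ⟨ht, hy.1, hy.2⟩)

section
variable {d μ ω L K R : ℝ} {f : ℝ → ℝ → ℝ → ℝ} {p : ℝ → ℝ → ℝ}

theorem slope_bound {φ : ℝ → ℝ} {a H c r : ℝ} (hd : HasDerivWithinAt φ (-a) (Iic H) H)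
    (h0 : φ H = 0) (hr : 0 < r) (hc : ∀ y ∈ Icc 0 r, c * y ≤ φ (H - y)) : c ≤ a := by
  have h1 : HasDerivWithinAt φ (-a) (Iio H) H := hd.mono Iio_subset_Iic_self
  rw [hasDerivWithinAt_iff_tendsto_slope' (by simp)] at h1
  have h2 : -a ≤ -c := by
    refine le_of_tendsto h1 ?_
    filter_upwards [Ioo_mem_nhdsLT (show H - r < H by linarith)] with y hy
    have := hc (H - y) ⟨by linarith [hy.2], by linarith [hy.1]⟩
    rw [sub_sub_cancel] at this
    rw [slope_def_field, h0, div_le_iff_of_neg (by linarith [hy.2])]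
    linarith
  linarith

theorem fbc_mp (E : Env d μ ω L K R f p) {u1 u2 : ℝ → ℝ → ℝ} {g1 h1 g2 h2 : ℝ → ℝ}
    (G1 : Good d μ f p u1 g1 h1) (G2 : Good d μ f p u2 g2 h2) (hu : ∀ x, u1 0 x ≤ u2 0 x)
    {τ : ℝ} (hgh : ∀ t ∈ Icc 0 τ, g2 t ≤ g1 t ∧ h1 t ≤ h2 t) :
    ∀ t ∈ Icc 0 τ, ∀ x, u1 t x ≤ u2 t x := by
  have hsub : Icc 0 τ ⊆ Ici 0 := fun t ht => ht.1
  have hsub2 : Reg 0 τ g1 h1 ⊆ {q : ℝ × ℝ | 0 ≤ q.1} := fun q hq => hq.1.1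
  have key := mp_curves (G1.g_cont.mono hsub) (G1.h_cont.mono hsub)
    (w := fun t x => u2 t x - u1 t x) ((G2.cont.mono hsub2).sub (G1.cont.mono hsub2))
    (K := K) E.hd (fun x _ => sub_nonneg.2 (hu x))
    (fun t ht _ => by
      simpa [G1.zero t ht.1 (g1 t) (Or.inl le_rfl)] using G2.nonneg ht.1 (g1 t))
    (fun t ht _ => by
      simpa [G1.zero t ht.1 (h1 t) (Or.inr le_rfl)] using G2.nonneg ht.1 (h1 t))
    (fun t x a1 a2 a3 a4 a5 => by
      have := hgh t ⟨a1.le, a2⟩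
      obtain ⟨a, b, ha, hb, hab⟩ := G1.c2At a1 a3 a4
      obtain ⟨a', b', ha', hb', hab'⟩ := G2.c2At a1 (this.1.trans_lt a3) (a4.trans_le this.2)
      refine ⟨_, _, hb'.sub hb, ha'.sub ha, ?_⟩
      have l := E.lip t x (u2 t x) (u1 t x) (G2.nonneg a1.le x) (G2.le_R E a1.le x)
        (G1.nonneg a1.le x) (G1.le_R E a1.le x)
      rw [abs_of_neg a5] at l
      have := (abs_le.1 l).1
      rw [hab, hab']
      linarith)
  intro t ht x
  by_cases hx : x ≤ g1 t ∨ h1 t ≤ x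
  · rw [G1.zero t ht.1 x hx]; exact G2.nonneg ht.1 x
  · push Not at hx
    exact sub_nonneg.1 (key t ht x ⟨hx.1.le, hx.2.le⟩)

theorem fbc_right (E : Env d μ ω L K R f p) {u1 u2 : ℝ → ℝ → ℝ} {g1 h1 g2 h2 : ℝ → ℝ}
    (G1 : Good d μ f p u1 g1 h1) (G2 : Good d μ f p u2 g2 h2)
    {τ : ℝ} (hτ : 0 < τ) (hgh : ∀ t ∈ Ico 0 τ, g2 t < g1 t ∧ h1 t < h2 t)
    (hu : ∀ t ∈ Icc 0 τ, ∀ x, u1 t x ≤ u2 t x) (hg : g2 τ ≤ g1 τ) : h1 τ ≠ h2 τ := by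
  intro heq
  have hsub : Icc 0 τ ⊆ Ici 0 := fun t ht => ht.1
  -- positivity near the initial boundary
  have hgh0 := hgh 0 ⟨le_rfl, hτ⟩
  have hpos0 : 0 < u2 0 (h1 0) - u1 0 (h1 0) := by
    rw [G1.zero 0 le_rfl _ (Or.inr le_rfl), sub_zero]
    exact G2.pos 0 le_rfl _ (hgh0.1.trans (G1.gh 0 le_rfl)) hgh0.2
  have hslice : ∀ {v g h}, Good d μ f p v g h → Continuous fun x => v 0 x := fun G =>
    (G.cont.comp_continuous (f := fun x : ℝ => ((0:ℝ), x)) (by fun_prop) fun x => le_refl (0:ℝ))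
  have hc0 : Continuous fun x => u2 0 x - u1 0 x := (hslice G2).sub (hslice G1)
  obtain ⟨r0, hr0, H0⟩ := Metric.eventually_nhds_iff.1
    (hc0.continuousAt.eventually_mem (Ioi_mem_nhds hpos0))
  -- lower bound for the width
  obtain ⟨t1, ht1, hmin⟩ := (isCompact_Icc (a := 0) (b := τ)).exists_isMinOn ⟨0, le_rfl, hτ.le⟩
    ((G1.h_cont.mono hsub).sub (G1.g_cont.mono hsub))
  have hw0 : 0 < h1 t1 - g1 t1 := sub_pos.2 (G1.gh t1 ht1.1)
  obtain ⟨B0, hB0⟩ := (isCompact_Icc (a := 0) (b := τ)).exists_bound_of_continuousOn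
    (G1.ch.mono hsub)
  set r := min (r0 / 4) ((h1 t1 - g1 t1) / 4) with hr
  have hrpos : 0 < r := lt_min (by linarith) (by linarith)
  have r1 : r ≤ r0 / 4 := min_le_left _ _
  have r2 : r ≤ (h1 t1 - g1 t1) / 4 := min_le_right _ _
  have hwid : ∀ t ∈ Icc 0 τ, g1 t < h1 t - 2 * r := fun t ht => by
    have : h1 t1 - g1 t1 ≤ h1 t - g1 t := hmin ht
    linarith
  obtain ⟨κ, hκ, hopf⟩ := hopf d K (|B0| + 1) r τ E.hd (by positivity) hrpos hτ.le
  -- constant c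
  obtain ⟨y0, hy0, hymin⟩ := (isCompact_Icc (a := 0) (b := 2 * r)).exists_isMinOn
    ⟨0, le_rfl, by linarith⟩
    ((hc0.comp (by fun_prop : Continuous fun y : ℝ => h1 0 - y)).continuousOn)
  have hcpos : 0 < u2 0 (h1 0 - y0) - u1 0 (h1 0 - y0) := H0 (by
    rw [Real.dist_eq, abs_lt]
    constructor <;> linarith [hy0.1, hy0.2])
  set c0 := u2 0 (h1 0 - y0) - u1 0 (h1 0 - y0) with hc0'
  set c := c0 / (2 * r) with hc
  have hcp : 0 < c := by positivity
  have hh : ∀ t ∈ Icc 0 τ, g2 t ≤ g1 t ∧ h1 t ≤ h2 t := fun t ht => by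
    rcases ht.2.eq_or_lt with h | h
    · rw [h]; exact ⟨hg, heq.le⟩
    · exact ⟨(hgh t ⟨ht.1, h⟩).1.le, (hgh t ⟨ht.1, h⟩).2.le⟩
  have hsub2 : Reg 0 τ (fun t => h1 t - 2 * r) h1 ⊆ {q : ℝ × ℝ | 0 ≤ q.1} := fun q hq => hq.1.1
  have key := hopf 0 τ c h1 (deriv h1) (fun t x => u2 t x - u1 t x) hτ.le (by linarith) hcp.le
    (fun t ht => by
      obtain ⟨a, -, h, -⟩ := G1.dh t ht.1
      exact h.differentiableAt.hasDerivAt)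
    (fun t ht => by
      have := hB0 t ht
      rw [Real.norm_eq_abs] at this
      linarith [le_abs_self B0])
    ((G2.cont.mono hsub2).sub (G1.cont.mono hsub2))
    (fun t ht => sub_nonneg.2 (hu t ht _)) (fun t ht => sub_nonneg.2 (hu t ht _))
    (fun t x a1 a2 a3 a4 => by
      have ht : t ∈ Icc 0 τ := ⟨a1.le, a2⟩
      have a3' := (hwid t ht).trans a3
      obtain ⟨a, b, ha, hb, hab⟩ := G1.c2At a1 a3' a4
      obtain ⟨a', b', ha', hb', hab'⟩ := G2.c2At a1 ((hh t ht).1.trans_lt a3')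
        (a4.trans_le (hh t ht).2)
      refine ⟨_, _, hb'.sub hb, ha'.sub ha, ?_⟩
      have l := E.lip t x (u2 t x) (u1 t x) (G2.nonneg a1.le x) (G2.le_R E a1.le x)
        (G1.nonneg a1.le x) (G1.le_R E a1.le x)
      rw [abs_of_nonneg (sub_nonneg.2 (hu t ht x))] at l
      have := (abs_le.1 l).1
      rw [hab, hab']
      linarith)
    (fun y hy => by
      have k1 : c0 ≤ u2 0 (h1 0 - y) - u1 0 (h1 0 - y) := hymin hy
      refine le_trans ?_ k1
      rw [hc, div_mul_eq_mul_div, div_le_iff₀ (by linarith)]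
      exact mul_le_mul_of_nonneg_left hy.2 hcpos.le)
    τ ⟨hτ.le, le_rfl⟩
  obtain ⟨a1, -, dh1, du1⟩ := G1.dh τ hτ.le
  obtain ⟨a2, -, dh2, du2⟩ := G2.dh τ hτ.le
  have du : HasDerivWithinAt (fun x => u2 τ x - u1 τ x) (-(a2 - a1)) (Iic (h1 τ)) (h1 τ) := by
    rw [← heq] at du2
    exact (du2.fun_sub du1).congr_deriv (by ring)
  have k1 := slope_bound du (by
    rw [G1.zero τ hτ.le _ (Or.inr le_rfl), G2.zero τ hτ.le _ (Or.inr heq.ge), sub_zero]) hrpos key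
  have k2 := left_deriv_nonpos (dh2.fun_sub dh1) (by
    filter_upwards [Ioo_mem_nhdsLT hτ] with s hs
    have := (hgh s ⟨hs.1.le, hs.2⟩).2
    rw [heq]; linarith)
  have k3 : 0 < c * κ := by positivity
  have k4 : 0 < μ * (a2 - a1) := mul_pos E.hμ (by linarith)
  linarith

/-- Comparison principle for the free boundary problem. -/
theorem fbc (E : Env d μ ω L K R f p) {u1 u2 : ℝ → ℝ → ℝ} {g1 h1 g2 h2 : ℝ → ℝ}
    (G1 : Good d μ f p u1 g1 h1) (G2 : Good d μ f p u2 g2 h2)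
    (hg : g2 0 < g1 0) (hh : h1 0 < h2 0) (hu : ∀ x, u1 0 x ≤ u2 0 x) :
    ∀ t ≥ 0, g2 t < g1 t ∧ h1 t < h2 t ∧ ∀ x, u1 t x ≤ u2 t x := by
  have main : ∀ t ≥ 0, g2 t < g1 t ∧ h1 t < h2 t := by
    by_contra hcon
    push Not at hcon
    set φ : ℝ → ℝ := fun t => min (g1 t - g2 t) (h2 t - h1 t) with hφ
    have hφc : ContinuousOn φ (Ici 0) :=
      ContinuousOn.inf (G1.g_cont.sub G2.g_cont) (G2.h_cont.sub G1.h_cont)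
    have hφpos : ∀ t, 0 < φ t ↔ g2 t < g1 t ∧ h1 t < h2 t := fun t => by
      simp [hφ]
    set Z : Set ℝ := Ici 0 ∩ φ ⁻¹' (Iic 0) with hZ
    have hZc : IsClosed Z := hφc.preimage_isClosed_of_isClosed isClosed_Ici isClosed_Iic
    have hZn : Z.Nonempty := by
      obtain ⟨t, ht, h⟩ := hcon
      refine ⟨t, ht, ?_⟩
      by_contra hlt
      have h5 := (hφpos t).1 (not_le.1 hlt)
      exact absurd h5.2 (not_lt.2 (h h5.1))
    have hZb : BddBelow Z := ⟨0, fun t ht => ht.1⟩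
    have hmem := hZc.csInf_mem hZn hZb
    set τ := sInf Z with hτ
    have hbefore : ∀ t ∈ Ico 0 τ, g2 t < g1 t ∧ h1 t < h2 t := fun t ht => by
      rw [← hφpos]
      by_contra hle
      exact absurd (csInf_le hZb ⟨ht.1, not_lt.1 hle⟩) (not_le.2 ht.2)
    have hτpos : 0 < τ := by
      rcases (show 0 ≤ τ from hmem.1).eq_or_lt with h | h
      · have h6 : φ τ ≤ 0 := hmem.2
        rw [← h] at h6
        exact absurd ((hφpos 0).2 ⟨hg, hh⟩) (not_lt.2 h6)
      · exact h
    have hφτ : 0 ≤ φ τ := by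
      have hcw : Tendsto φ (𝓝[Ico 0 τ] τ) (𝓝 (φ τ)) :=
        (hφc τ hmem.1).mono_left (nhdsWithin_mono _ fun t ht => ht.1)
      have : (𝓝[Ico 0 τ] τ).NeBot := by
        rw [← mem_closure_iff_nhdsWithin_neBot, closure_Ico hτpos.ne]
        exact ⟨hτpos.le, le_rfl⟩
      refine ge_of_tendsto hcw ?_
      filter_upwards [self_mem_nhdsWithin] with t ht
      exact ((hφpos t).2 (hbefore t ht)).le
    have hφ0 : φ τ = 0 := le_antisymm hmem.2 hφτ
    have hgτ : g2 τ ≤ g1 τ := by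
      have := hφτ.trans (min_le_left _ _); linarith
    have hhτ : h1 τ ≤ h2 τ := by
      have := hφτ.trans (min_le_right _ _); linarith
    have hle : ∀ t ∈ Icc 0 τ, g2 t ≤ g1 t ∧ h1 t ≤ h2 t := fun t ht => by
      rcases ht.2.eq_or_lt with h | h
      · rw [h]; exact ⟨hgτ, hhτ⟩
      · exact ⟨(hbefore t ⟨ht.1, h⟩).1.le, (hbefore t ⟨ht.1, h⟩).2.le⟩
    have hule := fbc_mp E G1 G2 hu hle
    have n1 := fbc_right E G1 G2 hτpos hbefore hule hgτ
    have n2 := fbc_right E.refl G1.refl G2.refl hτpos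
      (fun t ht => ⟨by have := (hbefore t ht).2; linarith, by have := (hbefore t ht).1; linarith⟩)
      (fun t ht x => hule t ht _) (by linarith)
    rcases min_choice (g1 τ - g2 τ) (h2 τ - h1 τ) with h | h
    · apply n2
      have : g1 τ - g2 τ = 0 := by rw [← h]; exact hφ0
      linarith
    · apply n1
      have : h2 τ - h1 τ = 0 := by rw [← h]; exact hφ0
      linarith
  intro t ht
  exact ⟨(main t ht).1, (main t ht).2, fbc_mp E G1 G2 hu (τ := t)
    (fun s hs => ⟨(main s hs.1).1.le, (main s hs.1).2.le⟩) t ⟨ht, le_rfl⟩⟩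

end


section
variable {d μ ω L K R : ℝ} {f : ℝ → ℝ → ℝ → ℝ} {p : ℝ → ℝ → ℝ}

theorem first_zero {φ : ℝ → ℝ} {a b : ℝ} (hc : ContinuousOn φ (Icc a b)) (ha : 0 < φ a)
    (hb : ∃ t ∈ Icc a b, φ t ≤ 0) :
    ∃ τ ∈ Ioc a b, φ τ = 0 ∧ ∀ t ∈ Ico a τ, 0 < φ t := by
  set Z : Set ℝ := Icc a b ∩ φ ⁻¹' (Iic 0) with hZ
  have hZc : IsClosed Z := hc.preimage_isClosed_of_isClosed isClosed_Icc isClosed_Iic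
  have hZn : Z.Nonempty := by
    obtain ⟨t, ht, h⟩ := hb
    exact ⟨t, ht, h⟩
  have hZb : BddBelow Z := ⟨a, fun t ht => ht.1.1⟩
  have hmem := hZc.csInf_mem hZn hZb
  set τ := sInf Z with hτ
  have hle : φ τ ≤ 0 := hmem.2
  have hbefore : ∀ t ∈ Ico a τ, 0 < φ t := fun t ht => by
    by_contra hle
    exact absurd (csInf_le hZb ⟨⟨ht.1, ht.2.le.trans hmem.1.2⟩, not_lt.1 hle⟩) (not_le.2 ht.2)
  have hτa : a < τ := by
    rcases hmem.1.1.eq_or_lt with h | h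
    · rw [← h] at hle; linarith
    · exact h
  refine ⟨τ, ⟨hτa, hmem.1.2⟩, le_antisymm hle ?_, hbefore⟩
  have hcw : Tendsto φ (𝓝[Ico a τ] τ) (𝓝 (φ τ)) :=
    (hc τ hmem.1).mono_left (nhdsWithin_mono _ fun t ht => ⟨ht.1, ht.2.le.trans hmem.1.2⟩)
  have : (𝓝[Ico a τ] τ).NeBot := by
    rw [← mem_closure_iff_nhdsWithin_neBot, closure_Ico hτa.ne]
    exact ⟨hτa.le, le_rfl⟩
  refine ge_of_tendsto hcw ?_
  filter_upwards [self_mem_nhdsWithin] with t ht using (hbefore t ht).le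

theorem Good.h_mono (hμ : 0 < μ) {u : ℝ → ℝ → ℝ} {g h : ℝ → ℝ} (G : Good d μ f p u g h) :
    MonotoneOn h (Ici 0) := by
  refine monotoneOn_of_deriv_nonneg (convex_Ici 0) G.h_cont ?_ ?_
  · intro t ht
    rw [interior_Ici] at ht
    obtain ⟨a, -, h1, -⟩ := G.dh t (le_of_lt ht)
    exact h1.differentiableAt.differentiableWithinAt
  · intro t ht
    rw [interior_Ici] at ht
    obtain ⟨a, ha, h1, -⟩ := G.dh t (le_of_lt ht)
    rw [h1.deriv]; positivity

theorem Good.g_anti (hμ : 0 < μ) {u : ℝ → ℝ → ℝ} {g h : ℝ → ℝ} (G : Good d μ f p u g h) :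
    AntitoneOn g (Ici 0) := by
  intro a ha b hb hab
  have := G.refl.h_mono hμ ha hb hab
  linarith

theorem Env.f_le (E : Env d μ ω L K R f p) {t x a : ℝ} (h0 : 0 ≤ a) (hR : a ≤ R) :
    |f t x a| ≤ K * a := by
  have := E.lip t x a 0 h0 hR le_rfl E.hR.le
  rwa [E.f0, sub_zero, sub_zero, abs_of_nonneg h0] at this

/-- Upper bound for the motion of the front when `u` is small near the front. -/
theorem claimB (E : Env d μ ω L K R f p) {u : ℝ → ℝ → ℝ} {g h : ℝ → ℝ}
    (G : Good d μ f p u g h) {r δ ε' t1 t2 : ℝ} (hr : 0 < r) (hrK : K * r ^ 2 ≤ 2 * d)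
    (hδ : 0 < δ) (hε' : 2 * μ * δ / r < ε') (ht1 : 0 ≤ t1) (ht12 : t1 ≤ t2)
    (hu : ∀ t ∈ Icc t1 t2, ∀ x ∈ Icc (h t - r) (h t), u t x ≤ δ) :
    h t2 ≤ h t1 + r + ε' * (t2 - t1) := by
  have hd := E.hd
  have hμ := E.hμ
  have hε0 : 0 < ε' := lt_trans (by positivity) hε'
  set hb : ℝ → ℝ := fun t => h t1 + r + ε' * (t - t1) with hhb
  by_contra hcon
  push Not at hcon
  have hsub : Icc t1 t2 ⊆ Ici 0 := fun t ht => ht1.trans ht.1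
  have hbc : Continuous hb := by simp only [hhb]; fun_prop
  obtain ⟨τ, hτ, hτ0, hbef⟩ := first_zero (φ := fun t => hb t - h t) (a := t1) (b := t2)
    (hbc.continuousOn.sub (G.h_cont.mono hsub)) (by simp only [hhb]; linarith)
    ⟨t2, ⟨ht12, le_rfl⟩, by simp only [hhb]; linarith⟩
  have hτ1 : 0 ≤ τ := ht1.trans hτ.1.le
  set A := δ / r ^ 2 with hA
  have hApos : 0 < A := by positivity
  have hAr : A * r ^ 2 = δ := by rw [hA]; field_simp
  set z : ℝ → ℝ → ℝ := fun t x => A * (2 * r * (hb t - x) - (hb t - x) ^ 2) with hz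
  have hle : ∀ t ∈ Icc t1 τ, h t ≤ hb t := fun t ht => by
    rcases ht.2.eq_or_lt with h | h
    · rw [h]; linarith
    · have := hbef t ⟨ht.1, h⟩; linarith
  have hlow : ∀ t ∈ Icc t1 τ, h t1 ≤ hb t - r := fun t ht => by
    simp only [hhb]
    have := mul_nonneg hε0.le (sub_nonneg.2 ht.1)
    linarith
  have hsub' : Icc t1 τ ⊆ Ici 0 := fun t ht => ht1.trans ht.1
  have hsub2 : Reg t1 τ (fun t => hb t - r) h ⊆ {q : ℝ × ℝ | 0 ≤ q.1} :=
    fun q hq => ht1.trans hq.1.1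
  have zcont : Continuous (fun q : ℝ × ℝ => z q.1 q.2) := by simp only [hz]; fun_prop
  have hzx : ∀ t x, HasDerivAt (z t) (A * (-(2 * r) + 2 * (hb t - x))) x := fun t x => by
    have i1 : HasDerivAt (fun y => hb t - y) (-1) x := (hasDerivAt_id' x).const_sub _
    exact (((i1.const_mul (2 * r)).fun_sub (i1.fun_pow 2)).const_mul A).congr_deriv (by
      simp)
  have key := mp_curves (s := t1) (τ := τ) (α := fun t => hb t - r) (β := h)
    (by fun_prop) (G.h_cont.mono hsub') (w := fun t x => z t x - u t x)
    (zcont.continuousOn.sub (G.cont.mono hsub2)) (K := K) hd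
    (fun x hx => by
      have e : x = h t1 := by
        refine le_antisymm hx.2 ?_
        have := hx.1
        simp only [hhb] at this
        linarith
      rw [e, G.zero t1 ht1 _ (Or.inr le_rfl)]
      simp only [hz, hhb, sub_zero]
      have e2 : h t1 + r + ε' * (t1 - t1) - h t1 = r := by ring
      rw [e2]
      nlinarith)
    (fun t ht hle' => by
      have := hu t ⟨ht.1, ht.2.trans hτ.2⟩ (hb t - r) ⟨by linarith [hle t ht], hle'⟩
      simp only [hz]
      have e2 : hb t - (hb t - r) = r := by ring
      rw [e2]
      nlinarith)
    (fun t ht hle' => by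
      simp only [hz]
      rw [G.zero t (hsub' ht) _ (Or.inr le_rfl), sub_zero]
      have y0 : 0 ≤ hb t - h t := sub_nonneg.2 (hle t ht)
      have y1 : hb t - h t ≤ r := by linarith
      refine mul_nonneg hApos.le ?_
      nlinarith)
    (fun t x a1 a2 a3 a4 a5 => by
      have ht : t ∈ Icc t1 τ := ⟨a1.le, a2⟩
      have ht0 : 0 < t := ht1.trans_lt a1
      have hgx : g t < x := by
        have i1 := G.g_anti hμ ht1 ht0.le a1.le
        have i2 := G.gh t1 ht1
        have i3 := hlow t ht
        linarith
      obtain ⟨a, b, ha, hb', hab⟩ := G.c2At ht0 hgx a4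
      have zt : HasDerivAt (fun τ => z τ x) (A * ((2 * r - 2 * (hb t - x)) * ε')) t := by
        have i1 : HasDerivAt (fun t => hb t - x) ε' t := by
          simp only [hhb]
          exact (((((hasDerivAt_id' t).sub_const t1).const_mul ε').const_add
            (h t1 + r)).sub_const x).congr_deriv (by ring)
        exact (((i1.const_mul (2 * r)).fun_sub (i1.fun_pow 2)).const_mul A).congr_deriv (by
          push_cast; ring)
      have zx : C2At (z t) x (A * (-2)) := by
        refine C2At.of_hasDerivAt (hzx t) ?_
        have i1 : HasDerivAt (fun y => hb t - y) (-1) x := (hasDerivAt_id' x).const_sub _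
        exact (((i1.const_mul 2).const_add (-(2 * r))).const_mul A).congr_deriv (by ring)
      refine ⟨_, _, zt.sub hb', zx.sub ha, ?_⟩
      have hfu := (abs_le.1 (E.f_le (t := t) (x := x) (G.nonneg ht0.le x) (G.le_R E ht0.le x))).2
      rw [hab]
      have y0 : 0 ≤ hb t - x := by linarith [hle t ht]
      have y1 : hb t - x ≤ r := by linarith
      have k1 : 0 ≤ A * ((2 * r - 2 * (hb t - x)) * ε') :=
        mul_nonneg hApos.le (mul_nonneg (by linarith) hε0.le)
      have k2 : K * z t x ≤ 2 * d * A := by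
        have : z t x ≤ A * r ^ 2 := by
          simp only [hz]
          refine mul_le_mul_of_nonneg_left ?_ hApos.le
          nlinarith [sq_nonneg (r - (hb t - x))]
        calc K * z t x ≤ K * (A * r ^ 2) := mul_le_mul_of_nonneg_left this E.hK.le
          _ = A * (K * r ^ 2) := by ring
          _ ≤ A * (2 * d) := mul_le_mul_of_nonneg_left hrK hApos.le
          _ = _ := by ring
      linarith)
    τ ⟨hτ.1.le, le_rfl⟩
  obtain ⟨a, -, dh, du⟩ := G.dh τ hτ1
  have heq : hb τ = h τ := by linarith
  have dz := (hzx τ (h τ)).hasDerivWithinAt (s := Iic (h τ))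
  have dd : HasDerivWithinAt (fun x => z τ x - u τ x) (-(2 * r * A - a)) (Iic (h τ)) (h τ) :=
    (dz.fun_sub du).congr_deriv (by rw [heq]; ring)
  have k1 : 0 ≤ 2 * r * A - a := slope_bound dd (by
    simp only [hz]
    rw [G.zero τ hτ1 _ (Or.inr le_rfl), heq]; ring) hr (fun y hy => by
      rw [zero_mul]
      exact key _ ⟨by linarith [hy.2, heq], by linarith [hy.1]⟩)
  have dhb : HasDerivAt hb ε' τ := by
    simp only [hhb]
    exact ((((hasDerivAt_id' τ).sub_const t1).const_mul ε').const_add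
      (h t1 + r)).congr_deriv (by ring)
  have k2 := left_deriv_nonpos (dhb.fun_sub dh) (by
    filter_upwards [Ioo_mem_nhdsLT hτ.1] with s hs
    have := hbef s ⟨hs.1.le, hs.2⟩
    linarith)
  have k3 : 2 * μ * δ / r = μ * (2 * r * A) := by
    rw [hA]; field_simp
  have k4 : μ * a ≤ μ * (2 * r * A) := mul_le_mul_of_nonneg_left (by linarith) hμ.le
  linarith

/-- Linear upper bound for the front. -/
theorem linear_bound (E : Env d μ ω L K R f p) : ∃ C > 0, ∀ {u : ℝ → ℝ → ℝ} {g h : ℝ → ℝ},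
    Good d μ f p u g h → ∀ t1 t2, 0 ≤ t1 → t1 ≤ t2 → h t2 ≤ h t1 + C + C * (t2 - t1) := by
  have hd := E.hd
  have hK := E.hK
  have hμ := E.hμ
  have hR := E.hR
  set r := Real.sqrt (2 * d / K) with hr
  have hrpos : 0 < r := Real.sqrt_pos.2 (by positivity)
  have hrK : K * r ^ 2 ≤ 2 * d := by
    rw [hr, Real.sq_sqrt (by positivity)]; field_simp; exact le_rfl
  have hq : 0 < 2 * μ * R / r := by positivity
  refine ⟨r + (2 * μ * R / r + 1), by positivity, fun {u g h} G t1 t2 h1 h2 => ?_⟩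
  have := claimB E G hrpos hrK hR (lt_add_one _) h1 h2 (fun t ht x _ => G.le_R E (h1.trans ht.1) x)
  have h3 := mul_nonneg hrpos.le (sub_nonneg.2 h2)
  nlinarith

/-- One-sided Lipschitz bound, by doubling of variables. -/
theorem one_sided (E : Env d μ ω L K R f p) : ∃ M > 0, ∀ {u : ℝ → ℝ → ℝ} {g h : ℝ → ℝ},
    Good d μ f p u g h → ∀ t1 x1, 1 ≤ t1 → g 0 < x1 - 2 → ∀ s ∈ Icc (0:ℝ) 1,
      u t1 x1 - u t1 (x1 - s) ≤ 2 * M * s := by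
  have hd := E.hd
  have hK := E.hK
  have hμ := E.hμ
  have hR := E.hR
  set M := R + (R + 2 * K * R + 2 * d * R) / (4 * d) + 1 with hM
  have hMR : R ≤ M := by
    have : 0 < (R + 2 * K * R + 2 * d * R) / (4 * d) := by positivity
    linarith
  have hMd : R + 2 * K * R + 2 * d * R < 4 * d * M := by
    have : 4 * d * M = 4 * d * R + (R + 2 * K * R + 2 * d * R) + 4 * d := by
      rw [hM]; field_simp
    nlinarith [mul_pos hd hR]
  refine ⟨M, hR.trans_le hMR, fun {u g h} G t1 x1 ht1 hx1 s₀ hs₀ => ?_⟩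
  set Φ : ℝ × ℝ × ℝ → ℝ := fun q => u q.1 q.2.1 - u q.1 (q.2.1 - q.2.2)
    - M * (2 * q.2.2 - q.2.2 ^ 2) - R * (t1 - q.1) - R * (q.2.1 - x1) ^ 2 with hΦ
  set D : Set (ℝ × ℝ × ℝ) := Icc (t1 - 1) t1 ×ˢ (Icc (x1 - 1) (x1 + 1) ×ˢ Icc 0 1) with hD
  have hDc : IsCompact D := isCompact_Icc.prod (isCompact_Icc.prod isCompact_Icc)
  have hΦc : ContinuousOn Φ D := by
    have c1 : ContinuousOn (fun q : ℝ × ℝ × ℝ => u q.1 q.2.1) D :=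
      G.cont.comp (by fun_prop : ContinuousOn (fun q : ℝ × ℝ × ℝ => (q.1, q.2.1)) D)
        fun q hq => by have := hq.1.1; show 0 ≤ q.1; linarith
    have c2 : ContinuousOn (fun q : ℝ × ℝ × ℝ => u q.1 (q.2.1 - q.2.2)) D :=
      G.cont.comp (by fun_prop : ContinuousOn (fun q : ℝ × ℝ × ℝ => (q.1, q.2.1 - q.2.2)) D)
        fun q hq => by have := hq.1.1; show 0 ≤ q.1; linarith
    simp only [hΦ]
    exact (((c1.sub c2).sub (by fun_prop)).sub (by fun_prop)).sub (by fun_prop)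
  have hmem0 : (t1, x1, s₀) ∈ D :=
    ⟨⟨by simp, le_rfl⟩, ⟨⟨by simp, by simp⟩, hs₀⟩⟩
  obtain ⟨⟨t, x, s⟩, hmem, hmax⟩ := hDc.exists_isMaxOn ⟨_, hmem0⟩ hΦc
  have hmax' : ∀ t' x' y', t' ∈ Icc (t1 - 1) t1 → x' ∈ Icc (x1 - 1) (x1 + 1) →
      x' - y' ∈ Icc (0:ℝ) 1 →
      u t' x' - u t' y' - M * (2 * (x' - y') - (x' - y') ^ 2) - R * (t1 - t') - R * (x' - x1) ^ 2 ≤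
      u t x - u t (x - s) - M * (2 * s - s ^ 2) - R * (t1 - t) - R * (x - x1) ^ 2 := by
    intro t' x' y' h1 h2 h3
    have := hmax (a := (t', x', x' - y')) ⟨h1, h2, h3⟩
    simpa [hΦ] using this
  obtain ⟨⟨ta, tb⟩, ⟨xa, xb⟩, ⟨sa, sb⟩⟩ := hmem
  dsimp only at ta tb xa xb sa sb
  have ht0 : 0 ≤ t := by linarith
  have n1 := G.nonneg ht0 x
  have n2 := G.nonneg ht0 (x - s)
  have m1 := G.le_R E ht0 x
  have m2 := G.le_R E ht0 (x - s)
  suffices hle : u t x - u t (x - s) - M * (2 * s - s ^ 2) - R * (t1 - t) - R * (x - x1) ^ 2 ≤ 0 by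
    have h1 := hmax' t1 x1 (x1 - s₀) ⟨by linarith, le_rfl⟩ ⟨by linarith, by linarith⟩
      (by rwa [sub_sub_cancel])
    rw [sub_sub_cancel] at h1
    have := mul_nonneg (hR.le.trans hMR) (sq_nonneg s₀)
    nlinarith
  by_contra hpos
  push Not at hpos
  have b1 : 0 ≤ M * (2 * s - s ^ 2) := mul_nonneg (by linarith) (by nlinarith)
  have b2 : 0 ≤ R * (t1 - t) := mul_nonneg hR.le (by linarith)
  have b3 : 0 ≤ R * (x - x1) ^ 2 := mul_nonneg hR.le (sq_nonneg _)
  have hta : t1 - 1 < t := by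
    rcases ta.eq_or_lt with h | h
    · have : R * (t1 - t) = R := by rw [← h]; ring
      linarith
    · exact h
  have hxa : x1 - 1 < x := by
    rcases xa.eq_or_lt with h | h
    · have : R * (x - x1) ^ 2 = R := by rw [← h]; ring
      linarith
    · exact h
  have hxb : x < x1 + 1 := by
    rcases xb.eq_or_lt with h | h
    · have : R * (x - x1) ^ 2 = R := by rw [h]; ring
      linarith
    · exact h
  have hsa : 0 < s := by
    rcases sa.eq_or_lt with h | h
    · have : u t (x - s) = u t x := by rw [← h, sub_zero]
      linarith
    · exact h
  have hsb : s < 1 := by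
    rcases sb.eq_or_lt with h | h
    · have : M * (2 * s - s ^ 2) = M := by rw [h]; ring
      linarith
    · exact h
  have htpos : 0 < t := by linarith
  have hux : 0 < u t x := by linarith
  have hg0 := G.g_anti hμ (self_mem_Ici) ht0 ht0
  have hgx : g t < x - s := by linarith
  have hxh : x < h t := by
    by_contra hle
    have := G.zero t ht0 x (Or.inr (not_lt.1 hle))
    linarith
  obtain ⟨a, b, ha, hb, hab⟩ := G.c2At htpos (by linarith : g t < x) hxh
  obtain ⟨a', b', ha', hb', hab'⟩ := G.c2At htpos hgx (by linarith)
  have q1 : a ≤ 2 * R - 2 * M := by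
    have hq : C2At (fun x' => M * (2 * (x' - (x - s)) - (x' - (x - s)) ^ 2) + R * (x' - x1) ^ 2) x
        (-2 * M + 2 * R) := by
      refine C2At.of_hasDerivAt (φ' := fun x' => M * (2 - 2 * (x' - (x - s))) + R * (2 * (x' - x1)))
        (fun y => ?_) ?_
      · have i1 : HasDerivAt (fun y => y - (x - s)) 1 y := (hasDerivAt_id' y).sub_const _
        have i2 : HasDerivAt (fun y => y - x1) 1 y := (hasDerivAt_id' y).sub_const _
        exact ((((i1.const_mul 2).fun_sub (i1.fun_pow 2)).const_mul M).fun_add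
          ((i2.fun_pow 2).const_mul R)).congr_deriv (by simp)
      · have i1 : HasDerivAt (fun y => y - (x - s)) 1 x := (hasDerivAt_id' x).sub_const _
        have i2 : HasDerivAt (fun y => y - x1) 1 x := (hasDerivAt_id' x).sub_const _
        exact ((((i1.const_mul 2).const_sub 2).const_mul M).fun_add
          ((i2.const_mul 2).const_mul R)).congr_deriv (by ring)
    have := (ha.sub hq).nonpos_of_max (by
      have m1 : Ioo (max (x1 - 1) (x - s)) (min (x1 + 1) (x - s + 1)) ∈ 𝓝 x :=
        Ioo_mem_nhds (max_lt hxa (by linarith)) (lt_min hxb (by linarith))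
      filter_upwards [m1] with y hy
      have y1 := (le_max_left _ _).trans_lt hy.1
      have y2 := (le_max_right _ _).trans_lt hy.1
      have y3 := hy.2.trans_le (min_le_left _ _)
      have y4 := hy.2.trans_le (min_le_right _ _)
      have := hmax' t y (x - s) ⟨ta, tb⟩ ⟨y1.le, y3.le⟩ ⟨by linarith, by linarith⟩
      have e : x - (x - s) = s := by ring
      rw [e]
      linarith)
    linarith
  have q2 : 2 * M ≤ a' := by
    have hq : C2At (fun y => M * (2 * (x - y) - (x - y) ^ 2)) (x - s) (-2 * M) := by
      refine C2At.of_hasDerivAt (φ' := fun y => M * (-2 + 2 * (x - y))) (fun y => ?_) ?_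
      · have i1 : HasDerivAt (fun y => x - y) (-1) y := (hasDerivAt_id' y).const_sub _
        exact (((i1.const_mul 2).fun_sub (i1.fun_pow 2)).const_mul M).congr_deriv (by simp)
      · have i1 : HasDerivAt (fun y => x - y) (-1) (x - s) := (hasDerivAt_id' _).const_sub _
        exact (((i1.const_mul 2).const_add (-2)).const_mul M).congr_deriv (by ring)
    have := (ha'.neg.sub hq).nonpos_of_max (by
      have m1 : Ioo (x - 1) x ∈ 𝓝 (x - s) := Ioo_mem_nhds (by linarith) (by linarith)
      filter_upwards [m1] with y hy
      have := hmax' t x y ⟨ta, tb⟩ ⟨xa, xb⟩ ⟨by linarith [hy.2], by linarith [hy.1]⟩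
      have e : x - (x - s) = s := by ring
      rw [e]
      linarith)
    linarith
  have q3 : 0 ≤ b - b' + R := by
    have i : HasDerivAt (fun τ => u τ x - u τ (x - s) - R * (t1 - τ)) (b - b' + R) t := by
      exact ((hb.fun_sub hb').fun_sub (((hasDerivAt_id' t).const_sub t1).const_mul R)).congr_deriv
        (by ring)
    refine left_deriv_nonneg i ?_
    filter_upwards [Ioo_mem_nhdsLT hta] with τ hτ
    have := hmax' τ x (x - s) ⟨hτ.1.le, hτ.2.le.trans tb⟩ ⟨xa, xb⟩ (by
      rw [sub_sub_cancel]; exact ⟨sa, sb⟩)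
    rw [sub_sub_cancel] at this
    linarith
  have f1 := (abs_le.1 (E.f_le (t := t) (x := x) n1 m1)).2
  have f2 := (abs_le.1 (E.f_le (t := t) (x := x - s) n2 m2)).1
  have f3 : K * u t x ≤ K * R := mul_le_mul_of_nonneg_left m1 hK.le
  have f4 : K * u t (x - s) ≤ K * R := mul_le_mul_of_nonneg_left m2 hK.le
  have q4 : d * a ≤ d * (2 * R - 2 * M) := mul_le_mul_of_nonneg_left q1 hd.le
  have q5 : d * (2 * M) ≤ d * a' := mul_le_mul_of_nonneg_left q2 hd.le
  linarith

end


section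
variable {d μ ω L K R : ℝ} {f : ℝ → ℝ → ℝ → ℝ} {p : ℝ → ℝ → ℝ}

set_option maxHeartbeats 1000000 in
/-- Travelling bump subsolution. -/
theorem bump (E : Env d μ ω L K R f p) {B ℓ : ℝ} (hℓ : 0 < ℓ) :
    ∃ Λ > 0, ∀ {u : ℝ → ℝ → ℝ} {g h : ℝ → ℝ}, Good d μ f p u g h → ∀ t0 x0 η b T, 0 ≤ t0 → 0 ≤ η →
      0 ≤ b → b ≤ B → 0 ≤ T → g 0 < x0 - ℓ - b * T → x0 + ℓ ≤ h t0 →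
      (∀ x ∈ Icc (x0 - ℓ) (x0 + ℓ), η ≤ u t0 x) →
      η * Real.exp (-Λ * T) ≤ u (t0 + T) (x0 - b * T) := by
  have hd := E.hd
  have hK := E.hK
  have hμ := E.hμ
  set ζ : ℝ → ℝ := fun ξ => (ℓ ^ 2 - ξ ^ 2) ^ 2 with hζ
  set ζ1 : ℝ → ℝ := fun ξ => -4 * ξ * (ℓ ^ 2 - ξ ^ 2) with hζ1
  set ζ2 : ℝ → ℝ := fun ξ => 12 * ξ ^ 2 - 4 * ℓ ^ 2 with hζ2
  have D1 : ∀ y, HasDerivAt ζ (ζ1 y) y := fun y => by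
    have i1 : HasDerivAt (fun y => ℓ ^ 2 - y ^ 2) (-(2 * y)) y :=
      (((hasDerivAt_id' y).fun_pow 2).const_sub _).congr_deriv (by simp)
    exact (i1.fun_pow 2).congr_deriv (by simp only [hζ1]; push_cast; ring)
  have D2 : ∀ y, HasDerivAt ζ1 (ζ2 y) y := fun y => by
    have i1 : HasDerivAt (fun y => ℓ ^ 2 - y ^ 2) (-(2 * y)) y :=
      (((hasDerivAt_id' y).fun_pow 2).const_sub _).congr_deriv (by simp)
    exact (((hasDerivAt_id' y).const_mul (-4)).fun_mul i1).congr_deriv (by simp only [hζ2]; ring)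
  obtain ⟨Λ0, hΛ0, hΛ⟩ := exists_large_mult (s := Icc (-ℓ) ℓ) isCompact_Icc
    (A := fun y => d * ζ2 y - B * |ζ1 y|) (ψ := ζ)
    (by simp only [hζ2, hζ1]; fun_prop) (by simp only [hζ]; fun_prop)
    (fun x _ => by simp only [hζ]; positivity)
    (fun x _ h0 => by
      simp only [hζ] at h0
      have h1 : ℓ ^ 2 - x ^ 2 = 0 := by simpa using h0
      have h2 : x ^ 2 = ℓ ^ 2 := by linarith
      simp only [hζ2, hζ1, h1, h2]
      simp
      have : 0 < d * ℓ ^ 2 := by positivity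
      linarith)
  refine ⟨Λ0 + K, by positivity, fun {u g h} G t0 x0 η b T ht0 hη hb hbB hT hg hh hu => ?_⟩
  set Λ := Λ0 + K with hΛd
  set z : ℝ → ℝ → ℝ := fun t x => η / ℓ ^ 4 * Real.exp (-Λ * (t - t0)) * ζ (x - x0 + b * (t - t0))
    with hz
  have hc : 0 ≤ η / ℓ ^ 4 := by positivity
  have hsub : Reg t0 (t0 + T) (fun t => x0 - b * (t - t0) - ℓ) (fun t => x0 - b * (t - t0) + ℓ) ⊆
      {q : ℝ × ℝ | 0 ≤ q.1} := fun q hq => ht0.trans hq.1.1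
  have zcont : Continuous (fun q : ℝ × ℝ => z q.1 q.2) := by simp only [hz, hζ]; fun_prop
  have key := mp_curves (s := t0) (τ := t0 + T) (α := fun t => x0 - b * (t - t0) - ℓ)
    (β := fun t => x0 - b * (t - t0) + ℓ) (by fun_prop) (by fun_prop)
    (w := fun t x => u t x - z t x)
    ((G.cont.mono hsub).sub zcont.continuousOn) (K := -K) hd
    (fun x hx => by
      have h1 : x ∈ Icc (x0 - ℓ) (x0 + ℓ) := by simpa using hx
      have h2 := hu x h1
      have h3 : ζ (x - x0) ≤ ℓ ^ 4 := by
        simp only [hζ]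
        have : (x - x0) ^ 2 ≤ ℓ ^ 2 := by
          rw [sq_le_sq, abs_of_pos hℓ, abs_le]; exact ⟨by linarith [h1.1], by linarith [h1.2]⟩
        nlinarith [sq_nonneg (x - x0)]
      simp only [hz, sub_self, mul_zero, Real.exp_zero, mul_one, add_zero]
      have := mul_le_mul_of_nonneg_left h3 hc
      rw [div_mul_cancel₀ _ (by positivity)] at this
      linarith)
    (fun t ht _ => by
      have e : x0 - b * (t - t0) - ℓ - x0 + b * (t - t0) = -ℓ := by ring
      simp only [hz, hζ]
      rw [e]
      simpa using G.nonneg (ht0.trans ht.1) _)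
    (fun t ht _ => by
      have e : x0 - b * (t - t0) + ℓ - x0 + b * (t - t0) = ℓ := by ring
      simp only [hz, hζ]
      rw [e]
      simpa using G.nonneg (ht0.trans ht.1) _)
    (fun t x a1 a2 a3 a4 _ => by
      have htp : 0 < t := ht0.trans_lt a1
      have hgx : g t < x := by
        have i1 := G.g_anti hμ self_mem_Ici htp.le htp.le
        have i2 : b * (t - t0) ≤ b * T := mul_le_mul_of_nonneg_left (by linarith) hb
        linarith
      have hxh : x < h t := by
        have i1 := G.h_mono hμ ht0 htp.le a1.le
        have i2 : 0 ≤ b * (t - t0) := mul_nonneg hb (by linarith)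
        linarith
      obtain ⟨a, b', ha, hb', hab⟩ := G.c2At htp hgx hxh
      set ξ := x - x0 + b * (t - t0) with hξ
      set e := Real.exp (-Λ * (t - t0)) with he
      have hepos : 0 < e := Real.exp_pos _
      have zt : HasDerivAt (fun τ => z τ x) (η / ℓ ^ 4 * e * (-Λ * ζ ξ + b * ζ1 ξ)) t := by
        have i1 : HasDerivAt (fun t => x - x0 + b * (t - t0)) b t :=
          ((((hasDerivAt_id' t).sub_const t0).const_mul b).const_add (x - x0)).congr_deriv (by ring)
        have i2 : HasDerivAt (fun t => Real.exp (-Λ * (t - t0))) (e * -Λ) t :=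
          ((((hasDerivAt_id' t).sub_const t0).const_mul (-Λ)).exp).congr_deriv (by rw [he]; ring)
        have i3 := HasDerivAt.comp_real (g := fun t => x - x0 + b * (t - t0)) (D1 ξ) i1
        exact ((i2.const_mul (η / ℓ ^ 4)).fun_mul i3).congr_deriv (by ring)
      have zx : C2At (z t) x (η / ℓ ^ 4 * e * ζ2 ξ) := by
        have i1 : ∀ y, HasDerivAt (fun y => y - x0 + b * (t - t0)) 1 y := fun y =>
          ((hasDerivAt_id' y).sub_const x0).add_const _
        refine C2At.of_hasDerivAt
          (φ' := fun y => η / ℓ ^ 4 * e * ζ1 (y - x0 + b * (t - t0))) (fun y => ?_) ?_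
        · exact ((HasDerivAt.comp_real (g := fun y => y - x0 + b * (t - t0)) (D1 _) (i1 y)).const_mul (η / ℓ ^ 4 * e)).congr_deriv
            (by ring)
        · exact ((HasDerivAt.comp_real (g := fun y => y - x0 + b * (t - t0)) (D2 _) (i1 x)).const_mul
            (η / ℓ ^ 4 * e)).congr_deriv (by ring)
      refine ⟨_, _, hb'.sub zt, ha.sub zx, ?_⟩
      have hfu := (abs_le.1 (E.f_le (t := t) (x := x) (G.nonneg htp.le x) (G.le_R E htp.le x))).1
      have k1 := hΛ ξ ⟨by rw [hξ]; linarith, by rw [hξ]; linarith⟩ Λ0 le_rfl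
      have k2 : b * ζ1 ξ ≤ B * |ζ1 ξ| :=
        (mul_le_mul_of_nonneg_left (le_abs_self _) hb).trans
          (mul_le_mul_of_nonneg_right hbB (abs_nonneg _))
      have k3 : 0 ≤ η / ℓ ^ 4 * e * (d * ζ2 ξ - b * ζ1 ξ + (Λ - K) * ζ ξ) := by
        refine mul_nonneg (mul_nonneg hc hepos.le) ?_
        have : Λ - K = Λ0 := by rw [hΛd]; ring
        rw [this]
        linarith
      have k4 : z t x = η / ℓ ^ 4 * e * ζ ξ := rfl
      rw [hab, k4]
      nlinarith)
    (t0 + T) ⟨by linarith, le_rfl⟩ (x0 - b * T) ⟨by nlinarith, by nlinarith⟩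
  have e1 : z (t0 + T) (x0 - b * T) = η * Real.exp (-Λ * T) := by
    have e : x0 - b * T - x0 + b * (t0 + T - t0) = 0 := by ring
    simp only [hz, hζ]
    rw [e, add_sub_cancel_left]
    field_simp
    ring
  rw [e1] at key
  linarith

/-- Plateau lemma. -/
theorem plateau (E : Env d μ ω L K R f p) {δ ε : ℝ} (hδ : 0 < δ) (hδR : δ ≤ R) (hε : 0 < ε) :
    ∃ k : ℕ, ∃ R0 > 0, ∀ {u : ℝ → ℝ → ℝ} {g h : ℝ → ℝ}, Good d μ f p u g h → ∀ a,
      (∀ x ∈ Icc (a - R0) (a + R0), δ ≤ u 0 x) → p 0 a - 2 * ε ≤ u (k * ω) a := by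
  have hd := E.hd
  have hK := E.hK
  have hμ := E.hμ
  have hR := E.hR
  obtain ⟨v, vc, vb, vs, v0, k, hk⟩ := E.plat δ hδ hδR ε hε
  have hkω : 0 ≤ k * ω := mul_nonneg (Nat.cast_nonneg k) E.hω.le
  set lam := K + d with hlam
  have hlp : 0 < lam := by positivity
  set Q := R * Real.exp (lam * (k * ω)) / ε with hQ
  have hQp : 0 < Q := by positivity
  obtain ⟨R0, hR0, hR0Q⟩ : ∃ R0 > 0, Q ≤ Real.cosh R0 := by
    refine ⟨2 * Q, by positivity, ?_⟩
    rw [Real.cosh_eq]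
    have h1 := Real.add_one_le_exp (2 * Q)
    have h2 := Real.exp_pos (-(2 * Q))
    linarith
  have hch : 0 < Real.cosh R0 := Real.cosh_pos R0
  refine ⟨k, R0, hR0, fun {u g h} G a hu => ?_⟩
  set C := R / Real.cosh R0 with hC
  have hCp : 0 < C := by positivity
  set q : ℝ → ℝ → ℝ := fun t x => C * Real.exp (lam * t) * Real.cosh (x - a) with hq
  have hq0 : ∀ t x, 0 < q t x := fun t x => by
    have := Real.cosh_pos (x - a)
    simp only [hq]; positivity
  have hsub : Reg 0 (k * ω) (fun _ => a - R0) (fun _ => a + R0) ⊆ {q : ℝ × ℝ | 0 ≤ q.1} :=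
    fun q hq => hq.1.1
  have qc : Continuous (fun r : ℝ × ℝ => q r.1 r.2) := by simp only [hq]; fun_prop
  have hedge : ∀ t ≥ 0, R ≤ C * Real.exp (lam * t) * Real.cosh R0 := fun t ht => by
    have h1 : 1 ≤ Real.exp (lam * t) := Real.one_le_exp (by positivity)
    have h2 : C * Real.cosh R0 = R := by rw [hC]; field_simp
    calc R = C * Real.cosh R0 * 1 := by rw [h2, mul_one]
      _ ≤ C * Real.cosh R0 * Real.exp (lam * t) := mul_le_mul_of_nonneg_left h1 (by positivity)
      _ = _ := by ring
  have hga : g 0 < a - R0 := by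
    by_contra hle
    have := hu (a - R0) ⟨le_rfl, by linarith⟩
    rw [G.zero 0 le_rfl _ (Or.inl (not_lt.1 hle))] at this
    linarith
  have hha : a + R0 < h 0 := by
    by_contra hle
    have := hu (a + R0) ⟨by linarith, le_rfl⟩
    rw [G.zero 0 le_rfl _ (Or.inr (not_lt.1 hle))] at this
    linarith
  have key := mp_curves (s := 0) (τ := k * ω) (α := fun _ => a - R0) (β := fun _ => a + R0)
    (by fun_prop) (by fun_prop) (w := fun t x => u t x - v t x + q t x)
    (((G.cont.mono hsub).sub (vc.mono hsub)).add qc.continuousOn) (K := K) hd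
    (fun x hx => by
      have := hu x hx
      have h2 := hq0 0 x
      rw [v0]; linarith)
    (fun t ht _ => by
      have h1 := hedge t ht.1
      have h2 := (vb t ht.1 (a - R0)).2
      have h3 := G.nonneg ht.1 (a - R0)
      simp only [hq]
      have e : a - R0 - a = - R0 := by ring
      rw [e, Real.cosh_neg]
      linarith)
    (fun t ht _ => by
      have h1 := hedge t ht.1
      have h2 := (vb t ht.1 (a + R0)).2
      have h3 := G.nonneg ht.1 (a + R0)
      simp only [hq]
      have e : a + R0 - a = R0 := by ring
      rw [e]
      linarith)
    (fun t x a1 a2 a3 a4 a5 => by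
      have i1 := G.g_anti hμ self_mem_Ici a1.le a1.le
      have i2 := G.h_mono hμ self_mem_Ici a1.le a1.le
      obtain ⟨A, b, ha, hb, hab⟩ := G.c2At a1 (by linarith : g t < x) (by linarith : x < h t)
      obtain ⟨A', b', ha', hb', hab'⟩ := vs.c2At (t := t) (x := x) (Eventually.of_forall fun _ => a1)
      have qt : HasDerivAt (fun τ => - q τ x) (-(lam * q t x)) t := by
        have i2 : HasDerivAt (fun t => Real.exp (lam * t)) (Real.exp (lam * t) * lam) t :=
          (((hasDerivAt_id' t).const_mul lam).exp).congr_deriv (by ring)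
        exact ((i2.const_mul C).mul_const (Real.cosh (x - a))).fun_neg.congr_deriv
          (by simp only [hq]; ring)
      have qx : C2At (fun x => - q t x) x (- q t x) := by
        have i1 : ∀ y, HasDerivAt (fun y => y - a) 1 y := fun y => (hasDerivAt_id' y).sub_const a
        refine C2At.of_hasDerivAt
          (φ' := fun y => -(C * Real.exp (lam * t) * Real.sinh (y - a))) (fun y => ?_) ?_
        · exact (((i1 y).cosh).const_mul _).fun_neg.congr_deriv (by ring)
        · exact (((i1 x).sinh).const_mul _).fun_neg.congr_deriv (by simp only [hq]; ring)
      have e1 : (fun τ => u τ x - v τ x + q τ x) = fun τ => u τ x - v τ x - (- q τ x) := by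
        funext τ; ring
      have e2 : (fun x => u t x - v t x + q t x) = fun x => u t x - v t x - (- q t x) := by
        funext τ; ring
      refine ⟨b - b' - (-(lam * q t x)), A - A' - (- q t x), ?_, ?_, ?_⟩
      · rw [e1]; exact (hb.fun_sub hb').fun_sub qt
      · rw [e2]; exact (ha.sub ha').sub qx
      · have hv := vb t a1.le x
        have l := E.lip t x (u t x) (v t x) (G.nonneg a1.le x) (G.le_R E a1.le x) hv.1 hv.2
        have hq1 := hq0 t x
        rw [abs_of_neg (by linarith : u t x - v t x < 0)] at l
        have := (abs_le.1 l).1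
        rw [hab, hab', hlam]
        nlinarith)
    (k * ω) ⟨hkω, le_rfl⟩ a ⟨by linarith, by linarith⟩
  have h1 : q (k * ω) a ≤ ε := by
    simp only [hq, sub_self, Real.cosh_zero, mul_one]
    rw [hC, div_mul_eq_mul_div, div_le_iff₀ hch]
    rw [hQ, div_le_iff₀ hε] at hR0Q
    linarith
  have := hk a
  linarith

/-- If the front frequently is beyond `c' t`, the solution is bounded below there. -/
theorem combined (E : Env d μ ω L K R f p) {u : ℝ → ℝ → ℝ} {g h : ℝ → ℝ} (G : Good d μ f p u g h)
    {c' : ℝ} (hc : 0 < c') (hfr : ∃ᶠ t in atTop, c' * t ≤ h t) :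
    ∃ δ > 0, δ ≤ R ∧ ∃ C, ∀ N0 : ℕ, ∃ N ≥ N0, ∃ X ≥ c' * (N * ω) - C,
      ∀ x ∈ Icc (X - L) X, δ ≤ u (N * ω) x := by
  have hd := E.hd
  have hK := E.hK
  have hμ := E.hμ
  have hR := E.hR
  have hω := E.hω
  have hL := E.hL
  set r := Real.sqrt (2 * d / K) with hr
  have hrpos : 0 < r := Real.sqrt_pos.2 (by positivity)
  have hrK : K * r ^ 2 ≤ 2 * d := by
    rw [hr, Real.sq_sqrt (by positivity)]; field_simp; exact le_rfl
  set δ0 := c' * r / (8 * μ) with hδ0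
  have hδ0p : 0 < δ0 := by positivity
  have hδ0c : 2 * μ * δ0 / r < c' / 2 := by
    have : 2 * μ * δ0 / r = c' / 4 := by rw [hδ0]; field_simp; norm_num
    rw [this]; linarith
  obtain ⟨C, hC, hlin⟩ := linear_bound E
  obtain ⟨M, hM, hone⟩ := one_sided E
  -- Step 1
  have step1 : ∀ T0 ≥ (0:ℝ), ∃ t1 ≥ T0, ∃ x1 ∈ Icc (h t1 - r) (h t1), δ0 < u t1 x1 ∧
      c' * t1 - (2 * C + r) ≤ h t1 := by
    intro T0 hT0
    have hev : ∀ᶠ t in atTop, T0 ≤ t ∧ h T0 + r < c' / 2 * t := by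
      refine (eventually_ge_atTop T0).and ?_
      exact (tendsto_id.const_mul_atTop (by positivity : 0 < c' / 2)).eventually_gt_atTop _
    obtain ⟨t, ht, htT, htb⟩ := (hfr.and_eventually hev).exists
    set S : Set ℝ := {τ | τ ∈ Icc T0 t ∧ ∃ x1 ∈ Icc (h τ - r) (h τ), δ0 < u τ x1} with hS
    have hSn : S.Nonempty := by
      by_contra hne
      rw [not_nonempty_iff_eq_empty] at hne
      have := claimB E G hrpos hrK hδ0p hδ0c hT0 htT (fun τ hτ x hx => by
        by_contra hlt
        have : τ ∈ S := ⟨hτ, x, hx, not_le.1 hlt⟩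
        rw [hne] at this
        exact this)
      nlinarith
    have hSb : BddAbove S := ⟨t, fun τ hτ => hτ.1.2⟩
    obtain ⟨t1, ht1S, ht1⟩ := exists_lt_of_lt_csSup hSn (show sSup S - 1 < sSup S by linarith)
    obtain ⟨⟨ha, hb⟩, x1, hx1, hu1⟩ := ht1S
    refine ⟨t1, ha, x1, hx1, hu1, ?_⟩
    rcases le_or_gt (t1 + 1) t with hle | hgt
    · have k1 := claimB E G hrpos hrK hδ0p hδ0c (by linarith : 0 ≤ t1 + 1) hle (fun τ hτ x hx => by
        by_contra hlt
        have : τ ∈ S := ⟨⟨by linarith [hτ.1], hτ.2⟩, x, hx, not_le.1 hlt⟩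
        have := le_csSup hSb this
        linarith [hτ.1])
      have k2 := hlin G t1 (t1 + 1) (by linarith) (by linarith)
      nlinarith
    · have k2 := hlin G t1 t (by linarith) hb
      nlinarith
  set ℓ' := min 1 (δ0 / (4 * M)) with hℓ'
  have hℓ'p : 0 < ℓ' := lt_min one_pos (by positivity)
  have hℓ'1 : ℓ' ≤ 1 := min_le_left _ _
  have hℓ'2 : 2 * M * ℓ' ≤ δ0 / 2 := by
    have : ℓ' ≤ δ0 / (4 * M) := min_le_right _ _
    rw [le_div_iff₀ (by positivity)] at this
    linarith
  obtain ⟨Λ, hΛ, hbump⟩ := bump E (B := L) (ℓ := ℓ' / 2) (by positivity)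
  set δ := δ0 / 2 * Real.exp (-Λ * (1 + ω)) with hδ
  have hδp : 0 < δ := by positivity
  refine ⟨min δ R, lt_min hδp hR, min_le_right _ _, c' * (1 + ω) + 2 * C + 2 * r + 1, fun N0 => ?_⟩
  obtain ⟨T1, hT1⟩ := eventually_atTop.1 (G.h_top.eventually_gt_atTop (g 0 + r + 3 + L))
  obtain ⟨t1, ht1, x1, hx1, hu1, hh1⟩ := step1 (max (max 1 T1) (N0 * ω))
    (le_max_of_le_left (le_max_of_le_left zero_le_one))
  have ht1a : 1 ≤ t1 := ((le_max_left _ _).trans (le_max_left _ _)).trans ht1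
  have ht1b : g 0 + r + 3 + L < h t1 := hT1 t1 (((le_max_right _ _).trans (le_max_left _ _)).trans ht1)
  have ht1c : N0 * ω ≤ t1 := (le_max_right _ _).trans ht1
  set N := ⌈(t1 + 1) / ω⌉₊ with hN
  have hN1 : t1 + 1 ≤ N * ω := (div_le_iff₀ hω).1 (Nat.le_ceil _)
  have hN2 : N * ω < t1 + 1 + ω := by
    have := Nat.ceil_lt_add_one (show 0 ≤ (t1 + 1) / ω by positivity)
    have h2 := mul_lt_mul_of_pos_right this hω
    rw [add_mul, div_mul_cancel₀ _ hω.ne', one_mul] at h2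
    exact h2
  refine ⟨N, ?_, x1 - ℓ' / 2, ?_, ?_⟩
  · have : (N0:ℝ) * ω ≤ N * ω := by linarith
    exact_mod_cast le_of_mul_le_mul_right this hω
  · have := hx1.1
    have h3 : c' * (N * ω) ≤ c' * (t1 + 1 + ω) := mul_le_mul_of_nonneg_left hN2.le hc.le
    show c' * (N * ω) - _ ≤ _
    linarith
  · intro y hy
    set T := N * ω - t1 with hT
    have hTp : 0 < T := by linarith
    have := hbump G t1 (x1 - ℓ' / 2) (δ0 / 2) ((x1 - ℓ' / 2 - y) / T) T (by linarith) (by positivity)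
      (div_nonneg (by linarith [hy.2]) hTp.le)
      ((div_le_iff₀ hTp).2 (by nlinarith [hy.1])) hTp.le
      (by rw [div_mul_cancel₀ _ hTp.ne']; linarith [hy.1, hx1.1])
      (by linarith [hx1.2])
      (fun x hx => by
        have := hone G t1 x1 ht1a (by linarith [hx1.1]) (x1 - x)
          ⟨by linarith [hx.2], by linarith [hx.1]⟩
        rw [sub_sub_cancel] at this
        have h2 : 2 * M * (x1 - x) ≤ 2 * M * ℓ' :=
          mul_le_mul_of_nonneg_left (by linarith [hx.1]) (by positivity)
        linarith)
    rw [div_mul_cancel₀ _ hTp.ne', sub_sub_cancel, hT, add_sub_cancel, ← hT] at this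
    refine (min_le_left _ _).trans (le_trans ?_ this)
    refine mul_le_mul_of_nonneg_left (Real.exp_le_exp.2 ?_) (by positivity)
    nlinarith

end


section
variable {d μ ω L K R : ℝ} {f : ℝ → ℝ → ℝ → ℝ} {p : ℝ → ℝ → ℝ}

/-- The `m`-th translate of `U` at time `0` lies strictly below `V` at time `nω`. -/
def Dom (ω L : ℝ) (U V : ℝ → ℝ → ℝ) (gU hU gV hV : ℝ → ℝ) (n m : ℕ) : Prop :=
  gV (n * ω) < gU 0 + m * L ∧ hU 0 + m * L < hV (n * ω) ∧ ∀ x, U 0 (x - m * L) ≤ V (n * ω) x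

theorem Dom.propagate (E : Env d μ ω L K R f p) {U V : ℝ → ℝ → ℝ} {gU hU gV hV : ℝ → ℝ}
    (GU : Good d μ f p U gU hU) (GV : Good d μ f p V gV hV) {n m : ℕ}
    (h : Dom ω L U V gU hU gV hV n m) {t : ℝ} (ht : 0 ≤ t) :
    gV (t + n * ω) < gU t + m * L ∧ hU t + m * L < hV (t + n * ω) ∧
      ∀ x, U t (x - m * L) ≤ V (t + n * ω) x := by
  have G1 := GU.shift E 0 (-(m:ℤ))
  have G2 := GV.shift E n 0
  have := fbc E G1 G2 (by simpa using h.1) (by simpa using h.2.1)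
    (fun x => by simpa [sub_eq_add_neg] using h.2.2 x) t ht
  refine ⟨by simpa using this.1, by simpa using this.2.1, fun x => ?_⟩
  simpa [sub_eq_add_neg] using this.2.2 x

theorem Env.p_min (E : Env d μ ω L K R f p) : ∃ ε > 0, ∀ t x, ε ≤ p t x := by
  have hω := E.hω
  have hL := E.hL
  obtain ⟨q, hq, hmin⟩ := (isCompact_Icc.prod isCompact_Icc :
    IsCompact (Icc (0:ℝ) ω ×ˢ Icc (0:ℝ) L)).exists_isMinOn
    ⟨(0, 0), ⟨⟨le_rfl, hω.le⟩, ⟨le_rfl, hL.le⟩⟩⟩ E.p_cont.continuousOn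
  refine ⟨_, E.p_pos q.1 q.2, fun t x => ?_⟩
  obtain ⟨t', ht', e1⟩ := Function.Periodic.exists_mem_Ico₀ (f := fun t => p t x)
    (fun t => E.p_per_t t x) hω t
  obtain ⟨x', hx', e2⟩ := Function.Periodic.exists_mem_Ico₀ (f := fun x => p t' x)
    (fun x => E.p_per_x t' x) hL x
  rw [e1, e2]
  exact hmin (a := (t', x')) ⟨⟨ht'.1, ht'.2.le⟩, ⟨hx'.1, hx'.2.le⟩⟩

theorem Env.p_per_x_nat (E : Env d μ ω L K R f p) (m : ℕ) (t x : ℝ) :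
    p t (x - m * L) = p t x := by
  have := E.p_per_x_int (-(m:ℤ)) t x
  simpa [sub_eq_add_neg] using this

theorem Good.gap (E : Env d μ ω L K R f p) {U : ℝ → ℝ → ℝ} {gU hU : ℝ → ℝ}
    (GU : Good d μ f p U gU hU) : ∃ ε > 0, ∀ x ∈ Icc (gU 0) (hU 0), U 0 x + 2 * ε ≤ p 0 x := by
  have c1 : ContinuousOn (fun x => p 0 x - U 0 x) (Icc (gU 0) (hU 0)) := by
    refine ContinuousOn.sub ?_ ?_
    · exact (E.p_cont.comp (by fun_prop : Continuous fun x : ℝ => ((0:ℝ), x))).continuousOn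
    · exact (GU.cont.comp_continuous (f := fun x : ℝ => ((0:ℝ), x)) (by fun_prop)
        fun x => le_refl (0:ℝ)).continuousOn
  obtain ⟨y, hy, hmin⟩ := isCompact_Icc.exists_isMinOn
    ⟨gU 0, ⟨le_rfl, (GU.gh 0 le_rfl).le⟩⟩ c1
  refine ⟨(p 0 y - U 0 y) / 2, by linarith [GU.ltp 0 le_rfl y], fun x hx => ?_⟩
  have := hmin hx
  simp only [mem_ofPred_eq] at this
  linarith

/-- If `V` is close to `p` on the support of the `m`-th translate then `Dom` holds. -/
theorem Dom.of_close (E : Env d μ ω L K R f p) {U V : ℝ → ℝ → ℝ} {gU hU gV hV : ℝ → ℝ}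
    (GU : Good d μ f p U gU hU) (GV : Good d μ f p V gV hV) {n m : ℕ} {ε : ℝ} (hε : 0 < ε)
    (hgap : ∀ x ∈ Icc (gU 0) (hU 0), U 0 x + 2 * ε ≤ p 0 x)
    (hcl : ∀ x ∈ Icc (gU 0 + m * L) (hU 0 + m * L), p 0 x - ε ≤ V (n * ω) x) :
    Dom ω L U V gU hU gV hV n m := by
  have hn : (0:ℝ) ≤ n * ω := mul_nonneg (Nat.cast_nonneg n) E.hω.le
  have hgh := GU.gh 0 le_rfl
  have key : ∀ x ∈ Icc (gU 0 + m * L) (hU 0 + m * L), U 0 (x - m * L) + ε ≤ V (n * ω) x := by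
    intro x hx
    have h1 := hgap (x - m * L) ⟨by linarith [hx.1], by linarith [hx.2]⟩
    rw [E.p_per_x_nat] at h1
    have h2 := hcl x hx
    linarith
  have hpos : ∀ x ∈ Icc (gU 0 + m * L) (hU 0 + m * L), 0 < V (n * ω) x := fun x hx => by
    have := key x hx
    have := GU.nonneg le_rfl (x - m * L)
    linarith
  refine ⟨?_, ?_, fun x => ?_⟩
  · by_contra hle
    have := hpos _ ⟨le_rfl, by linarith⟩
    rw [GV.zero _ hn _ (Or.inl (not_lt.1 hle))] at this
    exact lt_irrefl _ this
  · by_contra hle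
    have := hpos _ ⟨by linarith, le_rfl⟩
    rw [GV.zero _ hn _ (Or.inr (not_lt.1 hle))] at this
    exact lt_irrefl _ this
  · by_cases hx : x ∈ Icc (gU 0 + m * L) (hU 0 + m * L)
    · have := key x hx; linarith
    · rw [GU.zero 0 le_rfl]
      · exact GV.nonneg hn x
      · by_contra hcon
        push Not at hcon
        exact hx ⟨by linarith [hcon.1], by linarith [hcon.2]⟩

theorem tendsto_nat_mul_atTop {ω : ℝ} (hω : 0 < ω) :
    Tendsto (fun n : ℕ => (n:ℝ) * ω) atTop atTop :=
  tendsto_natCast_atTop_atTop.atTop_mul_const hω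

theorem spread_lemma (E : Env d μ ω L K R f p) {U V : ℝ → ℝ → ℝ} {gU hU gV hV : ℝ → ℝ}
    (GU : Good d μ f p U gU hU) (GV : Good d μ f p V gV hV) (j : ℕ) :
    ∀ᶠ n in atTop, ∀ m ≤ j, Dom ω L U V gU hU gV hV n m := by
  obtain ⟨ε, hε, hgap⟩ := GU.gap E
  have hL := E.hL
  set A := |gU 0| + |hU 0| + j * L + 1 with hA
  have hjL : 0 ≤ j * L := by positivity
  have hAp : 0 < A := by positivity
  obtain ⟨T, hT⟩ := GV.conv A hAp ε hε
  filter_upwards [(tendsto_nat_mul_atTop E.hω).eventually_ge_atTop T] with n hn m hm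
  have hmL : m * L ≤ j * L := mul_le_mul_of_nonneg_right (by exact_mod_cast hm) hL.le
  have hmL0 : 0 ≤ m * L := by positivity
  refine Dom.of_close E GU GV hε hgap fun x hx => ?_
  have h1 := hT _ hn x ⟨by linarith [neg_abs_le (gU 0), abs_nonneg (hU 0), hx.1],
    by linarith [le_abs_self (hU 0), abs_nonneg (gU 0), hx.2]⟩
  have h2 := E.p_per_t_nat n 0 x
  rw [zero_add] at h2
  rw [h2] at h1
  linarith [(abs_le.1 h1).1]

theorem core_step (E : Env d μ ω L K R f p) {U V : ℝ → ℝ → ℝ} {gU hU gV hV : ℝ → ℝ}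
    (GU : Good d μ f p U gU hU) (GV : Good d μ f p V gV hV) {c' : ℝ} (hc : 0 < c')
    (hfr : ∃ᶠ t in atTop, c' * t ≤ hU t) :
    ∃ k : ℕ, ∃ C, ∀ N0 : ℕ, ∃ N ≥ N0, ∃ J : ℕ, c' * (N * ω) - C ≤ J * L ∧ ∀ᶠ n in atTop,
      ∀ j, (∀ m ≤ j, Dom ω L U V gU hU gV hV n m) →
        ∀ m ≤ j + J, Dom ω L U V gU hU gV hV (n + N + k) m := by
  obtain ⟨ε, hε, hgap⟩ := GU.gap E
  have hL := E.hL
  have hω := E.hω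
  obtain ⟨δ, hδ, hδR, C, hcomb⟩ := combined E GU hc hfr
  obtain ⟨k, R0, hR0, hplat⟩ := plateau E hδ hδR (by positivity : 0 < ε / 2)
  refine ⟨k, C + R0 + |hU 0| + L, fun N0 => ?_⟩
  obtain ⟨N1, hN1⟩ := eventually_atTop.1 (((tendsto_nat_mul_atTop hω).const_mul_atTop
    hc).eventually_ge_atTop (C + R0 + |hU 0|))
  obtain ⟨N, hN, X, hX, hUX⟩ := hcomb (max N0 N1)
  have hXp : 0 ≤ X - R0 - hU 0 := by
    have := hN1 N ((le_max_right _ _).trans hN)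
    linarith [le_abs_self (hU 0)]
  set J := ⌊(X - R0 - hU 0) / L⌋₊ with hJ
  have hJ1 : J * L ≤ X - R0 - hU 0 :=
    (le_div_iff₀ hL).1 (Nat.floor_le (div_nonneg hXp hL.le))
  have hJ2 : X - R0 - hU 0 < (J + 1) * L := (div_lt_iff₀ hL).1 (Nat.lt_floor_add_one _)
  refine ⟨N, (le_max_left _ _).trans hN, J, by linarith [le_abs_self (hU 0)], ?_⟩
  set m0 := ⌈(X - L + R0 - gU 0) / L⌉₊ with hm0
  obtain ⟨n1, hn1⟩ := eventually_atTop.1 (spread_lemma E GU GV m0)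
  filter_upwards [eventually_ge_atTop n1] with n hn j hj m hm
  rcases le_or_gt m m0 with hmm | hmm
  · exact hn1 _ (by omega) m hmm
  · have hmL : X - L + R0 - gU 0 ≤ m * L := by
      have h1 : (X - L + R0 - gU 0) / L ≤ m0 := Nat.le_ceil _
      have h2 : (m0:ℝ) ≤ m := by exact_mod_cast hmm.le
      exact (div_le_iff₀ hL).1 (h1.trans h2)
    have hmJ : m * L ≤ j * L + J * L := by
      rw [← add_mul]
      exact mul_le_mul_of_nonneg_right (by exact_mod_cast hm) hL.le
    have hNω : 0 ≤ N * ω := by positivity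
    -- lower bound by δ
    have hδV : ∀ x ∈ Icc (X - L) (X + j * L), δ ≤ V ((n + N : ℕ) * ω) x := by
      intro x hx
      -- choose the translate
      have hex : ∃ i ≤ j, x - i * L ∈ Icc (X - L) X := by
        set i := ⌈(x - X) / L⌉₊ with hi
        refine ⟨i, ?_, ?_, ?_⟩
        · exact Nat.ceil_le.2 ((div_le_iff₀ hL).2 (by linarith [hx.2]))
        · rcases le_or_gt ((x - X) / L) 0 with h0 | h0
          · have : i = 0 := Nat.ceil_eq_zero.2 h0
            rw [this]; simpa using hx.1
          · have := Nat.ceil_lt_add_one h0.le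
            have h2 := mul_lt_mul_of_pos_right this hL
            rw [add_mul, div_mul_cancel₀ _ hL.ne'] at h2
            linarith
        · have : (x - X) ≤ i * L := (div_le_iff₀ hL).1 (Nat.le_ceil _)
          linarith
      obtain ⟨i, hij, hxi⟩ := hex
      have h1 := ((hj i hij).propagate E GU GV hNω).2.2 x
      have h2 := hUX _ hxi
      have e : ((n + N : ℕ) : ℝ) * ω = N * ω + n * ω := by push_cast; ring
      rw [e]
      linarith
    refine Dom.of_close E GU GV hε hgap fun a ha => ?_
    have GV' := GV.shift E (n + N) 0
    have := hplat GV' a (fun x hx => by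
      have := hδV x ⟨by linarith [hx.1, ha.1], by linarith [hx.2, ha.2]⟩
      simpa using this)
    have e : ((n + N + k : ℕ) : ℝ) * ω = k * ω + (n + N : ℕ) * ω := by push_cast; ring
    rw [e]
    simp only [Int.cast_zero, zero_mul, add_zero] at this
    linarith

theorem core_iter (E : Env d μ ω L K R f p) {U V : ℝ → ℝ → ℝ} {gU hU gV hV : ℝ → ℝ}
    (GU : Good d μ f p U gU hU) (GV : Good d μ f p V gV hV) {c' : ℝ} (hc : 0 < c')
    (hfr : ∃ᶠ t in atTop, c' * t ≤ hU t) {c'' : ℝ} (hc'' : c'' < c') (h0 : 0 ≤ c'') (A : ℝ) :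
    ∀ᶠ n : ℕ in atTop, ∃ j : ℕ, c'' * (n * ω) + A ≤ j * L ∧
      ∀ m ≤ j, Dom ω L U V gU hU gV hV n m := by
  have hL := E.hL
  have hω := E.hω
  obtain ⟨k, C, hstep⟩ := core_step E GU GV hc hfr
  obtain ⟨N0, hN0⟩ := eventually_atTop.1 (((tendsto_nat_mul_atTop hω).const_mul_atTop
    (sub_pos.2 hc'')).eventually_gt_atTop (C + c'' * (k * ω)))
  obtain ⟨N, hN, J, hJ, hev⟩ := hstep (max N0 1)
  have hgain : c'' * ((N + k : ℕ) * ω) < J * L := by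
    have := hN0 N ((le_max_left _ _).trans hN)
    push_cast
    nlinarith
  set P := N + k with hP
  have hP1 : 1 ≤ P := ((le_max_right _ _).trans hN).trans (by omega)
  have hPpos : (0:ℝ) < P := by exact_mod_cast hP1
  obtain ⟨n1, hn1⟩ := eventually_atTop.1 (hev.and (spread_lemma E GU GV 0))
  have iter : ∀ i n, n1 ≤ n → ∀ m ≤ i * J, Dom ω L U V gU hU gV hV (n + i * P) m := by
    intro i
    induction i with
    | zero => intro n hn m hm; simpa using (hn1 n hn).2 m (by simpa using hm)
    | succ i ih =>
      intro n hn m hm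
      have := (hn1 (n + i * P) (by omega)).1 (i * J) (ih n hn) m (by
        rw [Nat.succ_mul] at hm; exact hm)
      have e : n + (i + 1) * P = n + i * P + N + k := by rw [hP]; ring
      rw [e]; exact this
  -- choose i
  set γ := J * L / P with hγ
  have hγc : c'' * ω < γ := by
    rw [hγ, lt_div_iff₀ hPpos]
    linarith
  have hγ0 : 0 < γ := lt_of_le_of_lt (by positivity) hγc
  have hev2 : ∀ᶠ n : ℕ in atTop, γ * (n1 + P) + A ≤ (γ - c'' * ω) * n := by
    exact (tendsto_natCast_atTop_atTop.const_mul_atTop (sub_pos.2 hγc)).eventually_ge_atTop _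
  filter_upwards [hev2, eventually_ge_atTop n1] with n hn hnn
  set i := (n - n1) / P with hi
  set r := (n - n1) % P with hr
  have hdiv : P * i + r = n - n1 := Nat.div_add_mod _ _
  have hrP : r < P := Nat.mod_lt _ hP1
  have hn' : n = (n1 + r) + i * P := by
    have : n = n1 + (n - n1) := by omega
    rw [this, ← hdiv]; ring
  refine ⟨i * J, ?_, ?_⟩
  · have h1 : (n:ℝ) = n1 + r + i * P := by exact_mod_cast hn'
    have h2 : (r:ℝ) < P := by exact_mod_cast hrP
    have h3 : γ * P = J * L := by rw [hγ]; field_simp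
    push_cast
    have h4 : (i:ℝ) * J * L = γ * (n - n1 - r) := by
      have : (n:ℝ) - n1 - r = i * P := by linarith
      rw [this]
      calc (i:ℝ) * J * L = i * (J * L) := by ring
        _ = i * (γ * P) := by rw [h3]
        _ = _ := by ring
    rw [h4]
    have h5 : γ * r ≤ γ * P := mul_le_mul_of_nonneg_left h2.le hγ0.le
    linarith
  · intro m hm
    have := iter i (n1 + r) (by omega) m hm
    rwa [← hn'] at this

theorem core (E : Env d μ ω L K R f p) {U V : ℝ → ℝ → ℝ} {gU hU gV hV : ℝ → ℝ}
    (GU : Good d μ f p U gU hU) (GV : Good d μ f p V gV hV) {c' : ℝ} (hc : 0 < c')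
    (hfr : ∃ᶠ t in atTop, c' * t ≤ hU t) {c'' : ℝ} (hc'' : c'' < c') (h0 : 0 ≤ c'') {ε : ℝ}
    (hε : 0 < ε) :
    ∃ T, ∀ t ≥ T, ∀ x ∈ Icc 0 (c'' * t), p t x - ε ≤ V t x := by
  have hL := E.hL
  have hω := E.hω
  obtain ⟨s1, hs1⟩ := GU.conv L hL ε hε
  set s0 := max s1 0 with hs0
  have hs00 : 0 ≤ s0 := le_max_right _ _
  obtain ⟨n0, hn0⟩ := eventually_atTop.1
    (core_iter E GU GV hc hfr hc'' h0 (c'' * (s0 + ω)))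
  refine ⟨s0 + (n0 + 1) * ω, fun t ht x hx => ?_⟩
  have hq : 0 ≤ (t - s0) / ω := by
    refine div_nonneg ?_ hω.le
    have : 0 ≤ (n0 + 1) * ω := by positivity
    linarith
  set n := ⌊(t - s0) / ω⌋₊ with hn
  have hn1 : n * ω ≤ t - s0 := (le_div_iff₀ hω).1 (Nat.floor_le hq)
  have hn2 : t - s0 < (n + 1) * ω := (div_lt_iff₀ hω).1 (Nat.lt_floor_add_one _)
  have hnn : n0 ≤ n := by
    refine Nat.le_floor ((le_div_iff₀ hω).2 ?_)
    linarith
  obtain ⟨j, hj, hord⟩ := hn0 n hnn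
  set m := ⌊x / L⌋₊ with hm
  have hm1 : m * L ≤ x := (le_div_iff₀ hL).1 (Nat.floor_le (div_nonneg hx.1 hL.le))
  have hm2 : x < (m + 1) * L := (div_lt_iff₀ hL).1 (Nat.lt_floor_add_one _)
  have hmj : m ≤ j := by
    have : m * L ≤ j * L := by
      refine (hm1.trans (hx.2.trans ?_)).trans hj
      have : t ≤ n * ω + (s0 + ω) := by linarith
      have := mul_le_mul_of_nonneg_left this h0
      linarith
    exact_mod_cast le_of_mul_le_mul_right this hL
  have hts : s0 ≤ t - n * ω := by linarith
  have h1 := ((hord m hmj).propagate E GU GV (t := t - n * ω) (by linarith)).2.2 x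
  rw [sub_add_cancel] at h1
  have h2 := hs1 (t - n * ω) ((le_max_left _ _).trans hts) (x - m * L)
    ⟨by linarith, by linarith⟩
  rw [E.p_per_x_nat] at h2
  have h3 := E.p_per_t_nat n (t - n * ω) x
  rw [sub_add_cancel] at h3
  rw [h3]
  linarith [(abs_le.1 h2).1]

theorem core_front (E : Env d μ ω L K R f p) {U V : ℝ → ℝ → ℝ} {gU hU gV hV : ℝ → ℝ}
    (GU : Good d μ f p U gU hU) (GV : Good d μ f p V gV hV) {c' : ℝ} (hc : 0 < c')
    (hfr : ∃ᶠ t in atTop, c' * t ≤ hU t) {c'' : ℝ} (hc'' : c'' < c') (h0 : 0 ≤ c'') :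
    ∀ᶠ t in atTop, c'' * t ≤ hV t := by
  obtain ⟨ε, hε, hp⟩ := E.p_min
  obtain ⟨T, hT⟩ := core E GU GV hc hfr hc'' h0 (by positivity : 0 < ε / 2)
  filter_upwards [eventually_ge_atTop T, eventually_ge_atTop 0] with t ht ht0
  by_contra hlt
  have h1 := hT t ht (c'' * t) ⟨by positivity, le_rfl⟩
  rw [GV.zero t ht0 _ (Or.inr (not_le.1 hlt).le)] at h1
  have := hp t (c'' * t)
  linarith

theorem speed_pos (E : Env d μ ω L K R f p) {U : ℝ → ℝ → ℝ} {gU hU : ℝ → ℝ}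
    (GU : Good d μ f p U gU hU) : ∃ c > 0, ∃ᶠ t in atTop, c * t ≤ hU t := by
  have hL := E.hL
  have hω := E.hω
  obtain ⟨k0, hk0, hord⟩ := ((eventually_ge_atTop 1).and (spread_lemma E GU GU 1)).exists
  have hk : (0:ℝ) < k0 := by exact_mod_cast hk0
  have ho := hord 1 le_rfl
  have hind : ∀ n : ℕ, hU 0 + n * L ≤ hU (n * (k0 * ω)) := by
    intro n
    induction n with
    | zero => simp
    | succ n ih =>
      have := (ho.propagate E GU GU (t := n * (k0 * ω)) (by positivity)).2.1
      have e : ((n + 1 : ℕ) : ℝ) * (k0 * ω) = n * (k0 * ω) + k0 * ω := by push_cast; ring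
      rw [e]
      push_cast at this ⊢
      linarith
  refine ⟨L / (2 * (k0 * ω)), by positivity, ?_⟩
  have ht : Tendsto (fun n : ℕ => (n:ℝ) * (k0 * ω)) atTop atTop :=
    tendsto_nat_mul_atTop (by positivity)
  refine ht.frequently (Eventually.frequently ?_)
  filter_upwards [(tendsto_nat_mul_atTop hL).eventually_ge_atTop (-2 * hU 0)] with n hn
  have h1 := hind n
  have e : L / (2 * (k0 * ω)) * (n * (k0 * ω)) = n * L / 2 := by field_simp
  rw [e]
  linarith

theorem speed (E : Env d μ ω L K R f p) {U : ℝ → ℝ → ℝ} {gU hU : ℝ → ℝ}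
    (GU : Good d μ f p U gU hU) : ∃ c > 0, ∀ {V : ℝ → ℝ → ℝ} {gV hV : ℝ → ℝ},
      Good d μ f p V gV hV →
      (∀ c'', 0 ≤ c'' → c'' < c → ∀ ε > 0, ∃ T, ∀ t ≥ T, ∀ x ∈ Icc 0 (c'' * t),
        p t x - ε ≤ V t x) ∧ Tendsto (fun t => hV t / t) atTop (𝓝 c) := by
  set S : Set ℝ := {c | 0 < c ∧ ∃ᶠ t in atTop, c * t ≤ hU t} with hS
  obtain ⟨c0, hc0, hf0⟩ := speed_pos E GU
  obtain ⟨C, hC, hlin⟩ := linear_bound E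
  have hSb : BddAbove S := by
    refine ⟨C, fun c hc => ?_⟩
    by_contra hlt
    push Not at hlt
    have hev : ∀ᶠ t : ℝ in atTop, 0 ≤ t ∧ hU 0 + C < (c - C) * t :=
      (eventually_ge_atTop 0).and
        ((tendsto_id.const_mul_atTop (sub_pos.2 hlt)).eventually_gt_atTop _)
    obtain ⟨t, h1, h2, h3⟩ := (hc.2.and_eventually hev).exists
    have := hlin GU 0 t le_rfl h2
    linarith
  have hlt_ex : ∀ c'' < sSup S, ∃ c ∈ S, c'' < c := fun c'' h =>
    exists_lt_of_lt_csSup ⟨c0, hc0, hf0⟩ h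
  have hpos : 0 < sSup S := hc0.trans_le (le_csSup hSb ⟨hc0, hf0⟩)
  refine ⟨sSup S, hpos, fun {V gV hV} GV => ⟨fun c'' h0 hlt ε hε => ?_, ?_⟩⟩
  · obtain ⟨c, hc, hcc⟩ := hlt_ex c'' hlt
    exact core E GU GV hc.1 hc.2 hcc h0 hε
  · refine tendsto_order.2 ⟨fun a ha => ?_, fun a ha => ?_⟩
    · obtain ⟨b, hb1, hb2⟩ := exists_between (max_lt ha hpos)
      obtain ⟨c, hc, hcc⟩ := hlt_ex b hb2
      have hb0 : 0 ≤ b := ((le_max_right _ _).trans_lt hb1).le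
      filter_upwards [core_front E GU GV hc.1 hc.2 hcc hb0, eventually_gt_atTop 0] with t h1 h2
      exact ((le_max_left _ _).trans_lt hb1).trans_le ((le_div_iff₀ h2).2 h1)
    · by_contra hcon
      have hfr : ∃ᶠ t in atTop, a * t ≤ hV t := by
        replace hcon := Filter.not_eventually.1 hcon
        refine (hcon.and_eventually (eventually_gt_atTop 0)).mono fun t ht => ?_
        exact (le_div_iff₀ ht.2).1 (not_lt.1 ht.1)
      obtain ⟨b, hb1, hb2⟩ := exists_between ha
      have hb0 : 0 < b := hpos.trans hb1
      have := core_front E GV GU (hb0.trans hb2) hfr hb2 hb0.le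
      exact absurd (le_csSup hSb ⟨hb0, this.frequently⟩) (not_le.2 hb1)

end


/-- Preliminary regularised information on a spreading solution. -/
structure Pre (d μ : ℝ) (f : ℝ → ℝ → ℝ → ℝ) (p : ℝ → ℝ → ℝ) (u : ℝ → ℝ → ℝ)
    (g h : ℝ → ℝ) : Prop where
  cont : ContinuousOn (fun q : ℝ × ℝ => u q.1 q.2) {q : ℝ × ℝ | 0 ≤ q.1}
  gc : ContinuousOn g (Ici 0)
  hc : ContinuousOn h (Ici 0)
  dh : ∀ t > 0, ∃ v, HasDerivAt h v t ∧ (0 < v → ∃ a > 0, v = μ * a ∧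
    HasDerivWithinAt (u t) (-a) (Iic (h t)) (h t))
  dg : ∀ t > 0, ∃ v, HasDerivAt g (-v) t ∧ (0 < v → ∃ a > 0, v = μ * a ∧
    HasDerivWithinAt (u t) a (Ici (g t)) (g t))
  ch : ContinuousOn (deriv h) (Ioi 0)
  cg : ContinuousOn (deriv g) (Ioi 0)
  zero : ∀ t ≥ 0, ∀ x, x ≤ g t ∨ h t ≤ x → u t x = 0
  pde : SolvesPDE d f u {q : ℝ × ℝ | 0 < q.1 ∧ g q.1 < q.2 ∧ q.2 < h q.1}
  lep : ∀ t ≥ 0, ∀ x, u t x ≤ p t x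
  init : ∀ x1 x2, 0 < u 0 x1 → 0 < u 0 x2 → ∀ x ∈ Icc x1 x2, 0 < u 0 x
  h_top : Tendsto h atTop atTop
  g_bot : Tendsto g atTop atBot
  conv : ∀ A > (0:ℝ), ∀ ε > 0, ∃ T, ∀ t ≥ T, ∀ x ∈ Icc (-A) A, |u t x - p t x| ≤ ε

section
variable {d μ ω L K R : ℝ} {f : ℝ → ℝ → ℝ → ℝ} {p : ℝ → ℝ → ℝ}
  {u : ℝ → ℝ → ℝ} {g h : ℝ → ℝ}

theorem Pre.refl (G : Pre d μ f p u g h) :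
    Pre d μ (reflF f) (reflU p) (reflU u) (fun t => - h t) (fun t => - g t) where
  cont := G.cont.comp (by fun_prop : ContinuousOn (fun q : ℝ × ℝ => (q.1, -q.2)) _) fun q hq => hq
  gc := G.hc.fun_neg
  hc := G.gc.fun_neg
  dh t ht := by
    obtain ⟨v, h1, h2⟩ := G.dg t ht
    refine ⟨v, h1.fun_neg.congr_deriv (by ring), fun hv => ?_⟩
    obtain ⟨a, ha, hva, h2⟩ := h2 hv
    refine ⟨a, ha, hva, ?_⟩
    have h3 : HasDerivWithinAt (fun y : ℝ => -y) (-1) (Iic (- g t)) (- g t) :=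
      (hasDerivAt_neg' (- g t)).hasDerivWithinAt
    have h2' : HasDerivWithinAt (u t) a (Ici (g t)) (- - g t) := by rwa [neg_neg]
    have := h2'.comp (- g t) h3 (fun y hy => by
      simp only [mem_Iic, mem_Ici] at hy ⊢; linarith)
    exact this.congr_deriv (by ring)
  dg t ht := by
    obtain ⟨v, h1, h2⟩ := G.dh t ht
    refine ⟨v, h1.fun_neg, fun hv => ?_⟩
    obtain ⟨a, ha, hva, h2⟩ := h2 hv
    refine ⟨a, ha, hva, ?_⟩
    have h3 : HasDerivWithinAt (fun y : ℝ => -y) (-1) (Ici (- h t)) (- h t) :=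
      (hasDerivAt_neg' (- h t)).hasDerivWithinAt
    have h2' : HasDerivWithinAt (u t) (-a) (Iic (h t)) (- - h t) := by rwa [neg_neg]
    have := h2'.comp (- h t) h3 (fun y hy => by
      simp only [mem_Iic, mem_Ici] at hy ⊢; linarith)
    exact this.congr_deriv (by ring)
  ch := by simpa using G.cg.fun_neg
  cg := by simpa using G.ch.fun_neg
  zero t ht x hx := G.zero t ht _ (by
    rcases hx with h | h
    · right; linarith
    · left; linarith)
  pde := G.pde.refl.mono fun q hq => ⟨hq.1, by
    have h1 := hq.2.1
    have h2 := hq.2.2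
    constructor <;> simp only <;> linarith⟩
  lep t ht x := G.lep t ht _
  init x1 x2 h1 h2 x hx := G.init (-x2) (-x1) h2 h1 (-x) ⟨by linarith [hx.2], by linarith [hx.1]⟩
  h_top := tendsto_neg_atBot_atTop.comp G.g_bot
  g_bot := tendsto_neg_atTop_atBot.comp G.h_top
  conv A hA ε hε := by
    obtain ⟨T, hT⟩ := G.conv A hA ε hε
    refine ⟨T, fun t ht x hx => hT t ht _ ⟨by linarith [hx.2], by linarith [hx.1]⟩⟩

theorem Pre.c2At (G : Pre d μ f p u g h) {t x : ℝ} (ht : 0 < t) (h1 : g t < x) (h2 : x < h t) :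
    ∃ a b, C2At (u t) x a ∧ HasDerivAt (fun τ => u τ x) b t ∧ b = d * a + f t x (u t x) :=
  G.pde.c2At (by
    filter_upwards [Ioo_mem_nhds h1 h2] with y hy using ⟨ht, hy.1, hy.2⟩)

theorem Pre.inside (G : Pre d μ f p u g h) {t x : ℝ} (ht : 0 ≤ t) (hx : 0 < u t x) :
    g t < x ∧ x < h t := by
  by_contra hc
  have := G.zero t ht x (by
    by_contra h2; push Not at h2; exact hc h2)
  linarith

theorem first_touch {s τ : ℝ} {α β : ℝ → ℝ} (hα : ContinuousOn α (Icc s τ))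
    (hβ : ContinuousOn β (Icc s τ)) {w : ℝ → ℝ → ℝ}
    (hw : ContinuousOn (fun q : ℝ × ℝ => w q.1 q.2) (Reg s τ α β))
    (h0 : ∀ x ∈ Icc (α s) (β s), 0 < w s x)
    (hl : ∀ t ∈ Icc s τ, α t ≤ β t → 0 < w t (α t))
    (hr : ∀ t ∈ Icc s τ, α t ≤ β t → 0 < w t (β t))
    (hi : ∀ t x, s < t → t ≤ τ → α t < x → x < β t → w t x = 0 →
      ∃ b a, HasDerivAt (fun τ => w τ x) b t ∧ C2At (w t) x a ∧ (0 ≤ a → b ≤ 0 → False)) :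
    ∀ t ∈ Icc s τ, ∀ x ∈ Icc (α t) (β t), 0 < w t x := by
  intro t₀ ht₀ x₀ hx₀
  by_contra hneg
  push Not at hneg
  have hR := Reg.isCompact hα hβ
  have hC : IsCompact (Reg s τ α β ∩ (fun q : ℝ × ℝ => w q.1 q.2) ⁻¹' Iic 0) :=
    hR.of_isClosed_subset (hw.preimage_isClosed_of_isClosed hR.isClosed isClosed_Iic)
      inter_subset_left
  obtain ⟨⟨t, x⟩, ⟨⟨ht, hx⟩, hle⟩, hmin⟩ := hC.exists_isMinOn ⟨(t₀, x₀), ⟨ht₀, hx₀⟩, hneg⟩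
    (continuous_fst.continuousOn)
  simp only [mem_preimage, mem_Iic] at hle ht hx
  have hmin' : ∀ t' x', t' ∈ Icc s τ → x' ∈ Icc (α t') (β t') → t' < t → 0 < w t' x' := by
    intro t' x' h1 h2 h3
    by_contra h4
    push Not at h4
    have : t ≤ t' := hmin (show (t', x') ∈ _ from ⟨⟨h1, h2⟩, h4⟩)
    linarith
  have a1 : s < t := by
    rcases ht.1.eq_or_lt with h | h
    · subst h; exact absurd (h0 x hx) (not_lt.2 hle)
    · exact h
  have hab := hx.1.trans hx.2
  have a2 : α t < x := by
    rcases hx.1.eq_or_lt with h | h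
    · rw [← h] at hle; exact absurd (hl t ht hab) (not_lt.2 hle)
    · exact h
  have a3 : x < β t := by
    rcases hx.2.eq_or_lt with h | h
    · rw [h] at hle; exact absurd (hr t ht hab) (not_lt.2 hle)
    · exact h
  obtain ⟨r, hr, hsr, hb⟩ := Reg.backward hα hβ a1 ht.2 a2 a3
  have hreg : ∀ t' x', t - r < t' → t' ≤ t → |x' - x| < r → t' ∈ Icc s τ ∧ x' ∈ Icc (α t') (β t') :=
    fun t' x' b1 b2 b3 => ⟨⟨by linarith, b2.trans ht.2⟩, (hb t' x' b1 b2 b3).1.le,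
      (hb t' x' b1 b2 b3).2.le⟩
  have hge : ∀ x', |x' - x| < r → 0 ≤ w t x' := by
    intro x' hx'
    have hcw : ContinuousWithinAt (fun q : ℝ × ℝ => w q.1 q.2) (Reg s τ α β) (t, x') :=
      hw _ (hreg t x' (by linarith) le_rfl hx')
    have h2 : Tendsto (fun t' : ℝ => ((t', x') : ℝ × ℝ)) (𝓝[<] t) (𝓝[Reg s τ α β] (t, x')) := by
      refine tendsto_nhdsWithin_iff.2 ⟨?_, ?_⟩
      · exact ((by fun_prop : Continuous fun t' : ℝ => ((t', x') : ℝ × ℝ)).tendsto t).mono_left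
          nhdsWithin_le_nhds
      · filter_upwards [Ioo_mem_nhdsLT (show t - r < t by linarith)] with t' ht'
        exact hreg t' x' ht'.1 ht'.2.le hx'
    refine ge_of_tendsto (hcw.tendsto.comp h2) ?_
    filter_upwards [Ioo_mem_nhdsLT (show t - r < t by linarith)] with t' ht'
    have := hreg t' x' ht'.1 ht'.2.le hx'
    exact (hmin' t' x' this.1 this.2 ht'.2).le
  have hz : w t x = 0 := le_antisymm hle (hge x (by simpa using hr))
  obtain ⟨b, a, hb1, ha1, hfin⟩ := hi t x a1 ht.2 a2 a3 hz
  refine hfin ?_ ?_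
  · apply ha1.nonneg_of_min
    filter_upwards [Metric.ball_mem_nhds x hr] with y hy
    rw [hz]; exact hge y (by simpa [Real.dist_eq] using hy)
  · refine left_deriv_nonpos hb1 ?_
    filter_upwards [Ioo_mem_nhdsLT (show t - r < t by linarith)] with s' hs'
    have := hreg s' x hs'.1 hs'.2.le (by simpa using hr)
    rw [hz]; exact (hmin' s' x this.1 this.2 hs'.2).le

/-- From any positivity point there is a continuous path back to time zero inside the positivity
set. -/
theorem Pre.path (E : Env d μ ω L K R f p) (G : Pre d μ f p u g h) {s x1 : ℝ} (hs : 0 ≤ s)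
    (hx1 : 0 < u s x1) :
    ∃ y : ℝ → ℝ, ContinuousOn y (Icc 0 s) ∧ y s = x1 ∧ ∀ τ ∈ Icc 0 s, 0 < u τ (y τ) := by
  by_contra hno
  let S : Set (ℝ × ℝ) := {q | 0 ≤ q.1 ∧ q.1 ≤ s ∧ ∃ y : ℝ → ℝ, ContinuousOn y (Icc q.1 s) ∧
    y s = x1 ∧ y q.1 = q.2 ∧ ∀ τ ∈ Icc q.1 s, 0 < u τ (y τ)}
  have hS0 : ∀ x, (0, x) ∉ S := by
    rintro x ⟨-, -, y, h1, h2, -, h3⟩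
    exact hno ⟨y, h1, h2, h3⟩
  have hsub : S ⊆ Reg 0 s g h := by
    rintro ⟨t, x⟩ ⟨h0, h1, y, -, -, h3, h4⟩
    have := G.inside h0 (by simpa [h3] using h4 t ⟨le_rfl, h1⟩)
    exact ⟨⟨h0, h1⟩, this.1.le, this.2.le⟩
  have hIcc : Icc 0 s ⊆ Ici (0:ℝ) := fun t ht => ht.1
  have hcomp := Reg.isCompact (G.gc.mono hIcc) (G.hc.mono hIcc)
  have hDsub : closure S ⊆ Reg 0 s g h := hcomp.isClosed.closure_subset_iff.2 hsub
  have hD : IsCompact (closure S) := hcomp.of_isClosed_subset isClosed_closure hDsub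
  have hsS : (s, x1) ∈ S := by
    refine ⟨hs, le_rfl, fun _ => x1, continuousOn_const, rfl, rfl, fun τ hτ => ?_⟩
    have : τ = s := le_antisymm hτ.2 hτ.1
    rw [this]; exact hx1
  have key := max_principle hD (w := fun t x => - u t x)
    ((G.cont.mono fun q hq => (hDsub hq).1.1).neg) (K := K) E.hd (by
    intro t x hmem hneg
    have hup : 0 < u t x := by linarith
    have ht := (hDsub hmem).1
    dsimp only at ht
    -- positivity ball
    have hcw : ContinuousWithinAt (fun q : ℝ × ℝ => u q.1 q.2) {q : ℝ × ℝ | 0 ≤ q.1} (t, x) :=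
      G.cont (t, x) ht.1
    have hev := hcw.tendsto.eventually (lt_mem_nhds hup)
    rw [Metric.nhdsWithin_basis_ball.eventually_iff] at hev
    obtain ⟨r, hr, hball⟩ := hev
    have hb : ∀ t' x', 0 ≤ t' → |t' - t| < r → |x' - x| < r → 0 < u t' x' := by
      intro t' x' h0 h1 h2
      have hm : ((t', x') : ℝ × ℝ) ∈ Metric.ball (t, x) r := by
        rw [Metric.mem_ball, Prod.dist_eq, Real.dist_eq, Real.dist_eq]
        exact max_lt h1 h2
      exact hball ⟨hm, h0⟩
    have hlin : ∀ t0 x0 t' x', (t0, x0) ∈ S → |t0 - t| < r → |x0 - x| < r → 0 ≤ t' → t' < t0 →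
        |t' - t| < r → |x' - x| < r → (t', x') ∈ S := by
      rintro t0 x0 t' x' ⟨c0, c1, y, c2, c3, c4, c5⟩ d1 d2 d3 d4 d5 d6
      dsimp only at c0 c1 c2 c3 c4 c5
      have hpos : 0 < t0 - t' := by linarith
      refine ⟨d3, by dsimp only; linarith, fun τ => if τ ≤ t0 then x' + (τ - t') / (t0 - t') * (x0 - x') else y τ,
        ?_, ?_, ?_, ?_⟩
      · refine ContinuousOn.if ?_ ?_ ?_
        · rintro a ⟨ha, ha2⟩
          have : a = t0 := by
            have h5 : frontier {a : ℝ | a ≤ t0} = {t0} := frontier_Iic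
            rw [h5] at ha2; exact ha2
          rw [this, c4, div_self hpos.ne']; ring
        · exact (by fun_prop : Continuous fun τ => x' + (τ - t') / (t0 - t') * (x0 - x')).continuousOn
        · refine c2.mono ?_
          rintro a ⟨ha, ha2⟩
          have h5 : closure {a : ℝ | ¬ a ≤ t0} = Ici t0 := by
            have : {a : ℝ | ¬ a ≤ t0} = Ioi t0 := by ext; simp
            rw [this]; exact closure_Ioi t0
          rw [h5] at ha2
          exact ⟨ha2, ha.2⟩
      · dsimp only
        split_ifs with h5
        · have h6 : s = t0 := le_antisymm h5 c1
          rw [← h6] at c4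
          rw [h6, div_self hpos.ne', ← c3, c4]; ring
        · exact c3
      · dsimp only
        rw [if_pos d4.le]; simp
      · intro τ hτ
        dsimp only at hτ ⊢
        split_ifs with h5
        · set θ := (τ - t') / (t0 - t') with hθ
          have hθ0 : 0 ≤ θ := div_nonneg (by linarith [hτ.1]) hpos.le
          have hθ1 : θ ≤ 1 := (div_le_one hpos).2 (by linarith)
          rw [abs_lt] at d1 d2 d5 d6
          refine hb τ _ (by linarith [hτ.1]) ?_ ?_
          · rw [abs_lt]; constructor <;> linarith [hτ.1]
          · have := (convex_Ioo (x - r) (x + r)) (x := x') (y := x0)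
              ⟨by linarith, by linarith⟩ ⟨by linarith, by linarith⟩
              (by linarith : 0 ≤ 1 - θ) hθ0 (by ring)
            simp only [smul_eq_mul] at this
            rw [abs_lt]; constructor <;> nlinarith [this.1, this.2]
        · push Not at h5
          exact c5 τ ⟨h5.le, hτ.2⟩
    have hnear : ∀ r' > 0, ∃ t0 x0, (t0, x0) ∈ S ∧ |t0 - t| < r' ∧ |x0 - x| < r' := by
      intro r' hr'
      obtain ⟨⟨t0, x0⟩, h1, h2⟩ := Metric.mem_closure_iff.1 hmem r' hr'
      rw [Prod.dist_eq, Real.dist_eq, Real.dist_eq, max_lt_iff] at h2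
      exact ⟨t0, x0, h1, by rw [abs_sub_comm]; exact h2.1, by rw [abs_sub_comm]; exact h2.2⟩
    have htpos : 0 < t := by
      rcases ht.1.eq_or_lt with h0 | h0
      · exfalso
        obtain ⟨t0, x0, e1, e2, e3⟩ := hnear r hr
        rcases e1.1.eq_or_lt with h1 | h1
        · dsimp only at h1; rw [← h1] at e1; exact hS0 _ e1
        · exact hS0 x (hlin t0 x0 0 x e1 e2 e3 le_rfl h1 (by simpa [← h0] using hr) (by simpa using hr))
      · exact h0
    have hback : ∀ t' x', 0 ≤ t' → t - r < t' → t' < t → |x' - x| < r → (t', x') ∈ S := by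
      intro t' x' e0 e1 e2 e3
      obtain ⟨t0, x0, f1, f2, f3⟩ := hnear (min r (t - t')) (lt_min hr (by linarith))
      have f2' := lt_min_iff.1 f2
      refine hlin t0 x0 t' x' f1 f2'.1 (f3.trans_le (min_le_left _ _)) e0 ?_ ?_ e3
      · have := (abs_lt.1 f2'.2).1; linarith
      · rw [abs_lt]; constructor <;> linarith
    refine ⟨min r t, lt_min hr htpos, fun t' x' e1 e2 e3 => ?_, ?_⟩
    · have e1' : t - r < t' := by linarith [min_le_left r t]
      have e1'' : 0 < t' := by linarith [min_le_right r t]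
      have e3' := e3.trans_le (min_le_left r t)
      rcases e2.eq_or_lt with h5 | h5
      · subst h5
        have h2 : Tendsto (fun a : ℝ => ((a, x') : ℝ × ℝ)) (𝓝[<] t') (𝓝 (t', x')) :=
          ((by fun_prop : Continuous fun a : ℝ => ((a, x') : ℝ × ℝ)).tendsto t').mono_left
            nhdsWithin_le_nhds
        refine mem_closure_of_tendsto h2 ?_
        filter_upwards [Ioo_mem_nhdsLT (show t' - r < t' by linarith),
          Ioo_mem_nhdsLT e1''] with a h6 h7
        exact hback a x' h7.1.le h6.1 h6.2 e3'
      · exact subset_closure (hback t' x' e1''.le e1' h5 e3')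
    · obtain ⟨i1, i2⟩ := G.inside ht.1 hup
      obtain ⟨a, b, ha, hb, hab⟩ := G.c2At htpos i1 i2
      refine ⟨-b, -a, hb.fun_neg, ha.neg, ?_⟩
      have := (abs_le.1 (E.f_le (t := t) (x := x) hup.le ((G.lep t ht.1 x).trans (E.p_le t x)))).2
      rw [hab]; linarith)
  have := key s x1 (subset_closure hsS)
  linarith

theorem Pre.ordConn (E : Env d μ ω L K R f p) (G : Pre d μ f p u g h) {s x1 x2 : ℝ} (hs : 0 ≤ s)
    (h1 : 0 < u s x1) (h2 : 0 < u s x2) : ∀ x ∈ Icc x1 x2, 0 < u s x := by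
  obtain ⟨y1, c1, e1, p1⟩ := G.path E hs h1
  obtain ⟨y2, c2, e2, p2⟩ := G.path E hs h2
  have hIcc : Icc 0 s ⊆ Ici (0:ℝ) := fun t ht => ht.1
  have hmono : ∀ {A : Set (ℝ × ℝ)}, (∀ q ∈ A, 0 ≤ q.1) →
    ContinuousOn (fun q : ℝ × ℝ => u q.1 q.2) A := fun hA => G.cont.mono hA
  -- uniform positivity on compacts
  have hcurve : ∀ y : ℝ → ℝ, ContinuousOn y (Icc 0 s) → (∀ τ ∈ Icc 0 s, 0 < u τ (y τ)) →
      ∃ η > 0, ∀ τ ∈ Icc 0 s, η < u τ (y τ) := by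
    intro y hy hp
    have hcy : ContinuousOn (fun τ => u τ (y τ)) (Icc 0 s) :=
      G.cont.comp (continuousOn_id.prodMk hy) fun τ hτ => hτ.1
    obtain ⟨τ, hτ, hm⟩ := isCompact_Icc.exists_isMinOn ⟨0, le_rfl, hs⟩ hcy
    refine ⟨u τ (y τ) / 2, half_pos (hp τ hτ), fun t ht => ?_⟩
    have := hm ht
    dsimp only at this
    have := hp τ hτ
    simp only [mem_ofPred_eq] at *
    linarith
  obtain ⟨η1, hη1, q1⟩ := hcurve y1 c1 p1
  obtain ⟨η2, hη2, q2⟩ := hcurve y2 c2 p2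
  have hbot : ∃ η > 0, ∀ x ∈ Icc (y1 0) (y2 0), η < u 0 x := by
    have hc0 : ContinuousOn (fun x => u 0 x) (Icc (y1 0) (y2 0)) :=
      G.cont.comp (by fun_prop : ContinuousOn (fun x : ℝ => ((0:ℝ), x)) _) fun x _ => (le_rfl : (0:ℝ) ≤ 0)
    by_cases hne : (Icc (y1 0) (y2 0)).Nonempty
    · obtain ⟨x, hx, hm⟩ := isCompact_Icc.exists_isMinOn hne hc0
      have hp := G.init _ _ (p1 0 ⟨le_rfl, hs⟩) (p2 0 ⟨le_rfl, hs⟩) x hx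
      refine ⟨u 0 x / 2, half_pos hp, fun t ht => ?_⟩
      have : u 0 x ≤ u 0 t := hm ht
      linarith
    · exact ⟨1, one_pos, fun x hx => absurd ⟨x, hx⟩ hne⟩
  obtain ⟨η0, hη0, q0⟩ := hbot
  set η := min η0 (min η1 η2) with hη
  have hηp : 0 < η := lt_min hη0 (lt_min hη1 hη2)
  have l0 : η ≤ η0 := min_le_left _ _
  have l1 : η ≤ η1 := (min_le_right _ _).trans (min_le_left _ _)
  have l2 : η ≤ η2 := (min_le_right _ _).trans (min_le_right _ _)
  have hexp : ∀ t, 0 ≤ t → η * Real.exp (-(K + 1) * t) ≤ η := fun t ht =>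
    mul_le_of_le_one_right hηp.le (Real.exp_le_one_iff.2 (by have := E.hK; nlinarith))
  have key := first_touch c1 c2 (w := fun t x => u t x - η * Real.exp (-(K + 1) * t))
    ((hmono fun q hq => hq.1.1).sub (by fun_prop))
    (fun x hx => by have := q0 x hx; have := hexp 0 le_rfl; linarith)
    (fun t ht _ => by have := q1 t ht; have := hexp t ht.1; linarith)
    (fun t ht _ => by have := q2 t ht; have := hexp t ht.1; linarith)
    (fun t x ht1 ht2 hx1 hx2 hw => by
      have hpos : 0 < η * Real.exp (-(K + 1) * t) := by positivity
      have hup : 0 < u t x := by linarith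
      obtain ⟨i1, i2⟩ := G.inside ht1.le hup
      obtain ⟨a, b, ha, hb, hab⟩ := G.c2At ht1 i1 i2
      have hE : HasDerivAt (fun τ : ℝ => η * Real.exp (-(K + 1) * τ))
          (η * (Real.exp (-(K + 1) * t) * (-(K + 1)))) t := by
        have h1 : HasDerivAt (fun τ : ℝ => -(K + 1) * τ) (-(K + 1)) t := by
          simpa using (hasDerivAt_id t).const_mul (-(K + 1))
        exact h1.exp.const_mul η
      have hcc : C2At (fun y : ℝ => η * Real.exp (-(K + 1) * t)) x 0 :=
        C2At.of_hasDerivAt (φ' := fun _ => 0) (fun y => hasDerivAt_const y _)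
          (hasDerivAt_const x _)
      refine ⟨_, _, hb.sub hE, ha.sub hcc, fun h5 h6 => ?_⟩
      have := (abs_le.1 (E.f_le (t := t) (x := x) hup.le
        ((G.lep t ht1.le x).trans (E.p_le t x)))).1
      have h7 : 0 ≤ d * a := mul_nonneg E.hd.le (by linarith)
      have h8 : u t x = η * Real.exp (-(K + 1) * t) := by linarith
      rw [hab] at h6
      have h9 : η * (Real.exp (-(K + 1) * t) * (-(K + 1))) = -(K + 1) * u t x := by rw [h8]; ring
      rw [h9] at h6
      linarith)
  intro x hx
  have := key s ⟨hs, le_rfl⟩ x (by rw [e1, e2]; exact hx)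
  have hpos : 0 < η * Real.exp (-(K + 1) * s) := by positivity
  linarith
end


section
variable {d μ ω L K R : ℝ} {f : ℝ → ℝ → ℝ → ℝ} {p : ℝ → ℝ → ℝ}
  {u : ℝ → ℝ → ℝ} {g h : ℝ → ℝ}

theorem linear_lower {φ : ℝ → ℝ} {a l : ℝ} (ha : 0 < a) (hl : 0 < l)
    (hd : HasDerivWithinAt φ (-a) (Iic l) l) (h0 : φ l = 0) (hc : ContinuousOn φ (Icc 0 l))
    (hp : ∀ x ∈ Ico 0 l, 0 < φ x) : ∃ c > 0, ∀ y ∈ Icc 0 l, c * y ≤ φ (l - y) := by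
  have h1 : HasDerivWithinAt φ (-a) (Iio l) l := hd.mono Iio_subset_Iic_self
  rw [hasDerivWithinAt_iff_tendsto_slope' (by simp)] at h1
  have h2 := h1.eventually (gt_mem_nhds (show -a < -(a / 2) by linarith))
  obtain ⟨x0, hx0, h3⟩ := (mem_nhdsLT_iff_exists_Ioo_subset.1 h2)
  have hx0' : x0 < l := hx0
  set x1 := (max x0 0 + l) / 2 with hx1
  have hm : max x0 0 < l := max_lt hx0' hl
  have hx1l : x1 < l := by rw [hx1]; linarith
  have hx10 : 0 < x1 := by rw [hx1]; linarith [le_max_right x0 0]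
  have hx1x : x0 < x1 := by rw [hx1]; linarith [le_max_left x0 0]
  obtain ⟨x2, hx2, hmin⟩ := isCompact_Icc.exists_isMinOn ⟨0, le_rfl, hx10.le⟩
    (hc.mono (Icc_subset_Icc_right hx1l.le))
  have hm2 : 0 < φ x2 := hp x2 ⟨hx2.1, hx2.2.trans_lt hx1l⟩
  refine ⟨min (a / 2) (φ x2 / l), lt_min (half_pos ha) (div_pos hm2 hl), fun y hy => ?_⟩
  rcases le_or_gt (l - y) x1 with h5 | h5
  · have h6 : φ x2 ≤ φ (l - y) := hmin ⟨by linarith [hy.2], h5⟩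
    calc min (a / 2) (φ x2 / l) * y ≤ φ x2 / l * l :=
          mul_le_mul (min_le_right _ _) hy.2 hy.1 (div_pos hm2 hl).le
      _ = φ x2 := by field_simp
      _ ≤ _ := h6
  · rcases hy.1.eq_or_lt with h6 | h6
    · rw [← h6]; simp [h0]
    · have h7 := h3 (show l - y ∈ Ioo x0 l from ⟨by linarith, by linarith⟩)
      simp only [mem_ofPred_eq, slope_def_field, h0] at h7
      rw [div_lt_iff_of_neg (by linarith)] at h7
      have : min (a / 2) (φ x2 / l) * y ≤ a / 2 * y :=
        mul_le_mul_of_nonneg_right (min_le_left _ _) h6.le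
      nlinarith

theorem Pre.pos_right (E : Env d μ ω L K R f p) (G : Pre d μ f p u g h) {t : ℝ} (ht : 0 < t)
    (h0 : 0 < u t 0) (hdh : 0 < deriv h t) : 0 < h t ∧ ∀ x ∈ Ico 0 (h t), 0 < u t x := by
  have hht := (G.inside ht.le h0).2
  refine ⟨hht, fun x hx => ?_⟩
  obtain ⟨v, h1, h2⟩ := G.dh t ht
  rw [h1.deriv] at hdh
  obtain ⟨a, ha, hva, h3⟩ := h2 hdh
  have hz := G.zero t ht.le (h t) (Or.inr le_rfl)
  have h1 : HasDerivWithinAt (u t) (-a) (Iio (h t)) (h t) := h3.mono Iio_subset_Iic_self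
  rw [hasDerivWithinAt_iff_tendsto_slope' (by simp)] at h1
  have h2 := h1.eventually (gt_mem_nhds (show -a < 0 by linarith))
  obtain ⟨y, hy1, hy2⟩ := (h2.and (Ioo_mem_nhdsLT hx.2)).exists
  rw [slope_def_field, hz, div_neg_iff] at hy1
  have hy3 : 0 < u t y := by
    rcases hy1 with h | h
    · linarith [h.1]
    · linarith [h.2, hy2.2]
  exact G.ordConn E ht.le h0 hy3 x ⟨hx.1, hy2.1.le⟩

theorem Pre.conv_pos (E : Env d μ ω L K R f p) (G : Pre d μ f p u g h) :
    ∃ T > 0, ∀ t ≥ T, 0 < u t 0 := by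
  obtain ⟨ε, hε, hp⟩ := E.p_min
  obtain ⟨T, hT⟩ := G.conv 1 one_pos (ε / 2) (half_pos hε)
  refine ⟨max T 1, by positivity, fun t ht => ?_⟩
  have := (abs_le.1 (hT t ((le_max_left _ _).trans ht) 0 ⟨by norm_num, by norm_num⟩)).1
  have := hp t 0
  linarith

theorem Pre.right (E : Env d μ ω L K R f p) (G : Pre d μ f p u g h) :
    ∃ T > 0, ∀ t ≥ T, 0 < u t 0 ∧ 0 < deriv h t := by
  obtain ⟨T0, hT0, hu0⟩ := G.conv_pos E
  have hdiff : ∀ t > 0, HasDerivAt h (deriv h t) t := fun t ht => by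
    obtain ⟨v, h1, -⟩ := G.dh t ht
    exact h1.differentiableAt.hasDerivAt
  obtain ⟨s, hs, hds⟩ : ∃ s ≥ T0, 0 < deriv h s := by
    by_contra hno
    push Not at hno
    have hanti : AntitoneOn h (Ici T0) := by
      refine antitoneOn_of_deriv_nonpos (convex_Ici T0) (G.hc.mono fun t ht => ?_) ?_ ?_
      · exact hT0.le.trans ht
      · intro t ht
        rw [interior_Ici] at ht
        exact (hdiff t (hT0.trans ht)).differentiableAt.differentiableWithinAt
      · intro t ht
        rw [interior_Ici] at ht
        exact hno t (le_of_lt ht)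
    obtain ⟨t, h1, h2⟩ := ((G.h_top.eventually_gt_atTop (h T0)).and
      (eventually_ge_atTop T0)).exists
    have := hanti self_mem_Ici h2 h2
    linarith
  have hs0 : 0 < s := hT0.trans_le hs
  refine ⟨s, hs0, fun t1 ht1 => ⟨hu0 t1 (hs.trans ht1), ?_⟩⟩
  by_contra hneg
  push Not at hneg
  have hchI : ContinuousOn (deriv h) (Icc s t1) := G.ch.mono fun t ht => hs0.trans_le ht.1
  obtain ⟨τ, hτ, hτ0, hτp⟩ := first_zero hchI hds ⟨t1, ⟨ht1, le_rfl⟩, hneg⟩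
  have hposd : ∀ t ∈ Ico s τ, 0 < t ∧ 0 < u t 0 ∧ 0 < deriv h t := fun t ht =>
    ⟨hs0.trans_le ht.1, hu0 t (hs.trans ht.1), hτp t ht⟩
  have hpos : ∀ t ∈ Ico s τ, 0 < h t ∧ ∀ x ∈ Ico 0 (h t), 0 < u t x := fun t ht =>
    G.pos_right E (hposd t ht).1 (hposd t ht).2.1 (hposd t ht).2.2
  obtain ⟨hhs, hus⟩ := hpos s ⟨le_rfl, hτ.1⟩
  have hmono : ∀ t ∈ Ico s τ, h s ≤ h t := by
    have : MonotoneOn h (Ico s τ) := by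
      refine monotoneOn_of_deriv_nonneg (convex_Ico s τ) (G.hc.mono fun t ht => ?_) ?_ ?_
      · exact hs0.le.trans ht.1
      · intro t ht
        rw [interior_Ico] at ht
        exact (hdiff t (hs0.trans ht.1)).differentiableAt.differentiableWithinAt
      · intro t ht
        rw [interior_Ico] at ht
        exact (hτp t ⟨ht.1.le, ht.2⟩).le
    intro t ht
    exact this ⟨le_rfl, hτ.1⟩ ht ht.1
  -- linear lower bound at time s
  obtain ⟨v, hv1, hv2⟩ := G.dh s hs0
  rw [hv1.deriv] at hds
  obtain ⟨a, ha, -, hv3⟩ := hv2 hds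
  obtain ⟨c, hc, hlow⟩ := linear_lower ha hhs hv3 (G.zero s hs0.le _ (Or.inr le_rfl))
    (G.cont.comp (by fun_prop : ContinuousOn (fun x : ℝ => (s, x)) _) fun x _ => hs0.le) hus
  obtain ⟨B, hB⟩ := isCompact_Icc.exists_bound_of_continuousOn hchI
  obtain ⟨κ, hκ, hopf1⟩ := hopf d K (max B 1) (h s / 2) (τ - s) E.hd (by positivity)
    (by positivity) (by linarith [hτ.1])
  have h2r : 2 * (h s / 2) = h s := by ring
  rw [h2r] at hopf1
  have hlb : ∀ t ∈ Ico s τ, μ * (c * κ) ≤ deriv h t := by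
    intro t ht
    have hin : ∀ t' ∈ Icc s t, t' ∈ Ico s τ := fun t' ht' => ⟨ht'.1, ht'.2.trans_lt ht.2⟩
    have key := hopf1 s t c h (deriv h) u ht.1 (by linarith [ht.2]) hc.le
      (fun t' ht' => hdiff t' (hs0.trans_le ht'.1))
      (fun t' ht' => (hB t' ⟨ht'.1, (hin t' ht').2.le.trans hτ.2⟩).trans (le_max_left _ _))
      (G.cont.mono fun q hq => hs0.le.trans hq.1.1)
      (fun t' ht' => (G.zero t' (hs0.le.trans ht'.1) _ (Or.inr le_rfl)).ge)
      (fun t' ht' => ((hpos t' (hin t' ht')).2 _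
        ⟨by linarith [hmono t' (hin t' ht')], by linarith⟩).le)
      (fun t' x' a1 a2 a3 a4 => by
        have hin' := hin t' ⟨a1.le, a2⟩
        have hup := (hpos t' hin').2 x' ⟨by linarith [hmono t' hin'], a4⟩
        have ht0 : 0 < t' := hs0.trans a1
        obtain ⟨i1, i2⟩ := G.inside ht0.le hup
        obtain ⟨a, b, ha, hb, hab⟩ := G.c2At ht0 i1 i2
        refine ⟨b, a, hb, ha, ?_⟩
        have := (abs_le.1 (E.f_le (t := t') (x := x') hup.le
          ((G.lep t' ht0.le x').trans (E.p_le t' x')))).1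
        rw [hab]; linarith)
      hlow t ⟨ht.1, le_rfl⟩
    obtain ⟨v, hv1, hv2⟩ := G.dh t (hposd t ht).1
    have h3 := (hposd t ht).2.2
    rw [hv1.deriv] at h3 ⊢
    obtain ⟨a, ha, hva, hv3⟩ := hv2 h3
    have := slope_bound hv3 (G.zero t (hposd t ht).1.le _ (Or.inr le_rfl))
      (half_pos hhs) key
    rw [hva]
    exact mul_le_mul_of_nonneg_left this E.hμ.le
  have hlim : Tendsto (deriv h) (𝓝[<] τ) (𝓝 (deriv h τ)) :=
    ((G.ch.continuousAt (Ioi_mem_nhds (hs0.trans hτ.1))).tendsto).mono_left nhdsWithin_le_nhds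
  have h9 : μ * (c * κ) ≤ deriv h τ := by
    refine ge_of_tendsto hlim ?_
    filter_upwards [Ioo_mem_nhdsLT hτ.1] with t ht
    exact hlb t ⟨ht.1.le, ht.2⟩
  rw [hτ0] at h9
  have := mul_pos E.hμ (mul_pos hc hκ)
  linarith

theorem Pre.strict (E : Env d μ ω L K R f p) (G : Pre d μ f p u g h) :
    ∀ t > 0, ∀ x, u t x < p t x := by
  intro t0 ht0 x0
  by_cases hx0 : x0 ≤ g t0 ∨ h t0 ≤ x0
  · rw [G.zero t0 ht0.le x0 hx0]; exact E.p_pos _ _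
  push Not at hx0
  obtain ⟨m, hm, hpm⟩ := E.p_min
  have hI : Icc 0 t0 ⊆ Ici (0:ℝ) := fun t ht => ht.1
  obtain ⟨A1, hA1⟩ := isCompact_Icc.exists_bound_of_continuousOn (G.gc.mono hI)
  obtain ⟨A2, hA2⟩ := isCompact_Icc.exists_bound_of_continuousOn (G.hc.mono hI)
  set A := max (max A1 A2) 1 with hA
  have hA0 : 0 < A := by positivity
  have hxA : ∀ t ∈ Icc 0 t0, ∀ x ∈ Icc (g t) (h t), |x| ≤ A := by
    intro t ht x hx
    have b1 := (abs_le.1 (hA1 t ht)).1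
    have b2 := (abs_le.1 (hA2 t ht)).2
    have c1 : A1 ≤ A := (le_max_left _ _).trans (le_max_left _ _)
    have c2 : A2 ≤ A := (le_max_right _ _).trans (le_max_left _ _)
    rw [abs_le]; constructor <;> linarith [hx.1, hx.2]
  have hd := E.hd
  have hK := E.hK
  set l := 2 * A / (d * t0) with hl
  have hl0 : 0 < l := by positivity
  have hlt : d * l ^ 2 * t0 = 2 * (l * A) := by rw [hl]; field_simp
  set C := Real.cosh (l * A) with hC
  have hC0 : 0 < C := Real.cosh_pos _
  set Mx := C * Real.exp (d * l ^ 2 * t0) with hMx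
  have hMx0 : 0 < Mx := by positivity
  set η := m / (2 * Mx) with hη
  have hη0 : 0 < η := by positivity
  have hcosh : ∀ x, |x| ≤ A → Real.cosh (l * x) ≤ C := fun x hx => by
    rw [hC, Real.cosh_le_cosh, abs_mul, abs_mul, abs_of_pos hl0, abs_of_pos hA0]
    exact mul_le_mul_of_nonneg_left hx hl0.le
  set z : ℝ → ℝ → ℝ := fun t x => η * Real.exp (-K * t) *
    (Real.cosh (l * x) * Real.exp (d * l ^ 2 * t) - C) with hz
  have hzle : ∀ t ∈ Icc 0 t0, ∀ x, |x| ≤ A → z t x ≤ m / 2 := by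
    intro t ht x hx
    have e1 : Real.exp (-K * t) ≤ 1 := Real.exp_le_one_iff.2 (by nlinarith [ht.1])
    have e2 : Real.cosh (l * x) * Real.exp (d * l ^ 2 * t) ≤ Mx := by
      rw [hMx]
      refine mul_le_mul (hcosh x hx) (Real.exp_le_exp.2 ?_) (Real.exp_pos _).le hC0.le
      exact mul_le_mul_of_nonneg_left ht.2 (by positivity)
    have e3 : z t x ≤ η * Real.exp (-K * t) * Mx := by
      rw [hz]; exact mul_le_mul_of_nonneg_left (by linarith) (by positivity)
    have e4 : η * Real.exp (-K * t) * Mx ≤ η * 1 * Mx := by gcongr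
    have e5 : η * 1 * Mx = m / 2 := by rw [hη]; field_simp
    linarith
  have hzt : ∀ t x, HasDerivAt (fun τ => z τ x) (-K * z t x + η * Real.exp (-K * t) *
      (Real.cosh (l * x) * Real.exp (d * l ^ 2 * t) * (d * l ^ 2))) t := by
    intro t x
    have h1 : HasDerivAt (fun τ : ℝ => Real.exp (-K * τ)) (Real.exp (-K * t) * (-K)) t := by
      have : HasDerivAt (fun τ : ℝ => -K * τ) (-K) t := by
        simpa using (hasDerivAt_id t).const_mul (-K)
      exact this.exp
    have h2 : HasDerivAt (fun τ : ℝ => Real.exp (d * l ^ 2 * τ))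
        (Real.exp (d * l ^ 2 * t) * (d * l ^ 2)) t := by
      have : HasDerivAt (fun τ : ℝ => d * l ^ 2 * τ) (d * l ^ 2) t := by
        simpa using (hasDerivAt_id t).const_mul (d * l ^ 2)
      exact this.exp
    exact ((h1.const_mul η).fun_mul ((h2.const_mul (Real.cosh (l * x))).sub_const C)).congr_deriv
      (by rw [hz]; ring)
  have hzx : ∀ t x, C2At (z t) x (η * Real.exp (-K * t) *
      (Real.cosh (l * x) * l ^ 2 * Real.exp (d * l ^ 2 * t))) := by
    intro t x
    have hlin : ∀ y : ℝ, HasDerivAt (fun y : ℝ => l * y) l y := fun y => by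
      simpa using (hasDerivAt_id y).const_mul l
    refine C2At.of_hasDerivAt (φ' := fun y => η * Real.exp (-K * t) *
      (Real.sinh (l * y) * l * Real.exp (d * l ^ 2 * t))) (fun y => ?_) ?_
    · exact ((((hlin y).cosh).mul_const _).sub_const C).const_mul _
    · exact (((((hlin x).sinh).mul_const l).mul_const _).const_mul _).congr_deriv (by ring)
  have key := mp_curves (G.gc.mono hI) (G.hc.mono hI) (w := fun t x => p t x - u t x - z t x)
    ((E.p_cont.continuousOn.sub (G.cont.mono fun q hq => hq.1.1)).sub (by
      rw [hz]; fun_prop)) (K := K) hd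
    (fun x hx => by
      have h1 := G.lep 0 le_rfl x
      have h2 := hcosh x (hxA 0 ⟨le_rfl, ht0.le⟩ x hx)
      have h3 : z 0 x ≤ 0 := by
        rw [hz]; simp only [mul_zero, Real.exp_zero, mul_one]
        exact mul_nonpos_of_nonneg_of_nonpos hη0.le (by linarith)
      linarith)
    (fun t ht hgh => by
      have h1 := G.zero t ht.1 (g t) (Or.inl le_rfl)
      have h2 := hzle t ht (g t) (hxA t ht _ ⟨le_rfl, hgh⟩)
      have h3 := hpm t (g t)
      linarith)
    (fun t ht hgh => by
      have h1 := G.zero t ht.1 (h t) (Or.inr le_rfl)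
      have h2 := hzle t ht (h t) (hxA t ht _ ⟨hgh, le_rfl⟩)
      have h3 := hpm t (h t)
      linarith)
    (fun t x a1 a2 a3 a4 a5 => by
      have htI : t ∈ Icc 0 t0 := ⟨a1.le, a2⟩
      have h2 := hzle t htI x (hxA t htI _ ⟨a3.le, a4.le⟩)
      have h3 := hpm t x
      have hup : 0 < u t x := by linarith
      obtain ⟨a, b, ha, hb, hab⟩ := G.c2At a1 a3 a4
      obtain ⟨a', b', ha', hb', hab'⟩ := E.p_sol.c2At (t := t) (x := x)
        (Eventually.of_forall fun y => mem_univ _)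
      refine ⟨_, _, (hb'.fun_sub hb).fun_sub (hzt t x), (ha'.sub ha).sub (hzx t x), ?_⟩
      have hle := G.lep t a1.le x
      have l := E.lip t x (p t x) (u t x) (E.p_pos t x).le (E.p_le t x) hup.le
        (hle.trans (E.p_le t x))
      rw [abs_of_nonneg (by linarith : 0 ≤ p t x - u t x)] at l
      have := (abs_le.1 l).1
      rw [hab, hab']
      nlinarith [E.hK])
  have h1 := key t0 ⟨ht0.le, le_rfl⟩ x0 ⟨hx0.1.le, hx0.2.le⟩
  have h2 : 0 < z t0 x0 := by
    have e1 : 1 ≤ Real.cosh (l * x0) := Real.one_le_cosh _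
    have e2 : C < Real.exp (d * l ^ 2 * t0) := by
      rw [hC, Real.cosh_eq, hlt]
      have h3 : Real.exp (-(l * A)) ≤ Real.exp (l * A) :=
        Real.exp_le_exp.2 (by nlinarith [mul_pos hl0 hA0])
      have h4 : Real.exp (l * A) < Real.exp (2 * (l * A)) :=
        Real.exp_lt_exp.2 (by nlinarith [mul_pos hl0 hA0])
      linarith
    have e3 : C < Real.cosh (l * x0) * Real.exp (d * l ^ 2 * t0) := by
      nlinarith [Real.exp_pos (d * l ^ 2 * t0)]
    rw [hz]
    exact mul_pos (by positivity) (by linarith)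
  linarith

theorem Pre.good (E : Env d μ ω L K R f p) (G : Pre d μ f p u g h) :
    ∃ n : ℕ, Good d μ f p (fun t x => u (t + n * ω) x) (fun t => g (t + n * ω))
      (fun t => h (t + n * ω)) := by
  obtain ⟨T1, hT1, hr⟩ := G.right E
  obtain ⟨T2, hT2, hl⟩ := G.refl.right E.refl
  obtain ⟨n, hn⟩ := exists_nat_gt (max T1 T2 / ω)
  rw [div_lt_iff₀ E.hω] at hn
  have n1 : T1 < n * ω := (le_max_left _ _).trans_lt hn
  have n2 : T2 < n * ω := (le_max_right _ _).trans_lt hn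
  have hn0 : 0 < n * ω := hT1.trans n1
  have ht0 : ∀ t ≥ (0:ℝ), 0 < t + n * ω := fun t ht => by linarith
  have htt : Tendsto (fun t : ℝ => t + n * ω) atTop atTop :=
    tendsto_atTop_add_const_right _ _ tendsto_id
  have hr' : ∀ t ≥ (0:ℝ), 0 < h (t + n * ω) ∧ ∀ x ∈ Ico 0 (h (t + n * ω)), 0 < u (t + n * ω) x :=
    fun t ht => by
      have := hr (t + n * ω) (by linarith)
      exact G.pos_right E (ht0 t ht) this.1 this.2
  have hl' : ∀ t ≥ (0:ℝ), g (t + n * ω) < 0 ∧ ∀ x, g (t + n * ω) < x → x ≤ 0 → 0 < u (t + n * ω) x :=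
    fun t ht => by
      have := hl (t + n * ω) (by linarith)
      have := G.refl.pos_right E.refl (ht0 t ht) this.1 this.2
      refine ⟨by linarith [this.1], fun x h1 h2 => ?_⟩
      have h3 := this.2 (-x) ⟨by linarith, by linarith⟩
      simpa [reflU] using h3
  refine ⟨n, ?_⟩
  have hpos : ∀ t ≥ (0:ℝ), ∀ x, g (t + n * ω) < x → x < h (t + n * ω) → 0 < u (t + n * ω) x := by
    intro t ht x h1 h2
    rcases le_total x 0 with h3 | h3
    · exact (hl' t ht).2 x h1 h3
    · exact (hr' t ht).2 x ⟨h3, h2⟩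
  exact {
    cont := G.cont.comp (by fun_prop : ContinuousOn
      (fun q : ℝ × ℝ => (q.1 + n * ω, q.2)) _) fun q hq => (ht0 _ hq).le
    dh := fun t ht => by
      obtain ⟨v, h1, h2⟩ := G.dh _ (ht0 t ht)
      have h3 := (hr (t + n * ω) (by linarith)).2
      rw [h1.deriv] at h3
      obtain ⟨a, ha, hva, h4⟩ := h2 h3
      refine ⟨a, ha, ?_, h4⟩
      rw [← hva]; exact h1.comp_add_const t (n * ω)
    dg := fun t ht => by
      obtain ⟨v, h1, h2⟩ := G.dg _ (ht0 t ht)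
      have h3 := (hl (t + n * ω) (by linarith)).2
      rw [deriv.fun_neg, h1.deriv, neg_neg] at h3
      obtain ⟨a, ha, hva, h4⟩ := h2 h3
      refine ⟨a, ha, ?_, h4⟩
      rw [← hva]; exact h1.comp_add_const t (n * ω)
    ch := by
      have e : deriv (fun t => h (t + n * ω)) = fun t => deriv h (t + n * ω) := by
        funext t; rw [deriv_comp_add_const]
      rw [e]
      exact G.ch.comp (by fun_prop) fun t ht => ht0 t ht
    cg := by
      have e : deriv (fun t => g (t + n * ω)) = fun t => deriv g (t + n * ω) := by
        funext t; rw [deriv_comp_add_const]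
      rw [e]
      exact G.cg.comp (by fun_prop) fun t ht => ht0 t ht
    gh := fun t ht => by linarith [(hr' t ht).1, (hl' t ht).1]
    pos := hpos
    zero := fun t ht x hx => G.zero _ (ht0 t ht).le _ hx
    pde := by
      have h1 := (G.pde.shift (n * ω) 0)
      simp only [add_zero] at h1
      refine (h1.mono fun q hq => ?_).congr_f fun q hq => ?_
      · exact ⟨by have := ht0 q.1 hq.1.le; exact this, hq.2.1, hq.2.2⟩
      · have := hpos q.1 hq.1.le q.2 hq.2.1 hq.2.2
        rw [E.per_t_nat _ _ _ _ this.le]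
    ltp := fun t ht x => by
      have := G.strict E _ (ht0 t ht) x
      rwa [E.p_per_t_nat] at this
    h_top := G.h_top.comp htt
    g_bot := G.g_bot.comp htt
    conv := fun A hA ε hε => by
      obtain ⟨T, hT⟩ := G.conv A hA ε hε
      refine ⟨T, fun t ht x hx => ?_⟩
      have := hT (t + n * ω) (by linarith) x hx
      rwa [E.p_per_t_nat] at this }
end


section
variable {d μ ω L K R : ℝ} {f : ℝ → ℝ → ℝ → ℝ} {p : ℝ → ℝ → ℝ}
  {u : ℝ → ℝ → ℝ} {g h : ℝ → ℝ}

theorem pre_of_fbp (E : Env d μ ω L K R f p)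
    (hlip : ∀ A > 0, ∃ K', ∀ t x a b, 0 ≤ a → a ≤ A → 0 ≤ b → b ≤ A →
      |f t x a - f t x b| ≤ K' * |a - b|) {g₀ h₀ : ℝ} (hgh : g₀ < h₀) {u₀ : ℝ → ℝ}
    (hu₀ : memH g₀ h₀ u₀) (hup : ∀ x ∈ Icc g₀ h₀, u₀ x ≤ p 0 x)
    (S : IsFBPSolution d μ f g₀ h₀ u₀ u g h) (h_top : Tendsto h atTop atTop)
    (g_bot : Tendsto g atTop atBot)
    (conv : ∀ A > (0:ℝ), ∀ ε > 0, ∃ T, ∀ t ≥ T, ∀ x ∈ Icc (-A) A, |u t x - p t x| ≤ ε) :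
    Pre d μ f p u g h := by
  obtain ⟨k1, k2, k3, k4⟩ := hu₀
  have hgc : ContinuousOn g (Ici 0) := S.g_smooth.continuousOn
  have hhc : ContinuousOn h (Ici 0) := S.h_smooth.continuousOn
  have zero : ∀ t ≥ 0, ∀ x, x ≤ g t ∨ h t ≤ x → u t x = 0 := by
    intro t ht x hx
    have hl : u t (g t) = 0 := by
      rcases ht.eq_or_lt with h0 | h0
      · rw [← h0, S.g_init, S.init g₀ ⟨le_rfl, hgh.le⟩, k2]
      · exact S.bc_left t h0
    have hr : u t (h t) = 0 := by
      rcases ht.eq_or_lt with h0 | h0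
      · rw [← h0, S.h_init, S.init h₀ ⟨hgh.le, le_rfl⟩, k3]
      · exact S.bc_right t h0
    rcases hx with hx | hx
    · rcases hx.eq_or_lt with h1 | h1
      · rw [h1, hl]
      · exact S.ext t ht x (Or.inl h1)
    · rcases hx.eq_or_lt with h1 | h1
      · rw [← h1, hr]
      · exact S.ext t ht x (Or.inr h1)
  have cont : ContinuousOn (fun q : ℝ × ℝ => u q.1 q.2) {q : ℝ × ℝ | 0 ≤ q.1} := by
    have hcl : IsClosed {q : ℝ × ℝ | 0 ≤ q.1} := isClosed_le continuous_const continuous_fst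
    have hg' : ContinuousOn (fun q : ℝ × ℝ => q.2 - g q.1) {q : ℝ × ℝ | 0 ≤ q.1} :=
      continuousOn_snd.sub (hgc.comp continuousOn_fst fun q hq => hq)
    have hh' : ContinuousOn (fun q : ℝ × ℝ => h q.1 - q.2) {q : ℝ × ℝ | 0 ≤ q.1} :=
      (hhc.comp continuousOn_fst fun q hq => hq).sub continuousOn_snd
    have c1 := hg'.preimage_isClosed_of_isClosed hcl (isClosed_Ici (a := (0:ℝ)))
    have c2 := hh'.preimage_isClosed_of_isClosed hcl (isClosed_Ici (a := (0:ℝ)))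
    have c3 := hg'.preimage_isClosed_of_isClosed hcl (isClosed_Iic (a := (0:ℝ)))
    have c4 := hh'.preimage_isClosed_of_isClosed hcl (isClosed_Iic (a := (0:ℝ)))
    have e : {q : ℝ × ℝ | 0 ≤ q.1} = (({q : ℝ × ℝ | 0 ≤ q.1} ∩ (fun q : ℝ × ℝ => q.2 - g q.1) ⁻¹' Ici 0) ∩
        ({q : ℝ × ℝ | 0 ≤ q.1} ∩ (fun q : ℝ × ℝ => h q.1 - q.2) ⁻¹' Ici 0)) ∪
        (({q : ℝ × ℝ | 0 ≤ q.1} ∩ (fun q : ℝ × ℝ => q.2 - g q.1) ⁻¹' Iic 0) ∪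
        ({q : ℝ × ℝ | 0 ≤ q.1} ∩ (fun q : ℝ × ℝ => h q.1 - q.2) ⁻¹' Iic 0)) := by
      ext q
      simp only [mem_union, mem_inter_iff, mem_preimage, mem_Ici, mem_Iic, mem_ofPred_eq]
      constructor
      · intro hq
        rcases le_total 0 (q.2 - g q.1) with h1 | h1
        · rcases le_total 0 (h q.1 - q.2) with h2 | h2
          · exact Or.inl ⟨⟨hq, h1⟩, hq, h2⟩
          · exact Or.inr (Or.inr ⟨hq, h2⟩)
        · exact Or.inr (Or.inl ⟨hq, h1⟩)
      · rintro (h1 | h1 | h1)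
        · exact h1.1.1
        · exact h1.1
        · exact h1.1
    rw [e]
    refine ContinuousOn.union_of_isClosed ?_ ?_ (c1.inter c2) (c3.union c4)
    · refine S.u_cont.mono ?_
      rintro q ⟨⟨h1, h2⟩, h3, h4⟩
      simp only [mem_preimage, mem_Ici] at h2 h4
      exact ⟨h1, by linarith, by linarith⟩
    · refine (continuousOn_const (c := (0:ℝ))).congr ?_
      rintro q (⟨h1, h2⟩ | ⟨h1, h2⟩)
      · simp only [mem_preimage, mem_Iic] at h2
        exact zero q.1 h1 q.2 (Or.inl (by linarith))
      · simp only [mem_preimage, mem_Iic] at h2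
        exact zero q.1 h1 q.2 (Or.inr (by linarith))
  have lep : ∀ t ≥ 0, ∀ x, u t x ≤ p t x := by
    intro T hT x
    by_cases hx : x ≤ g T ∨ h T ≤ x
    · rw [zero T hT x hx]; exact (E.p_pos _ _).le
    push Not at hx
    have hI : Icc 0 T ⊆ Ici (0:ℝ) := fun t ht => ht.1
    have hcont : ContinuousOn (fun q : ℝ × ℝ => u q.1 q.2) (Reg 0 T g h) :=
      cont.mono fun q hq => hq.1.1
    obtain ⟨A, hA⟩ := (Reg.isCompact (hgc.mono hI) (hhc.mono hI)).exists_bound_of_continuousOn hcont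
    obtain ⟨K', hK'⟩ := hlip (max A R) (lt_of_lt_of_le E.hR (le_max_right _ _))
    have key := mp_curves (hgc.mono hI) (hhc.mono hI) (w := fun t x => p t x - u t x)
      (E.p_cont.continuousOn.sub hcont) (K := K') E.hd
      (fun x hx => by
        rw [S.g_init, S.h_init] at hx
        have := hup x hx
        rw [S.init x hx]; linarith)
      (fun t ht hgh => by
        rw [zero t ht.1 _ (Or.inl le_rfl)]; linarith [E.p_pos t (g t)])
      (fun t ht hgh => by
        rw [zero t ht.1 _ (Or.inr le_rfl)]; linarith [E.p_pos t (h t)])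
      (fun t x a1 a2 a3 a4 a5 => by
        obtain ⟨a, b, ha, hb, hab⟩ := S.pde.c2At (t := t) (x := x) (by
          filter_upwards [Ioo_mem_nhds a3 a4] with y hy using ⟨a1, hy.1, hy.2⟩)
        obtain ⟨a', b', ha', hb', hab'⟩ := E.p_sol.c2At (t := t) (x := x)
          (Eventually.of_forall fun y => mem_univ _)
        refine ⟨_, _, hb'.fun_sub hb, ha'.sub ha, ?_⟩
        have hp := E.p_pos t x
        have hAu := (abs_le.1 (hA (t, x) ⟨⟨a1.le, a2⟩, a3.le, a4.le⟩)).2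
        have l := hK' t x (p t x) (u t x) hp.le ((E.p_le t x).trans (le_max_right _ _))
          (by linarith) (hAu.trans (le_max_left _ _))
        rw [abs_of_neg a5] at l
        have := (abs_le.1 l).1
        rw [hab, hab']
        linarith)
    have := key T ⟨hT, le_rfl⟩ x ⟨hx.1.le, hx.2.le⟩
    linarith
  have hsub : Ioi (0:ℝ) ⊆ Ici 0 := Ioi_subset_Ici_self
  have init0 : ∀ x, 0 < u 0 x → x ∈ Ioo g₀ h₀ := by
    intro x hx
    by_contra hc
    have := zero 0 le_rfl x (by
      rw [S.g_init, S.h_init]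
      by_contra h2; push Not at h2; exact hc h2)
    linarith
  exact {
    cont := cont
    gc := hgc
    hc := hhc
    dh := fun t ht => by
      refine ⟨_, S.stefan_right t ht, fun hv => ?_⟩
      set D := derivWithin (u t) (Iic (h t)) (h t) with hD
      have hDn : D < 0 := by
        by_contra h0
        push Not at h0
        nlinarith [mul_nonneg E.hμ.le h0]
      refine ⟨-D, by linarith, by ring, ?_⟩
      rw [neg_neg]
      refine DifferentiableWithinAt.hasDerivWithinAt ?_
      by_contra h0
      rw [hD, derivWithin_zero_of_not_differentiableWithinAt h0] at hDn
      exact lt_irrefl _ hDn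
    dg := fun t ht => by
      set D := derivWithin (u t) (Ici (g t)) (g t) with hD
      refine ⟨μ * D, (S.stefan_left t ht).congr_deriv (by ring), fun hv => ?_⟩
      have hDn : 0 < D := pos_of_mul_pos_right hv E.hμ.le
      refine ⟨D, hDn, rfl, ?_⟩
      refine DifferentiableWithinAt.hasDerivWithinAt ?_
      by_contra h0
      rw [hD, derivWithin_zero_of_not_differentiableWithinAt h0] at hDn
      exact lt_irrefl _ hDn
    ch := (S.h_smooth.mono hsub).continuousOn_deriv_of_isOpen isOpen_Ioi le_rfl
    cg := (S.g_smooth.mono hsub).continuousOn_deriv_of_isOpen isOpen_Ioi le_rfl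
    zero := zero
    pde := S.pde
    lep := lep
    init := fun x1 x2 h1 h2 x hx => by
      have a1 := init0 x1 h1
      have a2 := init0 x2 h2
      have a3 : x ∈ Ioo g₀ h₀ := ⟨a1.1.trans_le hx.1, hx.2.trans_lt a2.2⟩
      rw [S.init x ⟨a3.1.le, a3.2.le⟩]
      exact k4 x a3
    h_top := h_top
    g_bot := g_bot
    conv := conv }
end


section
variable {d μ ω L K R : ℝ} {f : ℝ → ℝ → ℝ → ℝ} {p : ℝ → ℝ → ℝ}

theorem shift_limit {φ : ℝ → ℝ} {a c : ℝ}
    (hφ : Tendsto (fun t => φ (t + a) / t) atTop (𝓝 c)) :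
    Tendsto (fun t => φ t / t) atTop (𝓝 c) := by
  have h1 : Tendsto (fun t : ℝ => t - a) atTop atTop := tendsto_atTop_add_const_right _ _ tendsto_id
  have h2 := hφ.comp h1
  have h3 : Tendsto (fun t : ℝ => 1 - a / t) atTop (𝓝 (1 - 0)) :=
    tendsto_const_nhds.sub (tendsto_const_nhds.div_atTop tendsto_id)
  have h4 := h2.mul h3
  simp only [sub_zero, mul_one] at h4
  refine h4.congr' ?_
  filter_upwards [eventually_gt_atTop 0, eventually_gt_atTop a] with t ht hta
  have : t - a ≠ 0 := by linarith
  simp only [Function.comp_apply, sub_add_cancel]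
  field_simp

theorem lower_unshift (E : Env d μ ω L K R f p) {u : ℝ → ℝ → ℝ} {n : ℕ} {c : ℝ} (hc : 0 < c)
    (hV : ∀ c'', 0 ≤ c'' → c'' < c → ∀ ε > 0, ∃ T, ∀ t ≥ T, ∀ x ∈ Icc 0 (c'' * t),
      p t x - ε ≤ u (t + n * ω) x) {c1 : ℝ} (hc1 : c1 < c) {ε : ℝ} (hε : 0 < ε) :
    ∃ T, ∀ t ≥ T, ∀ x, 0 ≤ x → x ≤ c1 * t → p t x - ε ≤ u t x := by
  set c' := max c1 0 with hc'
  have h0 : 0 ≤ c' := le_max_right _ _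
  have h1 : c' < c := max_lt hc1 hc
  set c'' := (c' + c) / 2 with hc''
  have h2 : 0 ≤ c'' := by rw [hc'']; linarith
  have h3 : c'' < c := by rw [hc'']; linarith
  have h4 : c' < c'' := by rw [hc'']; linarith
  obtain ⟨T, hT⟩ := hV c'' h2 h3 ε hε
  set a := (n:ℝ) * ω with ha
  refine ⟨max (max (T + a) 0) (c'' * a / (c'' - c')), fun t ht x hx0 hx1 => ?_⟩
  have b1 : T + a ≤ t := (le_max_left _ _).trans ((le_max_left _ _).trans ht)
  have b2 : 0 ≤ t := (le_max_right _ _).trans ((le_max_left _ _).trans ht)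
  have b3 : c'' * a / (c'' - c') ≤ t := (le_max_right _ _).trans ht
  rw [div_le_iff₀ (by linarith)] at b3
  have b4 : c1 * t ≤ c' * t := mul_le_mul_of_nonneg_right (le_max_left _ _) b2
  have := hT (t - a) (by linarith) x ⟨hx0, by nlinarith⟩
  rw [sub_add_cancel] at this
  have e : p t x = p (t - a) x := by
    have := E.p_per_t_nat n (t - a) x
    rw [← ha, sub_add_cancel] at this
    exact this
  rw [e]; exact this

theorem main_of_env (E : Env d μ ω L K R f p)
    (hlip : ∀ A > 0, ∃ K', ∀ t x a b, 0 ≤ a → a ≤ A → 0 ≤ b → b ≤ A →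
      |f t x a - f t x b| ≤ K' * |a - b|) :
    ∃ cminus > (0:ℝ), ∃ cplus > (0:ℝ), Theorem11Conclusion d μ f p cminus cplus := by
  by_cases hex : ∃ U gU hU, Good d μ f p U gU hU
  · obtain ⟨U, gU, hU, GU⟩ := hex
    obtain ⟨cp, hcp, hP⟩ := speed E GU
    obtain ⟨cm, hcm, hM⟩ := speed E.refl GU.refl
    refine ⟨cm, hcm, cp, hcp, ?_⟩
    intro g₀ h₀ hgh u₀ hu₀ hup u g h S h_top g_bot conv
    have P := pre_of_fbp E hlip hgh hu₀ hup S h_top g_bot conv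
    obtain ⟨n, G⟩ := P.good E
    obtain ⟨r1, r2⟩ := hP G
    obtain ⟨l1, l2⟩ := hM G.refl
    refine ⟨?_, ?_, shift_limit r2⟩
    · intro c₁ c₂ hc2 _ hc1 ε hε
      obtain ⟨T1, hT1⟩ := lower_unshift E hcp r1 hc1 hε
      obtain ⟨T2, hT2⟩ := lower_unshift E.refl (u := reflU u) (n := n) hcm l1
        (show c₂ < cm by linarith) hε
      refine ⟨max (max T1 T2) 0, fun t ht x hx => ?_⟩
      have b1 : T1 ≤ t := (le_max_left _ _).trans ((le_max_left _ _).trans ht)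
      have b3 : T2 ≤ t := (le_max_right _ _).trans ((le_max_left _ _).trans ht)
      have b2 : 0 ≤ t := (le_max_right _ _).trans ht
      have hle := P.lep t b2 x
      have hge : p t x - ε ≤ u t x := by
        rcases le_total 0 x with h0 | h0
        · exact hT1 t b1 x h0 hx.2
        · have := hT2 t b3 (-x) (by linarith) (by linarith [hx.1])
          simpa [reflU] using this
      rw [abs_le]; constructor <;> linarith
    · have := (shift_limit (φ := fun t => - g t) l2).neg
      refine this.congr fun t => ?_
      ring
  · refine ⟨1, one_pos, 1, one_pos, ?_⟩
    intro g₀ h₀ hgh u₀ hu₀ hup u g h S h_top g_bot conv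
    have P := pre_of_fbp E hlip hgh hu₀ hup S h_top g_bot conv
    obtain ⟨n, G⟩ := P.good E
    exact absurd ⟨_, _, _, G⟩ hex
end


section
variable {ω L : ℝ} {f : ℝ → ℝ → ℝ → ℝ}

theorem shift_int {g : ℝ → ℝ} {T : ℝ} (h : ∀ t, g (t + T) = g t) (n : ℤ) (t : ℝ) :
    g (t + n * T) = g t := by
  have hp : Function.Periodic g T := h
  exact (hp.int_mul n) t

/-- for each level `a ≥ 0`, `f(·,·,a)` is bounded. -/
theorem f_bdd (hω : 0 < ω) (hL : 0 < L) (hf : BasicAssumptions ω L f) {a : ℝ} (ha : 0 ≤ a) :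
    ∃ C, ∀ t x, |f t x a| ≤ C := by
  have hc : ContinuousOn (fun q : ℝ × ℝ => f q.1 q.2 a) (Icc 0 ω ×ˢ Icc 0 L) := by
    have h1 : Continuous (fun q : ℝ × ℝ => ((q.1, q.2, a) : ℝ × ℝ × ℝ)) := by fun_prop
    exact hf.cont.comp h1.continuousOn (fun q _ => ha)
  obtain ⟨C, hC⟩ := (isCompact_Icc.prod isCompact_Icc).exists_bound_of_continuousOn hc
  refine ⟨C, fun t x => ?_⟩
  have e1 : f (t - ⌊t / ω⌋ * ω) x a = f t x a := by
    have := shift_int (g := fun t => f t x a) (fun t => hf.per_t t x a ha) ⌊t / ω⌋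
      (t - ⌊t / ω⌋ * ω)
    simpa using this.symm
  have e2 : f (t - ⌊t / ω⌋ * ω) (x - ⌊x / L⌋ * L) a = f (t - ⌊t / ω⌋ * ω) x a := by
    have := shift_int (g := fun x => f (t - ⌊t / ω⌋ * ω) x a) (fun x => hf.per_x _ x a ha) ⌊x / L⌋
      (x - ⌊x / L⌋ * L)
    simpa using this.symm
  have r : ∀ {s T : ℝ}, 0 < T → s - ⌊s / T⌋ * T ∈ Icc 0 T := by
    intro s T hT
    have h1 := Int.floor_le (s / T)
    have h2 := Int.lt_floor_add_one (s / T)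
    rw [le_div_iff₀ hT] at h1
    rw [div_lt_iff₀ hT] at h2
    constructor <;> linarith
  have := hC (t - ⌊t / ω⌋ * ω, x - ⌊x / L⌋ * L) ⟨r hω, r hL⟩
  rw [Real.norm_eq_abs] at this
  simp only at this
  rw [e2, e1] at this
  exact this

theorem f_lip (hω : 0 < ω) (hL : 0 < L) (hf : BasicAssumptions ω L f) :
    ∀ A > 0, ∃ K', ∀ t x a b, 0 ≤ a → a ≤ A → 0 ≤ b → b ≤ A →
      |f t x a - f t x b| ≤ K' * |a - b| := by
  obtain ⟨fu, hfu, hmod⟩ := hf.c1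
  obtain ⟨δ, hδ, hm⟩ := hmod 1 one_pos
  obtain ⟨C, hC⟩ := f_bdd hω hL hf hδ.le
  have hC0 : 0 ≤ C := (abs_nonneg _).trans (hC 0 0)
  -- bound of `fu` at zero
  have h0 : ∀ t x, |fu t x 0| ≤ C / δ + 1 := by
    intro t x
    have key := Convex.norm_image_sub_le_of_norm_hasDerivWithin_le
      (f := fun u => f t x u - fu t x 0 * u) (f' := fun u => fu t x u - fu t x 0) (C := 1)
      (s := Icc 0 δ) (x := 0) (y := δ)
      (fun u hu => by
        have h1 := (hfu t x u hu.1).mono (Icc_subset_Ici_self : Icc 0 δ ⊆ Ici 0)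
        have h2 : HasDerivWithinAt (fun u : ℝ => fu t x 0 * u) (fu t x 0 * 1) (Icc 0 δ) u :=
          ((hasDerivAt_id' u).const_mul _).hasDerivWithinAt
        have h3 := h1.fun_sub h2
        rwa [mul_one] at h3)
      (fun u hu => by
        rw [Real.norm_eq_abs]
        exact hm t x u 0 hu.1 le_rfl (by rw [sub_zero, abs_of_nonneg hu.1]; exact hu.2))
      (convex_Icc 0 δ) ⟨le_rfl, hδ.le⟩ ⟨hδ.le, le_rfl⟩
    simp only [hf.zero, mul_zero, sub_zero, Real.norm_eq_abs, one_mul, abs_of_pos hδ] at key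
    have h1 : |fu t x 0 * δ| ≤ C + δ := by
      have := abs_sub_abs_le_abs_sub (fu t x 0 * δ) (f t x δ)
      rw [abs_sub_comm] at key
      linarith [hC t x]
    rw [abs_mul, abs_of_pos hδ] at h1
    have : C / δ + 1 = (C + δ) / δ := by field_simp
    rw [this, le_div_iff₀ hδ]
    exact h1
  have h1 : ∀ (N : ℕ) t x u, 0 ≤ u → u ≤ N * δ → |fu t x u| ≤ C / δ + 1 + N := by
    intro N
    induction N with
    | zero =>
      intro t x u hu hu2
      have : u = 0 := by
        simp only [Nat.cast_zero, zero_mul] at hu2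
        linarith
      rw [this]; simpa using h0 t x
    | succ N ih =>
      intro t x u hu hu2
      push_cast at hu2 ⊢
      by_cases hc : u ≤ δ
      · have a1 := hm t x u 0 hu le_rfl (by rw [sub_zero, abs_of_nonneg hu]; exact hc)
        have a2 := abs_sub_abs_le_abs_sub (fu t x u) (fu t x 0)
        have := h0 t x
        have : (0:ℝ) ≤ N := Nat.cast_nonneg N
        linarith
      · push Not at hc
        have a0 := ih t x (u - δ) (by linarith) (by linarith)
        have a1 := hm t x u (u - δ) hu (by linarith) (by rw [sub_sub_cancel, abs_of_pos hδ])
        have a2 := abs_sub_abs_le_abs_sub (fu t x u) (fu t x (u - δ))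
        linarith
  intro A hA
  obtain ⟨N, hN⟩ := exists_nat_ge (A / δ)
  rw [div_le_iff₀ hδ] at hN
  refine ⟨C / δ + 1 + N, fun t x a b ha haA hb hbA => ?_⟩
  have key := Convex.norm_image_sub_le_of_norm_hasDerivWithin_le
      (f := fun u => f t x u) (f' := fun u => fu t x u) (C := C / δ + 1 + N)
      (s := Icc 0 A) (x := b) (y := a)
      (fun u hu => (hfu t x u hu.1).mono (Icc_subset_Ici_self : Icc 0 A ⊆ Ici 0))
      (fun u hu => by
        rw [Real.norm_eq_abs]
        exact h1 N t x u hu.1 (hu.2.trans hN))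
      (convex_Icc 0 A) ⟨hb, hbA⟩ ⟨ha, haA⟩
  simpa only [Real.norm_eq_abs] using key

end


section
open MeasureTheory

/-- The standard Gaussian density and its first two derivatives. -/
def kap0 (z : ℝ) : ℝ := (√(2 * Real.pi))⁻¹ * Real.exp (-(z ^ 2) / 2)
def kap1 (z : ℝ) : ℝ := -z * kap0 z
def kap2 (z : ℝ) : ℝ := (z ^ 2 - 1) * kap0 z

theorem kap0_pos (z : ℝ) : 0 < kap0 z := by unfold kap0; positivity

theorem kap0_cont : Continuous kap0 := by unfold kap0; fun_prop
theorem kap1_cont : Continuous kap1 := by unfold kap1; have := kap0_cont; fun_prop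
theorem kap2_cont : Continuous kap2 := by unfold kap2; have := kap0_cont; fun_prop

theorem kap0_deriv (z : ℝ) : HasDerivAt kap0 (kap1 z) z := by
  have h1 : HasDerivAt (fun z : ℝ => -(z ^ 2) / 2) (-z) z :=
    (((hasDerivAt_id' z).fun_pow 2).fun_neg.div_const 2).congr_deriv (by push_cast; ring)
  have h2 := (h1.exp).const_mul (√(2 * Real.pi))⁻¹
  refine h2.congr_deriv ?_
  unfold kap1 kap0; ring

theorem kap1_deriv (z : ℝ) : HasDerivAt kap1 (kap2 z) z := by
  have h2 := (hasDerivAt_id' z).fun_neg.fun_mul (kap0_deriv z)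
  refine h2.congr_deriv ?_
  unfold kap2 kap1; ring

theorem kap0_bound (z : ℝ) : kap0 z * (1 + z ^ 2) ^ 3 ≤ 216 := by
  have h1 : (√(2 * Real.pi))⁻¹ ≤ 1 := by
    apply inv_le_one_of_one_le₀
    rw [Real.one_le_sqrt]
    linarith [Real.pi_gt_three]
  have h2 : Real.exp (-(z ^ 2) / 2) * (1 + z ^ 2) ^ 3 ≤ 216 := by
    have h3 : (1 + z ^ 2) / 6 ≤ Real.exp (z ^ 2 / 6) := by
      have := Real.add_one_le_exp (z ^ 2 / 6)
      linarith
    have h4 : ((1 + z ^ 2) / 6) ^ 3 ≤ Real.exp (z ^ 2 / 6) ^ 3 := by gcongr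
    have h5 : Real.exp (z ^ 2 / 6) ^ 3 * Real.exp (-(z ^ 2) / 2) = 1 := by
      rw [← Real.exp_nat_mul, ← Real.exp_add, Real.exp_eq_one_iff]
      push_cast; ring
    have h6 := Real.exp_pos (-(z ^ 2) / 2)
    have h7 := mul_le_mul_of_nonneg_right h4 h6.le
    rw [h5] at h7
    have e : ((1 + z ^ 2) / 6) ^ 3 * Real.exp (-(z ^ 2) / 2)
      = Real.exp (-(z ^ 2) / 2) * (1 + z ^ 2) ^ 3 / 216 := by ring
    rw [e] at h7
    linarith
  unfold kap0
  rw [mul_assoc]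
  calc _ ≤ 1 * (Real.exp (-(z ^ 2) / 2) * (1 + z ^ 2) ^ 3) := by gcongr
    _ ≤ 216 := by rw [one_mul]; exact h2

/-- dominating weight -/
def wt (z : ℝ) : ℝ := 216 * (1 + z ^ 2)⁻¹

theorem wt_int : Integrable wt := integrable_inv_one_add_sq.const_mul 216
theorem wt_pos (z : ℝ) : 0 < wt z := by unfold wt; positivity
theorem wt_cont : Continuous wt := by
  unfold wt
  exact continuous_const.mul ((by fun_prop : Continuous fun z : ℝ => 1 + z ^ 2).inv₀
    (fun z => by positivity))

theorem kap0_le (z : ℝ) : (1 + z ^ 2) ^ 2 * |kap0 z| ≤ wt z := by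
  rw [abs_of_pos (kap0_pos z)]
  unfold wt
  rw [← div_eq_mul_inv, le_div_iff₀ (by positivity)]
  nlinarith [kap0_bound z]

theorem kap1_le (z : ℝ) : (1 + z ^ 2) * |kap1 z| ≤ wt z := by
  unfold kap1
  rw [abs_mul, abs_neg]
  have h : |z| ≤ 1 + z ^ 2 := by
    rw [abs_le]; constructor <;> nlinarith [sq_nonneg (z - 1), sq_nonneg (z + 1)]
  refine le_trans ?_ (kap0_le z)
  have : (1 + z ^ 2) * (|z| * |kap0 z|) ≤ (1 + z ^ 2) * ((1 + z ^ 2) * |kap0 z|) := by gcongr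
  linarith

theorem kap2_le (z : ℝ) : (1 + z ^ 2) * |kap2 z| ≤ wt z := by
  unfold kap2
  rw [abs_mul]
  have h : |z ^ 2 - 1| ≤ 1 + z ^ 2 := by
    rw [abs_le]; constructor <;> nlinarith [sq_nonneg z]
  refine le_trans ?_ (kap0_le z)
  have : (1 + z ^ 2) * (|z ^ 2 - 1| * |kap0 z|) ≤ (1 + z ^ 2) * ((1 + z ^ 2) * |kap0 z|) := by gcongr
  linarith

/-- a kernel: continuous and dominated by the weight. -/
structure Ker (κ : ℝ → ℝ) : Prop where
  cont : Continuous κ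
  le : ∀ z, (1 + z ^ 2) * |κ z| ≤ wt z

theorem ker0 : Ker kap0 := ⟨kap0_cont, fun z => le_trans (by
  gcongr; nlinarith [sq_nonneg z, sq_nonneg (z ^ 2)]) (kap0_le z)⟩
theorem ker1 : Ker kap1 := ⟨kap1_cont, kap1_le⟩
theorem ker2 : Ker kap2 := ⟨kap2_cont, kap2_le⟩

theorem Ker.le_wt {κ : ℝ → ℝ} (h : Ker κ) (z : ℝ) : |κ z| ≤ wt z := by
  refine le_trans ?_ (h.le z)
  have := abs_nonneg (κ z)
  nlinarith [sq_nonneg z]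

theorem Ker.int {κ : ℝ → ℝ} (h : Ker κ) : Integrable κ :=
  wt_int.mono' h.cont.aestronglyMeasurable (ae_of_all _ fun z => h.le_wt z)

theorem Ker.int_mul {κ : ℝ → ℝ} (h : Ker κ) {φ : ℝ → ℝ} (hφ : Continuous φ) {B : ℝ}
    (hB : ∀ x, |φ x| ≤ B) (x a : ℝ) : Integrable fun z => φ (x + a * z) * κ z := by
  refine (wt_int.const_mul B).mono' ?_ (ae_of_all _ fun z => ?_)
  · exact ((hφ.comp (by fun_prop)).mul h.cont).aestronglyMeasurable
  · rw [Real.norm_eq_abs, abs_mul]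
    have := (abs_nonneg _).trans (hB 0)
    exact mul_le_mul (hB _) (h.le_wt z) (abs_nonneg _) this

/-- smoothing operator with kernel -/
def Sm (κ : ℝ → ℝ) (a : ℝ) (φ : ℝ → ℝ) (x : ℝ) : ℝ := ∫ z, φ (x + a * z) * κ z

theorem Sm_bound {κ : ℝ → ℝ} (h : Ker κ) {φ : ℝ → ℝ} {B : ℝ} (hB : ∀ x, |φ x| ≤ B) (a x : ℝ) :
    |Sm κ a φ x| ≤ B * ∫ z, wt z := by
  rw [← integral_const_mul]
  refine norm_integral_le_of_norm_le (f := fun z => φ (x + a * z) * κ z)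
    (wt_int.const_mul B) (ae_of_all _ fun z => ?_)
  rw [Real.norm_eq_abs, abs_mul]
  have := (abs_nonneg _).trans (hB 0)
  exact mul_le_mul (hB _) (h.le_wt z) (abs_nonneg _) this

theorem wt_shift {z s : ℝ} (hs : |s| ≤ 1) : wt (z + s) ≤ 3 * wt z := by
  unfold wt
  have : (1 + (z + s) ^ 2)⁻¹ ≤ 3 * (1 + z ^ 2)⁻¹ := by
    rw [← div_eq_mul_inv, inv_eq_one_div, div_le_div_iff₀ (by positivity) (by positivity)]
    have := abs_le.1 hs
    nlinarith [sq_nonneg (z + 2 * s), this.1, this.2]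
  linarith

/-- derivative of the smoothing -/
theorem Sm_deriv {κ κ' : ℝ → ℝ} (h : Ker κ) (h' : Ker κ') (hd : ∀ z, HasDerivAt κ (κ' z) z)
    {φ : ℝ → ℝ} (hφ : Continuous φ) {B : ℝ} (hB : ∀ x, |φ x| ≤ B) {a : ℝ} (ha : 0 < a) (x : ℝ) :
    HasDerivAt (Sm κ a φ) (-(1 / a) * Sm κ' a φ x) x := by
  set ψ : ℝ → ℝ := fun w => φ (a * w) with hψ
  have hψc : Continuous ψ := hφ.comp (by fun_prop)
  have hB0 := (abs_nonneg _).trans (hB 0)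
  have tr : ∀ (k : ℝ → ℝ) (s : ℝ), ∫ z, ψ (s + z) * k z = ∫ y, ψ y * k (y - s) := by
    intro k s
    rw [← integral_add_left_eq_self (fun y => ψ y * k (y - s)) s]
    simp
  have e : ∀ (k : ℝ → ℝ) (y : ℝ), Sm k a φ y = ∫ z, ψ (y / a) * 0 + ψ (y / a + z) * k z := by
    intro k y
    unfold Sm
    refine integral_congr_ae (ae_of_all _ fun z => ?_)
    simp only [hψ, mul_zero, zero_add]
    congr 2
    field_simp
  have e' : ∀ (k : ℝ → ℝ) (y : ℝ), Sm k a φ y = ∫ z, ψ z * k (z - y / a) := by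
    intro k y
    rw [e, ← tr]; simp
  have key : ∀ s : ℝ, HasDerivAt (fun s => ∫ y, ψ y * κ (y - s)) (∫ y, ψ y * (-κ' (y - s))) s := by
    intro s
    refine (hasDerivAt_integral_of_dominated_loc_of_deriv_le (s := Metric.ball s 1)
      (F := fun s y => ψ y * κ (y - s)) (F' := fun s y => ψ y * (-κ' (y - s)))
      (bound := fun y => B * (3 * wt (y - s)))
      (Metric.ball_mem_nhds s one_pos) ?_ ?_ ?_ ?_ ?_ ?_).2
    · refine Eventually.of_forall fun s' => ?_
      exact (hψc.mul (h.cont.comp (by fun_prop))).aestronglyMeasurable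
    · have := (wt_int.comp_sub_right s).const_mul B
      refine this.mono' (hψc.mul (h.cont.comp (by fun_prop))).aestronglyMeasurable
        (ae_of_all _ fun y => ?_)
      rw [Real.norm_eq_abs, abs_mul]
      exact mul_le_mul (hB _) (h.le_wt _) (abs_nonneg _) hB0
    · exact (hψc.mul (h'.cont.comp (by fun_prop)).neg).aestronglyMeasurable
    · refine ae_of_all _ fun y s' hs' => ?_
      rw [Real.norm_eq_abs, abs_mul, abs_neg]
      refine mul_le_mul (hB _) ((h'.le_wt _).trans ?_) (abs_nonneg _) hB0
      have : y - s' = (y - s) + (s - s') := by ring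
      rw [this]
      apply wt_shift
      rw [Metric.mem_ball, dist_comm, Real.dist_eq] at hs'
      exact hs'.le
    · exact ((wt_int.comp_sub_right s).const_mul 3).const_mul B
    · refine ae_of_all _ fun y s' _ => ?_
      have := HasDerivAt.comp (h := fun s => y - s) s' (hd (y - s'))
        ((hasDerivAt_id' s').const_sub y)
      exact (this.congr_deriv (by ring)).const_mul (ψ y)
  have k2 := HasDerivAt.comp (h := fun x => x / a) x (key (x / a)) ((hasDerivAt_id' x).div_const a)
  have e3 : Sm κ a φ = (fun s => ∫ y, ψ y * κ (y - s)) ∘ fun x => x / a := by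
    funext y; rw [e']; rfl
  rw [e3]
  refine k2.congr_deriv ?_
  rw [e' κ' x]
  simp only [mul_neg, integral_neg]
  ring

theorem kap0_integral : ∫ z, kap0 z = 1 := by
  have := ProbabilityTheory.integral_gaussianPDFReal_eq_one 0 (v := 1) one_ne_zero
  rw [← this]
  congr 1
  funext z
  simp [kap0, ProbabilityTheory.gaussianPDFReal]

theorem integral_ker_deriv {κ κ' : ℝ → ℝ} (h : Ker κ) (h' : Ker κ')
    (hd : ∀ z, HasDerivAt κ (κ' z) z) : ∫ z, κ' z = 0 := by
  have := Sm_deriv h h' hd (φ := fun _ => 1) continuous_const (B := 1) (fun _ => by simp)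
    one_pos 0
  have e : ∀ k : ℝ → ℝ, Sm k 1 (fun _ => 1) = fun _ => ∫ z, k z := by
    intro k; funext x; simp [Sm]
  rw [e, e] at this
  have := this.unique (hasDerivAt_const _ _)
  linarith

theorem kap1_integral : ∫ z, kap1 z = 0 := integral_ker_deriv ker0 ker1 kap0_deriv
theorem kap2_integral : ∫ z, kap2 z = 0 := integral_ker_deriv ker1 ker2 kap1_deriv

/-- joint continuity of the smoothing -/
theorem Sm_cont {κ : ℝ → ℝ} (h : Ker κ) {X : Type*} [TopologicalSpace X]
    [FirstCountableTopology X] {q : X → ℝ → ℝ}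
    (hq : Continuous fun r : X × ℝ => q r.1 r.2) {B : ℝ} (hB : ∀ s x, |q s x| ≤ B)
    {a y : X → ℝ} (ha : Continuous a) (hy : Continuous y) :
    Continuous fun s => Sm κ (a s) (q s) (y s) := by
  refine continuous_of_dominated (F := fun s z => q s (y s + a s * z) * κ z)
    (bound := fun z => B * wt z) ?_ ?_ (wt_int.const_mul B) ?_
  · intro s
    have : Continuous fun z => q s (y s + a s * z) :=
      hq.comp (Continuous.prodMk continuous_const (by fun_prop))
    exact (this.mul h.cont).aestronglyMeasurable
  · intro s
    refine ae_of_all _ fun z => ?_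
    rw [Real.norm_eq_abs, abs_mul]
    exact mul_le_mul (hB _ _) (h.le_wt _) (abs_nonneg _) ((abs_nonneg _).trans (hB s 0))
  · refine ae_of_all _ fun z => ?_
    have : Continuous fun s => q s (y s + a s * z) :=
      hq.comp (Continuous.prodMk continuous_id (by fun_prop))
    exact this.mul continuous_const

end


section
open MeasureTheory

theorem Sm_gauss {a : ℝ} {φ : ℝ → ℝ} (hφ : Continuous φ) (x : ℝ) :
    Sm kap0 a φ x = ∫ y, φ (x + y) ∂(ProbabilityTheory.gaussianReal 0 (.mk (a ^ 2) (sq_nonneg _))) := by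
  have h := ProbabilityTheory.gaussianReal_map_const_mul (μ := 0) (v := 1) a
  rw [mul_zero, mul_one] at h
  rw [← h, integral_map (by fun_prop)
    (by fun_prop : Continuous fun y => φ (x + y)).aestronglyMeasurable,
    ProbabilityTheory.integral_gaussianReal_eq_integral_smul one_ne_zero]
  unfold Sm
  congr 1
  funext z
  simp [kap0, ProbabilityTheory.gaussianPDFReal]
  ring

theorem Sm_semigroup {a b : ℝ} {φ : ℝ → ℝ} (hφ : Continuous φ) {B : ℝ} (hB : ∀ x, |φ x| ≤ B)
    (x : ℝ) : Sm kap0 (√(a ^ 2 + b ^ 2)) φ x = Sm kap0 a (Sm kap0 b φ) x := by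
  have hc : Continuous (Sm kap0 b φ) :=
    Sm_cont ker0 (q := fun _ : ℝ => φ) (by fun_prop) (fun _ => hB) continuous_const continuous_id
  rw [Sm_gauss hφ, Sm_gauss hc]
  have e : (NNReal.mk ((√(a ^ 2 + b ^ 2)) ^ 2) (sq_nonneg _) : NNReal) =
      NNReal.mk (a ^ 2) (sq_nonneg _) + NNReal.mk (b ^ 2) (sq_nonneg _) := by
    apply NNReal.eq
    simp only [NNReal.coe_mk, NNReal.coe_add]
    rw [Real.sq_sqrt (by positivity)]
  have h := ProbabilityTheory.gaussianReal_conv_gaussianReal (m₁ := 0) (m₂ := 0)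
    (v₁ := .mk (a ^ 2) (sq_nonneg _)) (v₂ := .mk (b ^ 2) (sq_nonneg _))
  rw [add_zero] at h
  rw [e, ← h, Measure.conv, integral_map (by fun_prop)
    (by fun_prop : Continuous fun y => φ (x + y)).aestronglyMeasurable]
  rw [integral_prod]
  · congr 1
    funext y
    rw [Sm_gauss hφ]
    congr 1
    funext y'
    rw [add_assoc]
  · refine Integrable.mono' (integrable_const B) ?_ (ae_of_all _ fun y => hB _)
    exact (hφ.comp (by fun_prop : Continuous fun y : ℝ × ℝ => x + (y.1 + y.2))).aestronglyMeasurable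

theorem peano2 {φ φ1 : ℝ → ℝ} {x c : ℝ} (h1 : ∀ y, HasDerivAt φ (φ1 y) y)
    (h2 : HasDerivAt φ1 c x) {ε : ℝ} (hε : 0 < ε) :
    ∃ δ > 0, ∀ y, |y| ≤ δ → |φ (x + y) - φ x - φ1 x * y - c * y ^ 2 / 2| ≤ ε * y ^ 2 := by
  have h3 := h2.isLittleO.bound hε
  obtain ⟨δ, hδ, h4⟩ := Metric.nhds_basis_closedBall.eventually_iff.1 h3
  refine ⟨δ, hδ, fun y hy => ?_⟩
  have key := Convex.norm_image_sub_le_of_norm_hasDerivWithin_le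
      (f := fun u => φ (x + u) - φ x - φ1 x * u - c * u ^ 2 / 2)
      (f' := fun u => φ1 (x + u) - φ1 x - c * u) (C := ε * |y|)
      (s := Icc (-|y|) |y|) (x := 0) (y := y)
      (fun u _ => by
        have a1 := HasDerivAt.comp (h := fun u => x + u) u (h1 (x + u))
          ((hasDerivAt_id' u).const_add x)
        have a2 := (((a1.sub_const (φ x)).fun_sub ((hasDerivAt_id' u).const_mul (φ1 x))).fun_sub
          ((((hasDerivAt_id' u).fun_pow 2).const_mul c).div_const 2))
        exact (a2.congr_deriv (by push_cast; ring)).hasDerivWithinAt)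
      (fun u hu => by
        have hu' : |u| ≤ |y| := abs_le.2 hu
        have := @h4 (x + u) (by
          rw [Metric.mem_closedBall, Real.dist_eq, add_sub_cancel_left]; exact hu'.trans hy)
        simp only [add_sub_cancel_left, Real.norm_eq_abs, smul_eq_mul] at this
        rw [Real.norm_eq_abs, mul_comm c u]
        exact this.trans (mul_le_mul_of_nonneg_left hu' hε.le))
      (convex_Icc _ _) ⟨by simp, by simp⟩ ⟨neg_abs_le y, le_abs_self y⟩
  simp only [add_zero, sub_self, mul_zero, ne_eq, OfNat.ofNat_ne_zero, not_false_eq_true, zero_pow,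
    zero_div, sub_zero, Real.norm_eq_abs] at key
  rw [mul_assoc, abs_mul_abs_self, ← sq] at key
  exact key

theorem kap0_second : ∫ z, z ^ 2 * kap0 z = 1 := by
  have h := kap2_integral
  have e : (fun z => z ^ 2 * kap0 z) = fun z => kap2 z + kap0 z := by
    funext z; unfold kap2; ring
  rw [e, integral_add ker2.int ker0.int, h, kap0_integral, zero_add]

theorem gauss_gen {d : ℝ} (hd : 0 < d) {φ φ1 : ℝ → ℝ} {x c B : ℝ} (hB : ∀ x, |φ x| ≤ B)
    (h1 : ∀ y, HasDerivAt φ (φ1 y) y) (h2 : HasDerivAt φ1 c x) :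
    Tendsto (fun h => (Sm kap0 (√(2 * d * h)) φ x - φ x) / h) (𝓝[>] 0) (𝓝 (d * c)) := by
  have hφ : Continuous φ := continuous_iff_continuousAt.2 fun y => (h1 y).continuousAt
  have hB0 : 0 ≤ B := (abs_nonneg _).trans (hB 0)
  set ψ : ℝ → ℝ := fun y => φ (x + y) - φ x - φ1 x * y with hψ
  have hψc : Continuous ψ := by rw [hψ]; fun_prop
  obtain ⟨C, hC⟩ : ∃ C, ∀ y, |ψ y| ≤ C * y ^ 2 := by
    obtain ⟨δ, hδ, hh⟩ := peano2 h1 h2 one_pos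
    refine ⟨1 + |c| / 2 + (2 * B / δ ^ 2 + |φ1 x| / δ), fun y => ?_⟩
    have p1 : 0 ≤ |c| / 2 * y ^ 2 := by positivity
    have p2 : 0 ≤ (2 * B / δ ^ 2 + |φ1 x| / δ) * y ^ 2 := by positivity
    by_cases hy : |y| ≤ δ
    · have a1 := hh y hy
      have a2 : |ψ y| ≤ |φ (x + y) - φ x - φ1 x * y - c * y ^ 2 / 2| + |c * y ^ 2 / 2| := by
        have := abs_add_le (φ (x + y) - φ x - φ1 x * y - c * y ^ 2 / 2) (c * y ^ 2 / 2)
        rw [sub_add_cancel] at this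
        exact this
      have a3 : |c * y ^ 2 / 2| = |c| / 2 * y ^ 2 := by
        rw [abs_div, abs_mul, abs_of_nonneg (sq_nonneg y), abs_two]; ring
      linarith
    · push Not at hy
      have a1 : |ψ y| ≤ 2 * B + |φ1 x| * |y| := by
        have b1 := abs_sub (φ (x + y) - φ x) (φ1 x * y)
        have b2 := abs_sub (φ (x + y)) (φ x)
        rw [abs_mul] at b1
        have := hB (x + y); have := hB x
        simp only [hψ]; linarith
      have a2 : 2 * B ≤ 2 * B / δ ^ 2 * y ^ 2 := by
        rw [div_mul_eq_mul_div, le_div_iff₀ (by positivity)]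
        have : δ ^ 2 ≤ y ^ 2 := by rw [← sq_abs y]; gcongr
        gcongr
      have a3 : |φ1 x| * |y| ≤ |φ1 x| / δ * y ^ 2 := by
        rw [div_mul_eq_mul_div, le_div_iff₀ hδ, mul_assoc, ← sq_abs y, sq]
        gcongr
      have p3 : 0 ≤ y ^ 2 := by positivity
      linarith
  have hC0 : 0 ≤ C := by have := (abs_nonneg _).trans (hC 1); simpa using this
  have T1 : Tendsto (fun a : ℝ => ∫ z, ψ (a * z) / a ^ 2 * kap0 z) (𝓝[>] 0)
      (𝓝 (∫ z, c / 2 * (z ^ 2 * kap0 z))) := by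
    refine tendsto_integral_filter_of_dominated_convergence (fun z => C * wt z) ?_ ?_
      (wt_int.const_mul C) ?_
    · refine Eventually.of_forall fun a => ?_
      exact (((hψc.comp (by fun_prop)).div_const _).mul kap0_cont).aestronglyMeasurable
    · filter_upwards [self_mem_nhdsWithin] with a ha
      refine ae_of_all _ fun z => ?_
      have ha : 0 < a := ha
      rw [Real.norm_eq_abs, abs_mul, abs_div, abs_of_pos (by positivity : 0 < a ^ 2)]
      have b1 : |ψ (a * z)| / a ^ 2 ≤ C * (1 + z ^ 2) := by
        rw [div_le_iff₀ (by positivity)]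
        have := hC (a * z)
        have : 0 ≤ C * a ^ 2 := by positivity
        nlinarith
      calc _ ≤ C * (1 + z ^ 2) * |kap0 z| := by gcongr
        _ = C * ((1 + z ^ 2) * |kap0 z|) := by ring
        _ ≤ _ := mul_le_mul_of_nonneg_left (ker0.le z) hC0
    · refine ae_of_all _ fun z => ?_
      rw [← mul_assoc]
      refine Tendsto.mul_const _ ?_
      rw [Metric.tendsto_nhds]
      intro ε hε
      obtain ⟨δ, hδ, hh⟩ := peano2 h1 h2 (ε := ε / (2 * (1 + z ^ 2))) (by positivity)
      have c1 : Tendsto (fun a : ℝ => |a * z|) (𝓝[>] 0) (𝓝 0) := by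
        have : Continuous fun a : ℝ => |a * z| := by fun_prop
        have := (this.tendsto 0).mono_left (nhdsWithin_le_nhds (s := Ioi 0))
        simpa using this
      filter_upwards [self_mem_nhdsWithin, c1.eventually (gt_mem_nhds hδ)] with a ha hs
      have ha : 0 < a := ha
      have a1 := hh (a * z) hs.le
      rw [Real.dist_eq]
      have e : ψ (a * z) / a ^ 2 - c / 2 * z ^ 2 = (ψ (a * z) - c * (a * z) ^ 2 / 2) / a ^ 2 := by
        field_simp
      rw [e, abs_div, abs_of_pos (by positivity : 0 < a ^ 2), div_lt_iff₀ (by positivity)]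
      refine a1.trans_lt ?_
      rw [mul_pow, div_mul_eq_mul_div, div_lt_iff₀ (by positivity)]
      have : 0 < ε * a ^ 2 := by positivity
      nlinarith [sq_nonneg z]
  rw [integral_const_mul, kap0_second, mul_one] at T1
  have T2 : Tendsto (fun h : ℝ => √(2 * d * h)) (𝓝[>] 0) (𝓝[>] 0) := by
    refine tendsto_nhdsWithin_iff.2 ⟨?_, ?_⟩
    · have : Continuous fun h : ℝ => √(2 * d * h) := by fun_prop
      have := (this.tendsto 0).mono_left (nhdsWithin_le_nhds (s := Ioi 0))
      simpa using this
    · filter_upwards [self_mem_nhdsWithin] with h hh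
      have : 0 < h := hh
      exact Real.sqrt_pos.2 (by positivity)
  have T3 := (T1.comp T2).const_mul (2 * d)
  have e0 : 2 * d * (c / 2) = d * c := by ring
  rw [e0] at T3
  refine T3.congr' ?_
  filter_upwards [self_mem_nhdsWithin] with h hh
  have hh : 0 < h := hh
  have hs : (√(2 * d * h)) ^ 2 = 2 * d * h := Real.sq_sqrt (by positivity)
  simp only [Function.comp_apply]
  set a := √(2 * d * h) with ha
  have e1 : (fun z => ψ (a * z) / a ^ 2 * kap0 z) = fun z => (a ^ 2)⁻¹ *
      ((φ (x + a * z) * kap0 z - φ x * kap0 z) + φ1 x * a * kap1 z) := by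
    funext z; simp only [hψ, kap1]; rw [div_eq_mul_inv]; ring
  rw [e1, integral_const_mul, integral_add (f := fun z => φ (x + a * z) * kap0 z - φ x * kap0 z)
    ((ker0.int_mul hφ hB x a).sub (ker0.int.const_mul _)) (ker1.int.const_mul _), integral_sub (ker0.int_mul hφ hB x a) (ker0.int.const_mul _),
    integral_const_mul, integral_const_mul, kap1_integral, kap0_integral, hs]
  unfold Sm
  field_simp
  ring

end


section
open MeasureTheory

/-- Duhamel integral and its formal space derivatives. -/
def Duh (d Λ : ℝ) (q : ℝ → ℝ → ℝ) (t x : ℝ) : ℝ :=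
  ∫ σ in (0:ℝ)..t, Real.exp (-Λ * σ) * Sm kap0 (√(2 * d * σ)) (q (t - σ)) x
def Duh1 (d Λ : ℝ) (q : ℝ → ℝ → ℝ) (t x : ℝ) : ℝ :=
  ∫ σ in (0:ℝ)..t, Real.exp (-Λ * σ) * (-(1 / √(2 * d * σ)) * Sm kap1 (√(2 * d * σ)) (q (t - σ)) x)
def Duh2 (d Λ : ℝ) (q : ℝ → ℝ → ℝ) (t x : ℝ) : ℝ :=
  ∫ σ in (0:ℝ)..t, Real.exp (-Λ * σ) * (-(1 / √(2 * d * σ)) *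
    (-(1 / √(2 * d * σ)) * Sm kap2 (√(2 * d * σ)) (q (t - σ)) x))

/-- bounded continuous source. -/
structure Src (q : ℝ → ℝ → ℝ) (B : ℝ) : Prop where
  cont : Continuous fun r : ℝ × ℝ => q r.1 r.2
  bd : ∀ s x, |q s x| ≤ B

def Wt : ℝ := ∫ z, wt z

theorem Wt_nonneg : 0 ≤ Wt := integral_nonneg fun z => (wt_pos z).le

variable {d Λ B : ℝ} {q : ℝ → ℝ → ℝ}

theorem Src.B0 (S : Src q B) : 0 ≤ B := (abs_nonneg _).trans (S.bd 0 0)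

theorem Src.slice (S : Src q B) (s : ℝ) : Continuous (q s) :=
  S.cont.comp (by fun_prop : Continuous fun x : ℝ => (s, x))

theorem Src.sm_cont (S : Src q B) {κ : ℝ → ℝ} (h : Ker κ) :
    Continuous fun r : ℝ × ℝ × ℝ => Sm κ (√(2 * d * r.2.2)) (q (r.1 - r.2.2)) r.2.1 := by
  refine Sm_cont h (X := ℝ × ℝ × ℝ) (q := fun r y => q (r.1 - r.2.2) y) ?_
    (fun r x => S.bd _ x) (by fun_prop) (by fun_prop)
  exact S.cont.comp (by fun_prop : Continuous fun r : (ℝ × ℝ × ℝ) × ℝ => (r.1.1 - r.1.2.2, r.2))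

theorem Src.duh_cont (S : Src q B) : Continuous fun r : ℝ × ℝ => Duh d Λ q r.1 r.2 := by
  unfold Duh
  refine intervalIntegral.continuous_parametric_intervalIntegral_of_continuous
    (f := fun (r : ℝ × ℝ) σ => Real.exp (-Λ * σ) * Sm kap0 (√(2 * d * σ)) (q (r.1 - σ)) r.2)
    ?_ continuous_fst
  have h1 := (S.sm_cont (d := d) ker0).comp
    (by fun_prop : Continuous fun r : (ℝ × ℝ) × ℝ => (r.1.1, r.1.2, r.2))
  have h2 : Continuous fun r : (ℝ × ℝ) × ℝ => Real.exp (-Λ * r.2) := by fun_prop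
  exact h2.mul h1

theorem Src.sm_cont_sigma (S : Src q B) {κ : ℝ → ℝ} (h : Ker κ) (t x : ℝ) :
    Continuous fun σ : ℝ => Sm κ (√(2 * d * σ)) (q (t - σ)) x :=
  (S.sm_cont (d := d) h).comp (by fun_prop : Continuous fun σ : ℝ => (t, x, σ))

theorem Src.meas (S : Src q B) {κ : ℝ → ℝ} (h : Ker κ) (t x : ℝ) (r : ℝ → ℝ) (hr : Measurable r) :
    Measurable fun σ : ℝ => Real.exp (-Λ * σ) * (r σ * Sm κ (√(2 * d * σ)) (q (t - σ)) x) := by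
  have := (S.sm_cont_sigma (d := d) h t x).measurable
  have h2 : Measurable fun σ : ℝ => Real.exp (-Λ * σ) := by fun_prop
  exact h2.mul (hr.mul this)

theorem inv_sqrt_eq (hd : 0 < d) {σ : ℝ} (hσ : 0 < σ) :
    1 / √(2 * d * σ) = (√(2 * d))⁻¹ * σ ^ (-(1 / 2) : ℝ) := by
  rw [Real.sqrt_mul (by positivity), one_div, mul_inv, Real.rpow_neg hσ.le, ← Real.sqrt_eq_rpow]

/-- integrable bound for first derivative -/
def bd1 (d Λ B σ : ℝ) : ℝ :=
  (√(2 * d))⁻¹ * (B * Wt) * (σ ^ (-(1 / 2) : ℝ) * Real.exp (-Λ * σ))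

theorem bd1_int (hΛ : 0 < Λ) : IntegrableOn (bd1 d Λ B) (Ioi 0) := by
  have h := integrableOn_rpow_mul_exp_neg_mul_rpow (s := -(1 / 2)) (p := 1) (b := Λ) (by norm_num)
    one_pos hΛ
  simp only [Real.rpow_one] at h
  exact h.const_mul _

theorem bd1_ii (hΛ : 0 < Λ) {t : ℝ} (ht : 0 ≤ t) : IntervalIntegrable (bd1 d Λ B) volume 0 t := by
  rw [intervalIntegrable_iff, uIoc_of_le ht]
  exact (bd1_int hΛ).mono_set Ioc_subset_Ioi_self

theorem Src.le1 (S : Src q B) (hd : 0 < d) {t x σ : ℝ} (hσ : 0 < σ) :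
    ‖Real.exp (-Λ * σ) * (-(1 / √(2 * d * σ)) * Sm kap1 (√(2 * d * σ)) (q (t - σ)) x)‖ ≤
      bd1 d Λ B σ := by
  have h1 := Sm_bound ker1 (S.bd (t - σ)) (√(2 * d * σ)) x
  have hp : 0 < σ ^ (-(1 / 2) : ℝ) := Real.rpow_pos_of_pos hσ _
  rw [inv_sqrt_eq hd hσ, Real.norm_eq_abs, abs_mul, abs_mul, Real.abs_exp, abs_neg, abs_mul,
    abs_of_pos hp, abs_of_nonneg (by positivity : 0 ≤ (√(2 * d))⁻¹)]
  calc _ ≤ Real.exp (-Λ * σ) * ((√(2 * d))⁻¹ * σ ^ (-(1 / 2) : ℝ) * (B * Wt)) := by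
        gcongr; exact h1
    _ = _ := by unfold bd1; ring

theorem Src.duh_deriv (S : Src q B) (hd : 0 < d) (hΛ : 0 < Λ) {t : ℝ} (ht : 0 < t) (x : ℝ) :
    HasDerivAt (Duh d Λ q t) (Duh1 d Λ q t x) x := by
  refine (intervalIntegral.hasDerivAt_integral_of_dominated_loc_of_deriv_le (s := univ)
    (F := fun x σ => Real.exp (-Λ * σ) * Sm kap0 (√(2 * d * σ)) (q (t - σ)) x)
    (F' := fun x σ => Real.exp (-Λ * σ) *
      (-(1 / √(2 * d * σ)) * Sm kap1 (√(2 * d * σ)) (q (t - σ)) x))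
    (bound := bd1 d Λ B) univ_mem ?_ ?_ ?_ ?_ (bd1_ii hΛ ht.le) ?_).2
  · refine Eventually.of_forall fun y => ?_
    have := S.sm_cont_sigma (d := d) ker0 t y
    exact (by fun_prop : Continuous fun σ => Real.exp (-Λ * σ) *
      Sm kap0 (√(2 * d * σ)) (q (t - σ)) y).aestronglyMeasurable
  · have := S.sm_cont_sigma (d := d) ker0 t x
    exact (by fun_prop : Continuous fun σ => Real.exp (-Λ * σ) *
      Sm kap0 (√(2 * d * σ)) (q (t - σ)) x).intervalIntegrable _ _
  · exact (S.meas ker1 t x _ (by fun_prop)).aestronglyMeasurable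
  · refine ae_of_all _ fun σ hσ y _ => ?_
    rw [uIoc_of_le ht.le] at hσ
    exact S.le1 hd hσ.1
  · refine ae_of_all _ fun σ hσ y _ => ?_
    rw [uIoc_of_le ht.le] at hσ
    have : 0 < √(2 * d * σ) := Real.sqrt_pos.2 (by have := hσ.1; positivity)
    exact (Sm_deriv ker0 ker1 kap0_deriv (S.slice _) (S.bd _) this y).const_mul _

theorem Src.duh1_bound (S : Src q B) (hd : 0 < d) (hΛ : 0 < Λ) {t : ℝ} (ht : 0 < t) (x : ℝ) :
    |Duh1 d Λ q t x| ≤ ∫ σ in Ioi 0, bd1 d Λ B σ := by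
  unfold Duh1
  rw [intervalIntegral.integral_of_le ht.le]
  have h1 := norm_integral_le_of_norm_le (μ := volume.restrict (Ioc 0 t))
    (f := fun σ => Real.exp (-Λ * σ) *
      (-(1 / √(2 * d * σ)) * Sm kap1 (√(2 * d * σ)) (q (t - σ)) x)) (g := bd1 d Λ B)
    ((bd1_int hΛ).mono_set Ioc_subset_Ioi_self)
    ((ae_restrict_iff' measurableSet_Ioc).2 (ae_of_all _ fun σ hσ => S.le1 hd hσ.1))
  refine h1.trans (setIntegral_mono_set (bd1_int hΛ) ?_ (ae_of_all _ Ioc_subset_Ioi_self))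
  refine (ae_restrict_iff' measurableSet_Ioi).2 (ae_of_all _ fun σ hσ => ?_)
  have hσ : 0 < σ := hσ
  have := S.B0
  have := Wt_nonneg
  simp only [Pi.zero_apply, bd1]
  have := Real.rpow_pos_of_pos hσ (-(1 / 2) : ℝ)
  positivity

/-- uniform Lipschitz continuity in space of the Duhamel integral. -/
theorem Src.duh_lip (S : Src q B) (hd : 0 < d) (hΛ : 0 < Λ) :
    ∃ M, ∀ t, 0 ≤ t → ∀ x y, |Duh d Λ q t x - Duh d Λ q t y| ≤ M * |x - y| := by
  refine ⟨∫ σ in Ioi 0, bd1 d Λ B σ, fun t ht x y => ?_⟩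
  rcases ht.eq_or_lt with rfl | ht
  · have h0 := setIntegral_nonneg (μ := volume) (s := Ioi (0:ℝ)) (f := bd1 d Λ B) measurableSet_Ioi
      (fun σ hσ => by
        have hσ : 0 < σ := hσ
        have := S.B0
        have := Wt_nonneg
        have := Real.rpow_pos_of_pos hσ (-(1 / 2) : ℝ)
        simp only [bd1]
        positivity)
    have : Duh d Λ q 0 x - Duh d Λ q 0 y = 0 := by simp [Duh]
    rw [this, abs_zero]
    positivity
  · have := Convex.norm_image_sub_le_of_norm_hasDerivWithin_le (s := univ) (x := y) (y := x)
      (fun z _ => (S.duh_deriv (Λ := Λ) hd hΛ ht z).hasDerivWithinAt)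
      (fun z _ => S.duh1_bound hd hΛ ht z) convex_univ (mem_univ _) (mem_univ _)
    simpa only [Real.norm_eq_abs] using this

/-! second derivative -/

theorem Sm2_holder {φ : ℝ → ℝ} (hφ : Continuous φ) {C α : ℝ} (hC : 0 ≤ C) (hα : 0 < α)
    (hα1 : α < 1) (hB : ∀ x, |φ x| ≤ B) (hh : ∀ x y, |φ x - φ y| ≤ C * |x - y| ^ α)
    {a : ℝ} (ha : 0 < a) (x : ℝ) : |Sm kap2 a φ x| ≤ C * a ^ α * Wt := by
  have e : Sm kap2 a φ x = ∫ z, (φ (x + a * z) - φ x) * kap2 z := by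
    simp only [sub_mul]
    rw [integral_sub (ker2.int_mul hφ hB x a) (ker2.int.const_mul _), integral_const_mul,
      kap2_integral, mul_zero, sub_zero]
    rfl
  rw [e]
  unfold Wt
  rw [← integral_const_mul]
  refine norm_integral_le_of_norm_le (f := fun z => (φ (x + a * z) - φ x) * kap2 z)
    (wt_int.const_mul _) (ae_of_all _ fun z => ?_)
  rw [Real.norm_eq_abs, abs_mul]
  have h1 := hh (x + a * z) x
  rw [add_sub_cancel_left, abs_mul, abs_of_pos ha, Real.mul_rpow ha.le (abs_nonneg _)] at h1
  have h2 : |z| ^ α ≤ 1 + z ^ 2 := by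
    rcases le_total |z| 1 with hz | hz
    · have := Real.rpow_le_one (abs_nonneg z) hz hα.le
      nlinarith [sq_nonneg z]
    · have := Real.rpow_le_rpow_of_exponent_le hz (by linarith : α ≤ 2)
      rw [Real.rpow_two, sq_abs] at this
      linarith
  have hp : 0 ≤ C * a ^ α := by positivity
  calc _ ≤ (C * (a ^ α * (1 + z ^ 2))) * |kap2 z| := by
        gcongr
        refine h1.trans ?_
        gcongr
    _ = C * a ^ α * ((1 + z ^ 2) * |kap2 z|) := by ring
    _ ≤ _ := mul_le_mul_of_nonneg_left (kap2_le z) hp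

def bd2 (d C α σ : ℝ) : ℝ := C * Wt * (2 * d) ^ (α / 2 - 1) * σ ^ (α / 2 - 1)

theorem bd2_ii {C α : ℝ} (hα : 0 < α) (a b : ℝ) : IntervalIntegrable (bd2 d C α) volume a b :=
  (intervalIntegral.intervalIntegrable_rpow' (by linarith)).const_mul _

/-- Hölder in space -/
structure HSrc (q : ℝ → ℝ → ℝ) (B C α : ℝ) : Prop extends Src q B where
  C0 : 0 ≤ C
  α0 : 0 < α
  α1 : α < 1
  hol : ∀ s x y, |q s x - q s y| ≤ C * |x - y| ^ α

variable {C α : ℝ}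

theorem HSrc.le2 (S : HSrc q B C α) (hd : 0 < d) (hΛ : 0 < Λ) {t x σ : ℝ} (hσ : 0 < σ) :
    ‖Real.exp (-Λ * σ) * (-(1 / √(2 * d * σ)) *
    (-(1 / √(2 * d * σ)) * Sm kap2 (√(2 * d * σ)) (q (t - σ)) x))‖ ≤ bd2 d C α σ := by
  have ha : 0 < √(2 * d * σ) := Real.sqrt_pos.2 (by positivity)
  have h1 := Sm2_holder (S.slice (t - σ)) S.C0 S.α0 S.α1 (S.bd _) (S.hol _) ha x
  have e1 : Real.exp (-Λ * σ) ≤ 1 := Real.exp_le_one_iff.2 (by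
    have : 0 < Λ * σ := by positivity
    linarith)
  have hs : √(2 * d * σ) ^ 2 = 2 * d * σ := Real.sq_sqrt (by positivity)
  have e2 : -(1 / √(2 * d * σ)) * (-(1 / √(2 * d * σ)) * Sm kap2 (√(2 * d * σ)) (q (t - σ)) x)
      = (2 * d * σ)⁻¹ * Sm kap2 (√(2 * d * σ)) (q (t - σ)) x := by
    rw [← hs]; field_simp
    rw [Real.sqrt_sq ha.le]
  rw [e2, Real.norm_eq_abs, abs_mul, abs_mul, Real.abs_exp,
    abs_of_pos (by positivity : 0 < (2 * d * σ)⁻¹)]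
  have e3 : √(2 * d * σ) ^ α = (2 * d * σ) ^ (α / 2) := by
    rw [Real.sqrt_eq_rpow, ← Real.rpow_mul (by positivity)]
    congr 1; ring
  rw [e3] at h1
  calc _ ≤ 1 * ((2 * d * σ)⁻¹ * (C * (2 * d * σ) ^ (α / 2) * Wt)) := by
        gcongr
    _ = C * Wt * (2 * d * σ) ^ (α / 2 - 1) := by
        rw [Real.rpow_sub_one (by positivity)]; ring
    _ = _ := by
        rw [Real.mul_rpow (by positivity) hσ.le]; unfold bd2; ring

theorem HSrc.duh1_deriv (S : HSrc q B C α) (hd : 0 < d) (hΛ : 0 < Λ) {t : ℝ} (ht : 0 < t) (x : ℝ) :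
    HasDerivAt (Duh1 d Λ q t) (Duh2 d Λ q t x) x := by
  refine (intervalIntegral.hasDerivAt_integral_of_dominated_loc_of_deriv_le (s := univ)
    (F := fun x σ => Real.exp (-Λ * σ) *
      (-(1 / √(2 * d * σ)) * Sm kap1 (√(2 * d * σ)) (q (t - σ)) x))
    (F' := fun x σ => Real.exp (-Λ * σ) * (-(1 / √(2 * d * σ)) *
      (-(1 / √(2 * d * σ)) * Sm kap2 (√(2 * d * σ)) (q (t - σ)) x)))
    (bound := bd2 d C α) univ_mem ?_ ?_ ?_ ?_ (bd2_ii S.α0 _ _) ?_).2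
  · refine Eventually.of_forall fun y => ?_
    exact (S.meas ker1 t y _ (by fun_prop)).aestronglyMeasurable
  · rw [intervalIntegrable_iff]
    refine Integrable.mono' (intervalIntegrable_iff.1 (bd1_ii (d := d) (B := B) hΛ ht.le))
      (S.meas ker1 t x _ (by fun_prop)).aestronglyMeasurable
      ((ae_restrict_iff' measurableSet_uIoc).2 (ae_of_all _ fun σ hσ => ?_))
    rw [uIoc_of_le ht.le] at hσ
    exact S.le1 hd hσ.1
  · have := S.meas (d := d) (Λ := Λ) ker2 t x
      (fun σ => -(1 / √(2 * d * σ)) * -(1 / √(2 * d * σ))) (by fun_prop)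
    simp only [mul_assoc] at this ⊢
    exact this.aestronglyMeasurable
  · refine ae_of_all _ fun σ hσ y _ => ?_
    rw [uIoc_of_le ht.le] at hσ
    exact S.le2 hd hΛ hσ.1
  · refine ae_of_all _ fun σ hσ y _ => ?_
    rw [uIoc_of_le ht.le] at hσ
    have : 0 < √(2 * d * σ) := Real.sqrt_pos.2 (by have := hσ.1; positivity)
    exact ((Sm_deriv ker1 ker2 kap1_deriv (S.slice _) (S.bd _) this y).const_mul _).const_mul _

theorem HSrc.duh2_cont (S : HSrc q B C α) (hd : 0 < d) (hΛ : 0 < Λ) {t : ℝ} (ht : 0 < t) (x : ℝ) :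
    ContinuousAt (fun t => Duh2 d Λ q t x) t := by
  set G : ℝ → ℝ → ℝ := fun t σ => Real.exp (-Λ * σ) * (-(1 / √(2 * d * σ)) *
      (-(1 / √(2 * d * σ)) * Sm kap2 (√(2 * d * σ)) (q (t - σ)) x)) with hG
  have e : (fun t => Duh2 d Λ q t x) =ᶠ[𝓝 t]
      fun s => ∫ σ in (0:ℝ)..(t + 1), (Iic s).indicator (G s) σ := by
    filter_upwards [lt_mem_nhds ht, gt_mem_nhds (by linarith : t < t + 1)] with s hs hs1
    rw [intervalIntegral.integral_of_le (by linarith), setIntegral_indicator measurableSet_Iic,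
      Ioc_inter_Iic, min_eq_right hs1.le]
    unfold Duh2
    rw [intervalIntegral.integral_of_le hs.le]
  refine ContinuousAt.congr ?_ e.symm
  refine intervalIntegral.continuousAt_of_dominated_interval (bound := bd2 d C α) ?_ ?_
    (bd2_ii S.α0 _ _) ?_
  · refine Eventually.of_forall fun s => ?_
    have := S.meas (d := d) (Λ := Λ) ker2 s x
      (fun σ => -(1 / √(2 * d * σ)) * -(1 / √(2 * d * σ))) (by fun_prop)
    have e2 : G s = fun σ => Real.exp (-Λ * σ) * (-(1 / √(2 * d * σ)) * -(1 / √(2 * d * σ)) *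
        Sm kap2 (√(2 * d * σ)) (q (s - σ)) x) := by
      funext σ; simp only [hG]; ring
    rw [← e2] at this
    exact (this.indicator measurableSet_Iic).aestronglyMeasurable
  · refine Eventually.of_forall fun s => ae_of_all _ fun σ hσ => ?_
    rw [uIoc_of_le (by linarith)] at hσ
    refine le_trans (norm_indicator_le_norm_self _ _) (S.le2 hd hΛ hσ.1)
  · have hne : ∀ᵐ σ ∂(volume : Measure ℝ), σ ≠ t := by
      simp [ae_iff, measure_singleton]
    filter_upwards [hne] with σ hσ _
    have c1 : Continuous fun s => G s σ := by
      have := (S.sm_cont (d := d) ker2).comp (by fun_prop : Continuous fun s : ℝ => (s, x, σ))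
      exact continuous_const.mul (continuous_const.mul (continuous_const.mul this))
    rcases lt_or_gt_of_ne hσ with h | h
    · refine c1.continuousAt.congr ?_
      filter_upwards [lt_mem_nhds h] with s hs
      rw [indicator_of_mem (show σ ∈ Iic s from hs.le)]
    · refine (continuousAt_const (y := (0:ℝ))).congr ?_
      filter_upwards [gt_mem_nhds h] with s hs
      rw [indicator_of_notMem (show σ ∉ Iic s from not_le.2 hs)]

end


section
open MeasureTheory

variable {d Λ B C α : ℝ} {q : ℝ → ℝ → ℝ}

theorem Sm_zero (φ : ℝ → ℝ) (x : ℝ) : Sm kap0 0 φ x = φ x := by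
  unfold Sm
  simp only [zero_mul, add_zero]
  rw [integral_const_mul, kap0_integral, mul_one]

theorem Src.duh_bound (S : Src q B) (hΛ : 0 < Λ) {t : ℝ} (ht : 0 ≤ t) (x : ℝ) :
    |Duh d Λ q t x| ≤ B * Wt * t := by
  unfold Duh
  have := intervalIntegral.norm_integral_le_of_norm_le_const (a := 0) (b := t) (C := B * Wt)
    (f := fun σ => Real.exp (-Λ * σ) * Sm kap0 (√(2 * d * σ)) (q (t - σ)) x) (fun σ hσ => by
      rw [uIoc_of_le ht] at hσ
      have h1 := Sm_bound ker0 (S.bd (t - σ)) (√(2 * d * σ)) x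
      have h2 : Real.exp (-Λ * σ) ≤ 1 := Real.exp_le_one_iff.2 (by
        have := hσ.1
        have : 0 < Λ * σ := by positivity
        linarith)
      rw [Real.norm_eq_abs, abs_mul, Real.abs_exp]
      calc _ ≤ 1 * (B * Wt) := by gcongr; exact h1
        _ = _ := one_mul _)
  rwa [sub_zero, abs_of_nonneg ht, Real.norm_eq_abs] at this

theorem Src.duh_semigroup (S : Src q B) (hd : 0 < d) {t h : ℝ} (ht : 0 ≤ t) (hh : 0 ≤ h) (x : ℝ) :
    Duh d Λ q (t + h) x = Real.exp (-Λ * h) * Sm kap0 (√(2 * d * h)) (Duh d Λ q t) x +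
      ∫ σ in (0:ℝ)..h, Real.exp (-Λ * σ) * Sm kap0 (√(2 * d * σ)) (q (t + h - σ)) x := by
  set F : ℝ → ℝ := fun σ => Real.exp (-Λ * σ) * Sm kap0 (√(2 * d * σ)) (q (t + h - σ)) x with hF
  have hFc : Continuous F := by
    have := S.sm_cont_sigma (d := d) ker0 (t + h) x
    rw [hF]; fun_prop
  have e1 : Duh d Λ q (t + h) x = ∫ σ in (0:ℝ)..(t + h), F σ := rfl
  rw [e1, ← intervalIntegral.integral_add_adjacent_intervals (hFc.intervalIntegrable 0 h)
    (hFc.intervalIntegrable h (t + h)), add_comm]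
  congr 1
  have e2 := intervalIntegral.integral_comp_add_right (a := 0) (b := t) F h
  rw [zero_add] at e2
  rw [← e2]
  have e3 : ∀ σ ∈ Ioc 0 t, F (σ + h) = Real.exp (-Λ * h) * ∫ z, Real.exp (-Λ * σ) *
      Sm kap0 (√(2 * d * σ)) (q (t - σ)) (x + √(2 * d * h) * z) * kap0 z := by
    intro σ hσ
    have h1 := Sm_semigroup (a := √(2 * d * h)) (b := √(2 * d * σ)) (S.slice (t - σ))
      (S.bd _) x
    have hσ0 := hσ.1
    rw [Real.sq_sqrt (by positivity), Real.sq_sqrt (by positivity), ← mul_add, add_comm h σ] at h1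
    simp only [hF]
    rw [show t + h - (σ + h) = t - σ by ring, h1, mul_add, Real.exp_add]
    unfold Sm
    simp only [mul_assoc, integral_const_mul]
    ring
  rw [intervalIntegral.integral_of_le ht, setIntegral_congr_fun measurableSet_Ioc e3,
    integral_const_mul, integral_integral_swap]
  · congr 1
    unfold Sm
    congr 1
    funext z
    unfold Duh
    rw [integral_mul_const, intervalIntegral.integral_of_le ht]
    rfl
  · have i1 : Integrable (fun σ => Real.exp (-Λ * σ) * (B * Wt)) (volume.restrict (Ioc 0 t)) := by
      have : Continuous fun σ => Real.exp (-Λ * σ) * (B * Wt) := by fun_prop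
      exact (this.integrableOn_Icc).mono_set Ioc_subset_Icc_self
    refine (i1.mul_prod wt_int).mono' ?_ (ae_of_all _ fun r => ?_)
    · have := (S.sm_cont (d := d) ker0).comp
        (by fun_prop : Continuous fun r : ℝ × ℝ => (t, x + √(2 * d * h) * r.2, r.1))
      have c2 : Continuous fun r : ℝ × ℝ => Real.exp (-Λ * r.1) := by fun_prop
      exact ((c2.mul this).mul (kap0_cont.comp continuous_snd)).aestronglyMeasurable
    · simp only [Function.uncurry]
      rw [Real.norm_eq_abs, abs_mul, abs_mul, Real.abs_exp]
      have h1 := Sm_bound ker0 (S.bd (t - r.1)) (√(2 * d * r.1)) (x + √(2 * d * h) * r.2)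
      have h2 := ker0.le_wt r.2
      have := S.B0
      have := Wt_nonneg
      gcongr
      exact h1

/-- derivative of `h ↦ ∫₀ʰ J(h,σ)dσ` at zero -/
theorem deriv_moving {J : ℝ → ℝ → ℝ} (hJ : Continuous fun r : ℝ × ℝ => J r.1 r.2) :
    HasDerivWithinAt (fun h => ∫ σ in (0:ℝ)..h, J h σ) (J 0 0) (Ici 0) 0 := by
  rw [hasDerivWithinAt_iff_isLittleO, Asymptotics.isLittleO_iff]
  intro ε hε
  obtain ⟨δ, hδ, h1⟩ := Metric.continuous_iff.1 hJ (0, 0) ε hε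
  filter_upwards [self_mem_nhdsWithin, mem_nhdsWithin_of_mem_nhds (Metric.ball_mem_nhds 0 hδ)]
    with h hh hb
  have hh : 0 ≤ h := hh
  rw [Metric.mem_ball, Real.dist_eq, sub_zero, abs_of_nonneg hh] at hb
  have hc : Continuous (J h) := hJ.comp (by fun_prop : Continuous fun σ : ℝ => (h, σ))
  have e : (∫ σ in (0:ℝ)..h, J h σ) - (∫ σ in (0:ℝ)..0, J 0 σ) - (h - 0) • J 0 0 =
      ∫ σ in (0:ℝ)..h, (J h σ - J 0 0) := by
    rw [intervalIntegral.integral_sub (hc.intervalIntegrable _ _)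
      (continuous_const.intervalIntegrable _ _)]
    simp
  rw [e]
  have := intervalIntegral.norm_integral_le_of_norm_le_const (a := 0) (b := h) (C := ε)
    (f := fun σ => J h σ - J 0 0) (fun σ hσ => by
      rw [uIoc_of_le hh] at hσ
      have := h1 (h, σ) (by
        rw [Prod.dist_eq, max_lt_iff]
        simp only [Real.dist_eq, sub_zero, abs_of_nonneg hh, abs_of_pos hσ.1]
        exact ⟨hb, hσ.2.trans_lt hb⟩)
      rw [Real.dist_eq] at this
      exact this.le)
  exact this

theorem HSrc.right_deriv (S : HSrc q B C α) (hd : 0 < d) (hΛ : 0 < Λ) {t : ℝ} (ht : 0 < t) (x : ℝ) :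
    HasDerivWithinAt (fun s => Duh d Λ q s x)
      (d * Duh2 d Λ q t x - Λ * Duh d Λ q t x + q t x) (Ioi t) t := by
  have g1 := gauss_gen hd (fun y => S.duh_bound (d := d) hΛ ht.le y)
    (S.duh_deriv hd hΛ ht) (S.duh1_deriv hd hΛ ht x)
  have k1 : HasDerivWithinAt (fun h => Sm kap0 (√(2 * d * h)) (Duh d Λ q t) x)
      (d * Duh2 d Λ q t x) (Ioi 0) 0 := by
    rw [hasDerivWithinAt_iff_tendsto_slope' (by simp)]
    refine g1.congr fun h => ?_
    simp only [slope, vsub_eq_sub, sub_zero, smul_eq_mul, mul_zero, Real.sqrt_zero, Sm_zero]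
    rw [div_eq_inv_mul]
  have k2 : HasDerivWithinAt (fun h : ℝ => Real.exp (-Λ * h)) (-Λ) (Ioi 0) 0 := by
    have := ((hasDerivAt_id' (0:ℝ)).const_mul (-Λ)).exp
    simp only [mul_zero, Real.exp_zero, mul_one, one_mul] at this
    exact this.hasDerivWithinAt
  have k3 := k2.fun_mul k1
  simp only [mul_zero, Real.sqrt_zero, Sm_zero, Real.exp_zero, one_mul] at k3
  have k4 := (deriv_moving (J := fun h σ => Real.exp (-Λ * σ) *
      Sm kap0 (√(2 * d * σ)) (q (t + h - σ)) x) (by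
    have := (S.sm_cont (d := d) ker0).comp
      (by fun_prop : Continuous fun r : ℝ × ℝ => (t + r.1, x, r.2))
    have c2 : Continuous fun r : ℝ × ℝ => Real.exp (-Λ * r.2) := by fun_prop
    exact c2.mul this)).mono (Ioi_subset_Ici_self : Ioi (0:ℝ) ⊆ Ici 0)
  simp only [mul_zero, Real.sqrt_zero, Sm_zero, Real.exp_zero, one_mul, add_zero, sub_zero] at k4
  have k5 := k3.fun_add k4
  have k6 : HasDerivWithinAt (fun h => Duh d Λ q (t + h) x)
      (d * Duh2 d Λ q t x - Λ * Duh d Λ q t x + q t x) (Ioi 0) 0 := by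
    refine (k5.congr (fun h hh => ?_) ?_).congr_deriv (by ring)
    · exact S.duh_semigroup hd ht.le (le_of_lt hh) x
    · have := S.duh_semigroup (Λ := Λ) hd ht.le (le_refl 0) x
      simpa using this
  have k7 : HasDerivWithinAt (fun s : ℝ => s - t) 1 (Ioi t) t :=
    ((hasDerivAt_id' t).sub_const t).hasDerivWithinAt
  have k8 := HasDerivWithinAt.comp (h₂ := fun h => Duh d Λ q (t + h) x) (h := fun s : ℝ => s - t)
    (s' := Ioi 0) t (by rw [sub_self]; exact k6) k7 (fun s hs => by
      have : t < s := hs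
      exact (sub_pos.2 this : 0 < s - t))
  rw [mul_one] at k8
  refine k8.congr (fun s _ => ?_) ?_ <;> simp

theorem HSrc.time_deriv (S : HSrc q B C α) (hd : 0 < d) (hΛ : 0 < Λ) {t : ℝ} (ht : 0 < t) (x : ℝ) :
    HasDerivAt (fun s => Duh d Λ q s x)
      (d * Duh2 d Λ q t x - Λ * Duh d Λ q t x + q t x) t := by
  set g' : ℝ → ℝ := fun t => d * Duh2 d Λ q t x - Λ * Duh d Λ q t x + q t x with hg'
  have hV : Continuous fun s => Duh d Λ q s x :=
    S.duh_cont.comp (by fun_prop : Continuous fun s : ℝ => (s, x))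
  have hq : Continuous fun s => q s x := S.cont.comp (by fun_prop : Continuous fun s : ℝ => (s, x))
  have hc : ∀ s, 0 < s → ContinuousAt g' s := fun s hs =>
    (((S.duh2_cont hd hΛ hs x).const_mul d).sub (hV.continuousAt.const_mul Λ)).add hq.continuousAt
  have hco : ContinuousOn g' (Ioi 0) := fun s hs => (hc s hs).continuousWithinAt
  have hii : ∀ s, t / 2 ≤ s → IntervalIntegrable g' volume (t / 2) s := by
    intro s hs
    refine ContinuousOn.intervalIntegrable (hco.mono fun r hr => ?_)
    rw [uIcc_of_le hs] at hr
    have := hr.1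
    exact (by linarith : 0 < r)
  have key : ∀ s, t / 2 ≤ s → Duh d Λ q s x = Duh d Λ q (t / 2) x + ∫ r in (t/2)..s, g' r := by
    intro s hs
    rw [intervalIntegral.integral_eq_sub_of_hasDeriv_right_of_le hs hV.continuousOn
      (fun r hr => S.right_deriv hd hΛ (by have := hr.1; linarith) x) (hii s hs)]
    ring
  have h1 : HasDerivAt (fun s => ∫ r in (t/2)..s, g' r) (g' t) t :=
    intervalIntegral.integral_hasDerivAt_right (hii t (by linarith))
      (hco.stronglyMeasurableAtFilter isOpen_Ioi t ht) (hc t ht)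
  refine (h1.const_add (Duh d Λ q (t / 2) x)).congr_of_eventuallyEq ?_
  filter_upwards [lt_mem_nhds (by linarith : t / 2 < t)] with s hs
  exact key s hs.le

end


section
open MeasureTheory

variable {d Λ B C α K R δ : ℝ} {q : ℝ → ℝ → ℝ} {f : ℝ → ℝ → ℝ → ℝ}

theorem Sm0_le {φ : ℝ → ℝ} (hφ : Continuous φ) {m B : ℝ} (hm : ∀ x, 0 ≤ φ x) (hB : ∀ x, φ x ≤ B)
    (a x : ℝ) : 0 ≤ Sm kap0 a φ x ∧ Sm kap0 a φ x ≤ B := by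
  constructor
  · exact integral_nonneg fun z => mul_nonneg (hm _) (kap0_pos z).le
  · have h1 := integral_mono (ker0.int_mul hφ (B := B) (fun y => by
      rw [abs_of_nonneg (hm y)]; exact hB y) x a) (ker0.int.const_mul B)
      (fun z => mul_le_mul_of_nonneg_right (hB (x + a * z)) (kap0_pos z).le)
    rw [integral_const_mul, kap0_integral, mul_one] at h1
    exact h1

theorem int_exp (hΛ : 0 < Λ) (t : ℝ) :
    ∫ σ in (0:ℝ)..t, Real.exp (-Λ * σ) = (1 - Real.exp (-Λ * t)) / Λ := by
  have h : ∀ s ∈ uIcc 0 t, HasDerivAt (fun s => -(Real.exp (-Λ * s) / Λ)) (Real.exp (-Λ * s)) s := by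
    intro s _
    have := ((((hasDerivAt_id' s).const_mul (-Λ)).exp).div_const Λ).fun_neg
    refine this.congr_deriv ?_
    field_simp
  rw [intervalIntegral.integral_eq_sub_of_hasDerivAt h
    ((by fun_prop : Continuous fun s => Real.exp (-Λ * s)).intervalIntegrable _ _)]
  simp
  ring

theorem duh_between (hc : Continuous fun r : ℝ × ℝ => q r.1 r.2) (h0 : ∀ s x, 0 ≤ q s x)
    (hB : ∀ s x, q s x ≤ B) (hΛ : 0 < Λ) {t : ℝ} (ht : 0 ≤ t) (x : ℝ) :
    0 ≤ Duh d Λ q t x ∧ Duh d Λ q t x ≤ B * ((1 - Real.exp (-Λ * t)) / Λ) := by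
  have S : Src q B := ⟨hc, fun s x => by rw [abs_of_nonneg (h0 s x)]; exact hB s x⟩
  have hF : Continuous fun σ => Real.exp (-Λ * σ) * Sm kap0 (√(2 * d * σ)) (q (t - σ)) x := by
    have := S.sm_cont_sigma (d := d) ker0 t x
    fun_prop
  constructor
  · refine intervalIntegral.integral_nonneg ht fun σ _ => ?_
    exact mul_nonneg (Real.exp_pos _).le (Sm0_le (m := 0) (S.slice _) (h0 _) (hB _) _ _).1
  · rw [← int_exp hΛ, ← intervalIntegral.integral_const_mul]
    refine intervalIntegral.integral_mono_on ht (hF.intervalIntegrable _ _)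
      ((by fun_prop : Continuous fun s => B * Real.exp (-Λ * s)).intervalIntegrable _ _)
      (fun σ _ => ?_)
    rw [mul_comm B]
    exact mul_le_mul_of_nonneg_left (Sm0_le (m := 0) (S.slice _) (h0 _) (hB _) _ _).2
      (Real.exp_pos _).le

theorem Sm0_abs {φ : ℝ → ℝ} {B : ℝ} (hB : ∀ x, |φ x| ≤ B)
    (a x : ℝ) : |Sm kap0 a φ x| ≤ B := by
  have := norm_integral_le_of_norm_le (f := fun z => φ (x + a * z) * kap0 z)
    (ker0.int.const_mul B) (ae_of_all _ fun z => by
      rw [Real.norm_eq_abs, abs_mul, abs_of_pos (kap0_pos z)]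
      exact mul_le_mul_of_nonneg_right (hB _) (kap0_pos z).le)
  rw [integral_const_mul, kap0_integral, mul_one] at this
  exact this

theorem Src.duh_abs (S : Src q B) (hΛ : 0 < Λ) {t : ℝ} (ht : 0 ≤ t) (x : ℝ) :
    |Duh d Λ q t x| ≤ B / Λ := by
  have h1 := intervalIntegral.norm_integral_le_of_norm_le (μ := volume) ht
    (f := fun σ => Real.exp (-Λ * σ) * Sm kap0 (√(2 * d * σ)) (q (t - σ)) x)
    (g := fun σ => B * Real.exp (-Λ * σ))
    (ae_of_all _ fun σ _ => by
      rw [Real.norm_eq_abs, abs_mul, Real.abs_exp, mul_comm]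
      exact mul_le_mul_of_nonneg_right (Sm0_abs (S.bd _) _ _) (Real.exp_pos _).le)
    ((by fun_prop : Continuous fun s => B * Real.exp (-Λ * s)).intervalIntegrable _ _)
  rw [intervalIntegral.integral_const_mul, int_exp hΛ] at h1
  refine h1.trans ?_
  rw [← mul_div_assoc]
  have := Real.exp_pos (-Λ * t)
  have := S.B0
  gcongr
  nlinarith

theorem duh_sub {q' : ℝ → ℝ → ℝ} {B' : ℝ} (S : Src q B) (S' : Src q' B') (t x : ℝ) :
    Duh d Λ q t x - Duh d Λ q' t x = Duh d Λ (fun s y => q s y - q' s y) t x := by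
  unfold Duh
  have h1 := S.sm_cont_sigma (d := d) ker0 t x
  have h2 := S'.sm_cont_sigma (d := d) ker0 t x
  rw [← intervalIntegral.integral_sub]
  · congr 1
    funext σ
    unfold Sm
    simp only [sub_mul]
    rw [integral_sub (ker0.int_mul (S.slice _) (S.bd _) _ _)
      (ker0.int_mul (S'.slice _) (S'.bd _) _ _), mul_sub]
  · exact (by fun_prop : Continuous fun σ => Real.exp (-Λ * σ) *
      Sm kap0 (√(2 * d * σ)) (q (t - σ)) x).intervalIntegrable _ _
  · exact (by fun_prop : Continuous fun σ => Real.exp (-Λ * σ) *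
      Sm kap0 (√(2 * d * σ)) (q' (t - σ)) x).intervalIntegrable _ _

/-- assumptions on the reaction used for existence -/
structure Rx (d K R C α : ℝ) (f : ℝ → ℝ → ℝ → ℝ) : Prop where
  hd : 0 < d
  hK : 0 < K
  hR : 0 < R
  hC : 0 ≤ C
  α0 : 0 < α
  α1 : α < 1
  f0 : ∀ t x, f t x 0 = 0
  fR : ∀ t x, f t x R ≤ 0
  lip : ∀ t x a b, 0 ≤ a → a ≤ R → 0 ≤ b → b ≤ R → |f t x a - f t x b| ≤ K * |a - b|
  cont : ContinuousOn (fun q : ℝ × ℝ × ℝ => f q.1 q.2.1 q.2.2) {q : ℝ × ℝ × ℝ | 0 ≤ q.2.2}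
  hol : ∀ t x y u, 0 ≤ u → u ≤ R → |f t x u - f t y u| ≤ C * |x - y| ^ α

/-- truncation -/
def cl (R w : ℝ) : ℝ := max 0 (min w R)

theorem cl_nonneg (w : ℝ) : 0 ≤ cl R w := le_max_left _ _
theorem cl_le (hR : 0 < R) (w : ℝ) : cl R w ≤ R := max_le hR.le (min_le_right _ _)
theorem cl_cont : Continuous (cl R) := by unfold cl; fun_prop
theorem cl_lip (a b : ℝ) : |cl R a - cl R b| ≤ |a - b| := by
  unfold cl
  refine (abs_max_sub_max_le_abs _ _ 0 |>.trans' (by rw [max_comm 0, max_comm 0])).trans ?_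
  have := abs_min_sub_min_le_max a R b R
  simpa using this
theorem cl_eq {w : ℝ} (h0 : 0 ≤ w) (h1 : w ≤ R) : cl R w = w := by
  unfold cl; rw [min_eq_left h1, max_eq_right h0]

/-- truncated monotone reaction -/
def Ft (K R : ℝ) (f : ℝ → ℝ → ℝ → ℝ) (s y w : ℝ) : ℝ := f s y (cl R w) + K * cl R w

theorem Ft_bd (X : Rx d K R C α f) (s y w : ℝ) : 0 ≤ Ft K R f s y w ∧ Ft K R f s y w ≤ K * R := by
  have h0 := cl_nonneg (R := R) w
  have h1 := cl_le X.hR w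
  have a := abs_le.1 (X.lip s y (cl R w) 0 h0 h1 le_rfl X.hR.le)
  have b := abs_le.1 (X.lip s y (cl R w) R h0 h1 X.hR.le le_rfl)
  rw [X.f0, sub_zero, sub_zero, abs_of_nonneg h0] at a
  rw [abs_sub_comm (cl R w) R, abs_of_nonneg (by linarith)] at b
  have := X.fR s y
  unfold Ft
  constructor <;> nlinarith

theorem Ft_lip (X : Rx d K R C α f) (s y a b : ℝ) :
    |Ft K R f s y a - Ft K R f s y b| ≤ 2 * K * |a - b| := by
  have h1 := X.lip s y (cl R a) (cl R b) (cl_nonneg _) (cl_le X.hR _) (cl_nonneg _) (cl_le X.hR _)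
  have h2 := cl_lip (R := R) a b
  have e : Ft K R f s y a - Ft K R f s y b = (f s y (cl R a) - f s y (cl R b)) +
      K * (cl R a - cl R b) := by unfold Ft; ring
  rw [e]
  refine (abs_add_le _ _).trans ?_
  rw [abs_mul, abs_of_pos X.hK]
  have := mul_le_mul_of_nonneg_left h2 X.hK.le
  linarith

theorem Ft_hol (X : Rx d K R C α f) (s x y w : ℝ) :
    |Ft K R f s x w - Ft K R f s y w| ≤ C * |x - y| ^ α := by
  have := X.hol s x y (cl R w) (cl_nonneg _) (cl_le X.hR _)
  unfold Ft
  rwa [add_sub_add_right_eq_sub]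

theorem Ft_cont (X : Rx d K R C α f) :
    Continuous fun r : ℝ × ℝ × ℝ => Ft K R f r.1 r.2.1 r.2.2 := by
  have hc : Continuous fun r : ℝ × ℝ × ℝ => cl R r.2.2 := cl_cont.comp (by fun_prop)
  have h1 : Continuous fun r : ℝ × ℝ × ℝ => f r.1 r.2.1 (cl R r.2.2) := by
    have h2 : Continuous fun r : ℝ × ℝ × ℝ => ((r.1, r.2.1, cl R r.2.2) : ℝ × ℝ × ℝ) := by fun_prop
    exact X.cont.comp_continuous h2 (fun r => cl_nonneg _)
  exact h1.add (continuous_const.mul hc)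

/-- rescaled source -/
def Hh (K R : ℝ) (f : ℝ → ℝ → ℝ → ℝ) (s y z : ℝ) : ℝ :=
  Real.exp (-(3 * K * max s 0)) * Ft K R f (max s 0) y (Real.exp (3 * K * max s 0) * z)

theorem Hh_abs (X : Rx d K R C α f) (s y z : ℝ) : |Hh K R f s y z| ≤ K * R := by
  have h := Ft_bd X (max s 0) y (Real.exp (3 * K * max s 0) * z)
  have hK := X.hK
  have hR := X.hR
  unfold Hh
  rw [abs_mul, Real.abs_exp, abs_of_nonneg h.1]
  have : Real.exp (-(3 * K * max s 0)) ≤ 1 := Real.exp_le_one_iff.2 (by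
    have : 0 ≤ 3 * K * max s 0 := by positivity
    linarith)
  calc _ ≤ 1 * (K * R) := mul_le_mul this h.2 h.1 zero_le_one
    _ = _ := one_mul _

theorem Hh_lip (X : Rx d K R C α f) (s y a b : ℝ) :
    |Hh K R f s y a - Hh K R f s y b| ≤ 2 * K * |a - b| := by
  have h := Ft_lip X (max s 0) y (Real.exp (3 * K * max s 0) * a) (Real.exp (3 * K * max s 0) * b)
  unfold Hh
  rw [← mul_sub, abs_mul, Real.abs_exp]
  rw [← mul_sub, abs_mul, Real.abs_exp] at h
  calc _ ≤ Real.exp (-(3 * K * max s 0)) * (2 * K * (Real.exp (3 * K * max s 0) * |a - b|)) := by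
        gcongr
    _ = (Real.exp (-(3 * K * max s 0)) * Real.exp (3 * K * max s 0)) * (2 * K * |a - b|) := by ring
    _ = _ := by rw [← Real.exp_add]; simp

theorem Hh_src (X : Rx d K R C α f) {z : ℝ × ℝ → ℝ} (hz : Continuous z) :
    Src (fun s y => Hh K R f s y (z (s, y))) (K * R) := by
  refine ⟨?_, fun s x => Hh_abs X _ _ _⟩
  have h1 := (Ft_cont X).comp (by fun_prop : Continuous fun r : ℝ × ℝ =>
    ((max r.1 0, r.2, Real.exp (3 * K * max r.1 0) * z (r.1, r.2)) : ℝ × ℝ × ℝ))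
  have h2 : Continuous fun r : ℝ × ℝ => Real.exp (-(3 * K * max r.1 0)) := by fun_prop
  exact h2.mul h1

open BoundedContinuousFunction in
theorem heat_fixed (X : Rx d K R C α f) (δ : ℝ) :
    ∃ z : ℝ × ℝ → ℝ, Continuous z ∧ ∀ t x, z (t, x) = δ * Real.exp (-(4 * K * max t 0)) +
      Duh d (4 * K) (fun s y => Hh K R f s y (z (s, y))) (max t 0) x := by
  have hK := X.hK
  have hK4 : 0 < 4 * K := by positivity
  have hcont : ∀ z : ℝ × ℝ →ᵇ ℝ, Continuous fun r : ℝ × ℝ => δ * Real.exp (-(4 * K * max r.1 0)) +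
      Duh d (4 * K) (fun s y => Hh K R f s y (z (s, y))) (max r.1 0) r.2 := by
    intro z
    have h1 := (Hh_src X z.continuous).duh_cont (d := d) (Λ := 4 * K)
    have h2 := h1.comp (by fun_prop : Continuous fun r : ℝ × ℝ => (max r.1 0, r.2))
    have h3 : Continuous fun r : ℝ × ℝ => δ * Real.exp (-(4 * K * max r.1 0)) := by fun_prop
    exact h3.add h2
  have hbd : ∀ (z : ℝ × ℝ →ᵇ ℝ) (r : ℝ × ℝ), ‖δ * Real.exp (-(4 * K * max r.1 0)) +
      Duh d (4 * K) (fun s y => Hh K R f s y (z (s, y))) (max r.1 0) r.2‖ ≤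
      |δ| + K * R / (4 * K) := by
    intro z r
    refine (norm_add_le _ _).trans (add_le_add ?_ ?_)
    · rw [Real.norm_eq_abs, abs_mul, Real.abs_exp]
      have : Real.exp (-(4 * K * max r.1 0)) ≤ 1 := Real.exp_le_one_iff.2 (by
        have : 0 ≤ 4 * K * max r.1 0 := by positivity
        linarith)
      exact mul_le_of_le_one_right (abs_nonneg _) this
    · exact (Hh_src X z.continuous).duh_abs hK4 (le_max_right _ _) _
  set Φ : (ℝ × ℝ →ᵇ ℝ) → (ℝ × ℝ →ᵇ ℝ) := fun z =>
    BoundedContinuousFunction.ofNormedAddCommGroup _ (hcont z) _ (hbd z) with hΦ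
  have hΦv : ∀ z r, Φ z r = δ * Real.exp (-(4 * K * max r.1 0)) +
      Duh d (4 * K) (fun s y => Hh K R f s y (z (s, y))) (max r.1 0) r.2 := fun z r => rfl
  have hcw : ContractingWith (1 / 2) Φ := by
    refine ⟨by norm_num [← NNReal.coe_lt_coe], LipschitzWith.of_dist_le_mul fun z1 z2 => ?_⟩
    rw [BoundedContinuousFunction.dist_le (by positivity)]
    intro r
    rw [hΦv, hΦv, Real.dist_eq, add_sub_add_left_eq_sub, duh_sub (Hh_src X z1.continuous)
      (Hh_src X z2.continuous)]
    have S : Src (fun s y => Hh K R f s y (z1 (s, y)) - Hh K R f s y (z2 (s, y)))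
        (2 * K * dist z1 z2) := by
      refine ⟨(Hh_src X z1.continuous).cont.sub (Hh_src X z2.continuous).cont, fun s y => ?_⟩
      refine (Hh_lip X _ _ _ _).trans ?_
      have := BoundedContinuousFunction.dist_coe_le_dist (f := z1) (g := z2) (s, y)
      rw [Real.dist_eq] at this
      gcongr
    refine (S.duh_abs hK4 (le_max_right _ _) _).trans (le_of_eq ?_)
    push_cast
    field_simp
    norm_num
    ring
  refine ⟨hcw.fixedPoint, (hcw.fixedPoint).continuous, fun t x => ?_⟩
  have := hcw.fixedPoint_isFixedPt
  conv_lhs => rw [← this]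
  exact hΦv _ _

theorem heat_exist (X : Rx d K R C α f) (hδ : 0 ≤ δ) (hδR : δ ≤ R) :
    ∃ w : ℝ → ℝ → ℝ, (Continuous fun r : ℝ × ℝ => w r.1 r.2) ∧
      (∀ t ≥ 0, ∀ x, 0 ≤ w t x ∧ w t x ≤ R) ∧ SolvesPDE d f w {q : ℝ × ℝ | 0 < q.1} ∧
      ∀ x, w 0 x = δ := by
  have hK := X.hK
  have hR := X.hR
  obtain ⟨z, hz, hfix⟩ := heat_fixed X δ
  set w : ℝ → ℝ → ℝ := fun t x => Real.exp (3 * K * max t 0) * z (t, x) with hw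
  set Q : ℝ → ℝ → ℝ := fun s y => Ft K R f (max s 0) y (w s y) with hQ
  have hwc : Continuous fun r : ℝ × ℝ => w r.1 r.2 := by rw [hw]; fun_prop
  have hQc : Continuous fun r : ℝ × ℝ => Q r.1 r.2 :=
    (Ft_cont X).comp (by fun_prop : Continuous fun r : ℝ × ℝ =>
      ((max r.1 0, r.2, w r.1 r.2) : ℝ × ℝ × ℝ))
  have hQ0 : ∀ s y, 0 ≤ Q s y := fun s y => (Ft_bd X _ _ _).1
  have hQ1 : ∀ s y, Q s y ≤ K * R := fun s y => (Ft_bd X _ _ _).2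
  have SQ : Src Q (K * R) := ⟨hQc, fun s x => by rw [abs_of_nonneg (hQ0 s x)]; exact hQ1 s x⟩
  have hrep : ∀ t, 0 ≤ t → ∀ x, w t x = δ * Real.exp (-K * t) + Duh d K Q t x := by
    intro t ht x
    simp only [hw]
    rw [hfix, max_eq_left ht, mul_add]
    congr 1
    · rw [mul_left_comm, ← Real.exp_add]; congr 2; ring
    · unfold Duh
      rw [← intervalIntegral.integral_const_mul]
      refine intervalIntegral.integral_congr fun σ hσ => ?_
      rw [uIcc_of_le ht] at hσ
      unfold Sm
      simp only
      rw [← integral_const_mul, ← integral_const_mul, ← integral_const_mul]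
      congr 1
      funext y
      simp only [Hh, hQ, hw]
      rw [max_eq_left (sub_nonneg.2 hσ.2)]
      have e : Real.exp (3 * K * t) * Real.exp (-(4 * K) * σ) * Real.exp (-(3 * K * (t - σ))) =
          Real.exp (-K * σ) := by
        rw [← Real.exp_add, ← Real.exp_add]; congr 1; ring
      rw [← e]; ring
  have hbd : ∀ t, 0 ≤ t → ∀ x, 0 ≤ w t x ∧ w t x ≤ R := by
    intro t ht x
    rw [hrep t ht x]
    have h1 := duh_between (d := d) hQc hQ0 hQ1 hK ht x
    have h2 := Real.exp_pos (-K * t)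
    have e : K * R * ((1 - Real.exp (-K * t)) / K) = R * (1 - Real.exp (-K * t)) := by
      field_simp
    rw [e] at h1
    constructor
    · have := h1.1
      positivity
    · have := mul_le_mul_of_nonneg_right hδR h2.le
      linarith [h1.2]
  obtain ⟨M, hM⟩ := SQ.duh_lip (Λ := K) X.hd hK
  have hM0 : 0 ≤ |M| := abs_nonneg M
  have HQ : HSrc Q (K * R) (C + 2 * K * |M| + K * R) α := by
    refine { toSrc := SQ, C0 := by have := X.hC; positivity, α0 := X.α0, α1 := X.α1, hol := ?_ }
    intro s x y
    have hC := X.hC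
    have hp : 0 ≤ |x - y| ^ α := by positivity
    rcases le_total |x - y| 1 with h | h
    · have a1 := Ft_hol X (max s 0) x y (w s x)
      have a2 := Ft_lip X (max s 0) y (w s x) (w s y)
      have a3 : |w s x - w s y| ≤ |M| * |x - y| ^ α := by
        have b0 : |x - y| ≤ |x - y| ^ α := by
          have := Real.rpow_le_rpow_of_exponent_ge' (abs_nonneg (x - y)) h X.α0.le X.α1.le
          rwa [Real.rpow_one] at this
        have main : ∀ s, 0 ≤ s → |w s x - w s y| ≤ |M| * |x - y| := by
          intro s hs
          rw [hrep s hs, hrep s hs, add_sub_add_left_eq_sub]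
          exact (hM s hs x y).trans (mul_le_mul_of_nonneg_right (le_abs_self M) (abs_nonneg _))
        rcases le_total 0 s with hs | hs
        · exact (main s hs).trans (mul_le_mul_of_nonneg_left b0 hM0)
        · have e0 : ∀ x, w s x = w 0 x := by
            intro x
            simp only [hw]
            rw [hfix, hfix, max_eq_right hs, max_self]
          rw [e0, e0]
          exact (main 0 le_rfl).trans (mul_le_mul_of_nonneg_left b0 hM0)
      have a4 : |Q s x - Q s y| ≤ C * |x - y| ^ α + 2 * K * (|M| * |x - y| ^ α) := by
        have e : Q s x - Q s y = (Ft K R f (max s 0) x (w s x) - Ft K R f (max s 0) y (w s x)) +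
          (Ft K R f (max s 0) y (w s x) - Ft K R f (max s 0) y (w s y)) := by simp only [hQ]; ring
        rw [e]
        refine (abs_add_le _ _).trans (add_le_add a1 (a2.trans ?_))
        gcongr
      have : 0 ≤ K * R * |x - y| ^ α := by positivity
      linarith
    · have b0 : 1 ≤ |x - y| ^ α := Real.one_le_rpow h X.α0.le
      have b1 : |Q s x - Q s y| ≤ K * R := by
        rw [abs_le]
        constructor <;> linarith [hQ0 s x, hQ0 s y, hQ1 s x, hQ1 s y]
      have b2 : K * R * 1 ≤ K * R * |x - y| ^ α := by gcongr
      have : 0 ≤ C * |x - y| ^ α := by positivity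
      have : 0 ≤ 2 * K * |M| * |x - y| ^ α := by positivity
      linarith
  refine ⟨w, hwc, fun t ht x => hbd t ht x, ?_, fun x => ?_⟩
  · rintro ⟨t, x⟩ ht
    have ht : 0 < t := ht
    have ew : w t = fun x => δ * Real.exp (-K * t) + Duh d K Q t x := funext (hrep t ht.le)
    have d1 : ∀ y, HasDerivAt (w t) (Duh1 d K Q t y) y := by
      intro y; rw [ew]; exact (HQ.duh_deriv X.hd hK ht y).const_add _
    have d1' : deriv (w t) = Duh1 d K Q t := funext fun y => (d1 y).deriv
    have d2 : HasDerivAt (deriv (w t)) (Duh2 d K Q t x) x := by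
      rw [d1']; exact HQ.duh1_deriv X.hd hK ht x
    refine ⟨(d1 x).differentiableAt, d2.differentiableAt, ?_⟩
    simp only
    rw [d2.deriv]
    have k1 : HasDerivAt (fun s => δ * Real.exp (-K * s)) (δ * (Real.exp (-K * t) * (-K * 1))) t :=
      (((hasDerivAt_id' t).const_mul (-K)).exp).const_mul δ
    have k2 := k1.fun_add (HQ.time_deriv X.hd hK ht x)
    have k3 : HasDerivAt (fun s => w s x) _ t := k2.congr_of_eventuallyEq (by
      filter_upwards [lt_mem_nhds ht] with s hs
      exact hrep s hs.le x)
    refine k3.congr_deriv ?_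
    have eQ : Q t x = f t x (w t x) + K * w t x := by
      simp only [hQ, Ft]
      rw [max_eq_left ht.le, cl_eq (hbd t ht.le x).1 (hbd t ht.le x).2]
    rw [eQ]
    have := hrep t ht.le x
    linear_combination K * this
  · rw [hrep 0 le_rfl]
    simp [Duh]

end


theorem spreading_main
    (d μ ω L : ℝ) (hd : 0 < d) (hμ : 0 < μ) (hω : 0 < ω) (hL : 0 < L)
    (f : ℝ → ℝ → ℝ → ℝ) (hf : BasicAssumptions ω L f)
    (p : ℝ → ℝ → ℝ) (hp : HypH d ω L f p) :
    ∃ cminus > (0:ℝ), ∃ cplus > (0:ℝ), Theorem11Conclusion d μ f p cminus cplus := by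
  obtain ⟨M, hM, hneg⟩ := hf.neg_large
  obtain ⟨K', hK'⟩ := f_lip hω hL hf M hM
  obtain ⟨α, ⟨α0, α1⟩, hhol⟩ := hf.holder
  obtain ⟨C, hC, hhol⟩ := hhol M hM
  have hlip : ∀ t x a b, 0 ≤ a → a ≤ M → 0 ≤ b → b ≤ M →
      |f t x a - f t x b| ≤ (max K' 1) * |a - b| := fun t x a b h1 h2 h3 h4 =>
    (hK' t x a b h1 h2 h3 h4).trans
      (mul_le_mul_of_nonneg_right (le_max_left _ _) (abs_nonneg _))
  have hK : 0 < max K' 1 := lt_max_of_lt_right one_pos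
  have X : Rx d (max K' 1) M C α f :=
    { hd := hd, hK := hK, hR := hM, hC := hC.le, α0 := α0, α1 := α1, f0 := hf.zero,
      fR := fun t x => hneg t x M le_rfl, lip := hlip, cont := hf.cont,
      hol := by
        intro t x y u h0 h1
        have := hhol t t x y u h0 h1
        rwa [sub_self, abs_zero, Real.zero_rpow (by positivity), zero_add] at this }
  have key : ∀ δ, 0 < δ → δ ≤ M → ∃ w : ℝ → ℝ → ℝ, (Continuous fun r : ℝ × ℝ => w r.1 r.2) ∧
      (∀ t ≥ 0, ∀ x, 0 ≤ w t x ∧ w t x ≤ M) ∧ SolvesPDE d f w {q | 0 < q.1} ∧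
      (∀ x, w 0 x = δ) ∧
      ∀ ε > 0, ∃ S, ∀ s ≥ S, ∀ t ≥ (0:ℝ), ∀ x : ℝ, |w (t + s) x - p (t + s) x| ≤ ε := by
    intro δ h0 h1
    obtain ⟨w, hc, hb, hs, hi⟩ := heat_exist X h0.le h1
    refine ⟨w, hc, hb, hs, hi, hp.conv (fun _ => δ) continuous_const ⟨|δ|, fun _ => le_rfl⟩
      ⟨δ, h0, fun _ => le_rfl⟩ w ⟨hi, hc.continuousOn, hs, M, fun t ht x => ?_⟩⟩
    rw [abs_of_nonneg (hb t ht x).1]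
    exact (hb t ht x).2
  have hper : ∀ (n : ℕ) t x, p (t + n * ω) x = p t x := fun n t x => by
    have := shift_int (g := fun t => p t x) (fun t => hp.per_t t x) (n : ℤ) t
    simpa using this
  have htop : Tendsto (fun n : ℕ => (n : ℝ) * ω) atTop atTop :=
    tendsto_natCast_atTop_atTop.atTop_mul_const hω
  obtain ⟨w, hwc, hwb, -, -, hwv⟩ := key M hM le_rfl
  have hple : ∀ t x, p t x ≤ M := by
    intro t x
    refine le_of_forall_pos_le_add fun ε hε => ?_
    obtain ⟨S, hS⟩ := hwv ε hε
    obtain ⟨n, hn⟩ := (htop.eventually_ge_atTop (max S 0 - t)).exists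
    have h1 : max S 0 ≤ t + n * ω := by linarith
    have h2 := hS (t + n * ω) ((le_max_left _ _).trans h1) 0 le_rfl x
    rw [zero_add, hper] at h2
    have h3 := (hwb (t + n * ω) ((le_max_right _ _).trans h1) x).2
    have := (abs_le.1 h2).1
    linarith
  have hpc : Continuous fun q : ℝ × ℝ => p q.1 q.2 := by
    have hT : TendstoLocallyUniformly (fun (n : ℕ) (q : ℝ × ℝ) => w (q.1 + n * ω) q.2)
        (fun q : ℝ × ℝ => p q.1 q.2) atTop := by
      rw [Metric.tendstoLocallyUniformly_iff]
      intro ε hε q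
      obtain ⟨S, hS⟩ := hwv (ε / 2) (half_pos hε)
      refine ⟨{r : ℝ × ℝ | q.1 - 1 < r.1}, (isOpen_lt continuous_const continuous_fst).mem_nhds
        (by simp), ?_⟩
      filter_upwards [htop.eventually_ge_atTop (S - (q.1 - 1))] with n hn r hr
      have hr' : q.1 - 1 < r.1 := hr
      have h2 := hS (r.1 + n * ω) (by linarith) 0 le_rfl r.2
      rw [zero_add, hper] at h2
      rw [dist_comm, Real.dist_eq]
      linarith
    refine hT.continuous (Frequently.of_forall fun n => ?_)
    exact hwc.comp (by fun_prop : Continuous fun q : ℝ × ℝ => (q.1 + n * ω, q.2))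
  have E : Env d μ ω L (max K' 1) M f p :=
    { hd := hd, hμ := hμ, hω := hω, hL := hL, hK := hK, hR := hM, f0 := hf.zero, lip := hlip,
      per_t := hf.per_t, per_x := hf.per_x, p_cont := hpc, p_pos := hp.pos, p_le := hple,
      p_per_t := hp.per_t, p_per_x := hp.per_x, p_sol := hp.sol,
      plat := by
        intro δ h0 h1 ε hε
        obtain ⟨v, hc, hb, hs, hi, hv⟩ := key δ h0 h1
        obtain ⟨S, hS⟩ := hv ε hε
        obtain ⟨n, hn⟩ := (htop.eventually_ge_atTop S).exists
        refine ⟨v, hc.continuousOn, hb, hs, hi, n, fun x => ?_⟩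
        have h2 := (abs_le.1 (hS _ hn 0 le_rfl x)).1
        rw [hper, zero_add] at h2
        linarith }
  exact main_of_env E (f_lip hω hL hf)

/-- Theorem 1.1: existence of leftward and rightward asymptotic spreading speeds
for the free boundary problem (1.1). -/
theorem spreading_speed_free_boundary
    (d μ ω L : ℝ) (hd : 0 < d) (hμ : 0 < μ) (hω : 0 < ω) (hL : 0 < L)
    (f : ℝ → ℝ → ℝ → ℝ) (hf : BasicAssumptions ω L f)
    (p : ℝ → ℝ → ℝ) (hp : HypH d ω L f p) :
    ∃ cminus > (0:ℝ), ∃ cplus > (0:ℝ), Theorem11Conclusion d μ f p cminus cplus := by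
  exact spreading_main d μ ω L hd hμ hω hL f hf p hp
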